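/- Let Γ be a group generated by a finite set S. Then Γ has polynomial growth — i.e. there exist C > 0 and d ≥ 0 with |B_S(k)| ≤ C·k^d for all k ≥ 1 — if and only if Γ contains a nilpotent subgroup of finite index. -/

import Mathlib

open Pointwise

namespace Gromov
open scoped Classical commutatorElement

/-- Polynomial growth of degree at most `d`, uniformly over all finite subsets. -/
def PG (d : ℕ) (G : Type*) [Group G] : Prop :=
  ∀ F : Finset G, ∃ C : ℕ, ∀ n : ℕ, 1 ≤ n → (F ^ n).card ≤ C * n ^ d

lemma PG.of_injective {d : ℕ} {G H : Type*} [Group G] [Group H] (f : H →* G)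
    (hf : Function.Injective f) (h : PG d G) : PG d H := by
  intro F
  obtain ⟨C, hC⟩ := h (F.image f)
  refine ⟨C, fun n hn => ?_⟩
  rw [← Finset.card_image_of_injective (F ^ n) hf, Finset.image_pow]
  exact hC n hn

lemma PG.subgroup {d : ℕ} {G : Type*} [Group G] (h : PG d G) (H : Subgroup G) : PG d H :=
  h.of_injective H.subtype H.subtype_injective

lemma PG.of_surjective {d : ℕ} {G H : Type*} [Group G] [Group H] (f : G →* H)
    (hf : Function.Surjective f) (h : PG d G) : PG d H := by
  intro F
  obtain ⟨C, hC⟩ := h (F.image (Function.surjInv hf))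
  refine ⟨C, fun n hn => ?_⟩
  have : F ^ n = ((F.image (Function.surjInv hf)) ^ n).image f := by
    rw [Finset.image_pow, Finset.image_image]
    congr 1
    ext x
    simp
  rw [this]
  exact Finset.card_image_le.trans (hC n hn)

/-- every finite subset of the group generated by a symmetric set containing one is in a power -/
lemma subset_pow_of_gen {G : Type*} [Group G] (T : Finset G) (h1 : (1 : G) ∈ T)
    (hsymm : ∀ x ∈ T, x⁻¹ ∈ T) (F : Finset G)
    (hF : ∀ x ∈ F, x ∈ Subgroup.closure (T : Set G)) :
    ∃ r : ℕ, 1 ≤ r ∧ F ⊆ T ^ r := by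
  have hTinv : T⁻¹ = T := by
    ext x; rw [Finset.mem_inv']
    exact ⟨fun h => by simpa using hsymm _ h, fun h => hsymm _ h⟩
  have key : ∀ x ∈ Subgroup.closure (T : Set G), ∃ r : ℕ, x ∈ T ^ r := by
    intro x hx
    induction hx using Subgroup.closure_induction with
    | mem x hx => exact ⟨1, by simpa using hx⟩
    | one => exact ⟨0, by simp⟩
    | mul x y _ _ hx hy =>
      obtain ⟨r, hr⟩ := hx
      obtain ⟨s, hs⟩ := hy
      exact ⟨r + s, by rw [pow_add]; exact Finset.mul_mem_mul hr hs⟩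
    | inv x _ hx =>
      obtain ⟨r, hr⟩ := hx
      refine ⟨r, ?_⟩
      rw [← hTinv, ← Finset.mem_inv', ← inv_pow, inv_inv]; exact hr
  induction F using Finset.induction_on with
  | empty => exact ⟨1, le_rfl, by simp⟩
  | insert a s ha ih =>
    obtain ⟨r, hr1, hr⟩ := ih (fun x hx => hF x (Finset.mem_insert_of_mem hx))
    obtain ⟨q, hq⟩ := key a (hF a (Finset.mem_insert_self _ _))
    refine ⟨r + q, by omega, ?_⟩
    rw [Finset.insert_subset_iff]
    exact ⟨Finset.pow_subset_pow_right h1 (by omega) hq,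
      hr.trans (Finset.pow_subset_pow_right h1 (by omega))⟩

lemma PG.of_gen {d C : ℕ} {G : Type*} [Group G] (T : Finset G) (h1 : (1 : G) ∈ T)
    (hsymm : ∀ x ∈ T, x⁻¹ ∈ T) (hgen : Subgroup.closure (T : Set G) = ⊤)
    (hC : ∀ n : ℕ, 1 ≤ n → (T ^ n).card ≤ C * n ^ d) : PG d G := by
  intro F
  obtain ⟨r, hr1, hr⟩ := subset_pow_of_gen T h1 hsymm F (by simp [hgen])
  refine ⟨C * r ^ d, fun n hn => ?_⟩
  calc (F ^ n).card ≤ ((T ^ r) ^ n).card := Finset.card_le_card (Finset.pow_subset_pow_left hr)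
    _ = (T ^ (r * n)).card := by rw [pow_mul]
    _ ≤ C * (r * n) ^ d := hC _ (by nlinarith)
    _ = C * r ^ d * n ^ d := by ring

lemma exp_beats (C d : ℕ) : ∃ n : ℕ, 1 ≤ n ∧ C * n ^ d < 2 ^ n := by
  have h := tendsto_pow_const_div_const_pow_of_one_lt d (r := (2:ℝ)) (by norm_num)
  have h2 := (h.const_mul (C:ℝ))
  rw [mul_zero] at h2
  obtain ⟨n, hn, hn1⟩ := ((h2.eventually (gt_mem_nhds (show (0:ℝ) < 1 by norm_num))).and
    (Filter.eventually_ge_atTop 1)).exists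
  refine ⟨n, hn1, ?_⟩
  rw [← mul_div_assoc, div_lt_one (by positivity)] at hn
  exact_mod_cast hn

lemma prod_mem_pow {G : Type*} [Group G] (F : Finset G) (f : Bool → G) (hf : ∀ b, f b ∈ F)
    (l : List Bool) : (l.map f).prod ∈ F ^ l.length := by
  induction l with
  | nil => simp
  | cons a l ih => simp only [List.map_cons, List.prod_cons, List.length_cons, pow_succ']
                   exact Finset.mul_mem_mul (hf a) ih

/-- Pigeonhole: two different words in `t`, `e t` of the same length coincide. -/
lemma PG.collision {d : ℕ} {G : Type*} [Group G] (h : PG d G) (f : Bool → G) :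
    ∃ l l' : List Bool, l.length = l'.length ∧ l ≠ l' ∧ (l.map f).prod = (l'.map f).prod := by
  obtain ⟨C, hC⟩ := h (Finset.univ.image f)
  obtain ⟨n, hn1, hn⟩ := exp_beats C d
  have hlt := (hC n hn1).trans_lt hn
  have hcard : (Finset.univ : Finset (List.Vector Bool n)).card = 2 ^ n := by
    rw [Finset.card_univ, card_vector]; simp
  rw [← hcard] at hlt
  obtain ⟨x, -, y, -, hxy, he⟩ := Finset.exists_ne_map_eq_of_card_lt_of_maps_to hlt
    (f := fun v : List.Vector Bool n => (v.toList.map f).prod) (by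
      intro v _
      have := prod_mem_pow (Finset.univ.image f) f (by simp) v.toList
      rw [v.toList_length] at this
      exact Finset.mem_coe.2 this)
  exact ⟨x.toList, y.toList, by simp, fun h => hxy (List.Vector.toList_injective h), he⟩

end Gromov

namespace Gromov
open scoped Classical commutatorElement

/-- subgroup of elements commuting with everything modulo `Q` -/
lemma commutator_le_of_gens {G : Type*} [Group G] (Q : Subgroup G) [Q.Normal] (K : Subgroup G)
    (X Y : Set G) (hK : K ≤ Subgroup.closure X) (L : Subgroup G) (hL : L ≤ Subgroup.closure Y)
    (h : ∀ x ∈ X, ∀ y ∈ Y, ⁅x, y⁆ ∈ Q) : ⁅K, L⁆ ≤ Q := by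
  have key : ∀ x y : G, ⁅x, y⁆ ∈ Q ↔ Commute (x : G ⧸ Q) (y : G ⧸ Q) := by
    intro x y
    rw [← QuotientGroup.eq_one_iff, ← commutatorElement_eq_one_iff_commute]
    rfl
  rw [Subgroup.commutator_le]
  intro x hx y hy
  rw [key]
  have h1 : ∀ x ∈ X, ∀ y ∈ Subgroup.closure Y, Commute (x : G ⧸ Q) (y : G ⧸ Q) := by
    intro x hx y hy
    induction hy using Subgroup.closure_induction with
    | mem y hy => exact (key _ _).1 (h x hx y hy)
    | one => exact Commute.one_right _
    | mul a b _ _ ha hb => exact Commute.mul_right ha hb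
    | inv a _ ha => exact Commute.inv_right ha
  have hx' := hK hx
  have hy' := hL hy
  clear hx
  induction hx' using Subgroup.closure_induction with
  | mem x hx => exact h1 x hx y hy'
  | one => exact Commute.one_left _
  | mul a b _ _ ha hb => exact Commute.mul_left ha hb
  | inv a _ ha => exact Commute.inv_left ha

lemma normal_of_between {G : Type*} [Group G] (A B M : Subgroup G) (hAB : ⁅A, ⊤⁆ ≤ B)
    (h1 : B ≤ M) (h2 : M ≤ A) : M.Normal := by
  refine ⟨fun n hn g => ?_⟩
  have h3 : ⁅n, g⁆ ∈ M := h1 (hAB (Subgroup.commutator_mem_commutator (h2 hn) trivial))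
  have h4 : ⁅n, g⁆⁻¹ * n ∈ M := M.mul_mem (M.inv_mem h3) hn
  have : ⁅n, g⁆⁻¹ * n = g * n * g⁻¹ := by rw [commutatorElement_def]; group
  rwa [← this]

/-- Lower central factors of a finitely generated group are finitely generated. -/
lemma lcs_fg {G : Type*} [Group G] (S : Finset G) (hS : Subgroup.closure (S : Set G) = ⊤) (i : ℕ) :
    ∃ X : Finset G, (X : Set G) ⊆ (⊤ : Subgroup G).lowerCentralSeries i ∧
      (⊤ : Subgroup G).lowerCentralSeries i =
      Subgroup.closure (X : Set G) ⊔ (⊤ : Subgroup G).lowerCentralSeries (i + 1) := by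
  induction i with
  | zero => exact ⟨S, by simp, by simp [hS]⟩
  | succ i ih =>
    obtain ⟨X, hX, hXe⟩ := ih
    set γ := (⊤ : Subgroup G).lowerCentralSeries with hγ
    have hle : γ (i + 1 + 1) ≤ γ (i + 1) := Subgroup.lowerCentralSeries_antitone _ (Nat.le_succ _)
    have hcomm : ∀ j, γ (j + 1) = ⁅γ j, ⊤⁆ := fun j => rfl
    let Y : Finset G := (X ×ˢ S).image (fun p => ⁅p.1, p.2⁆)
    have hY : (Y : Set G) ⊆ γ (i + 1) := by
      intro y hy
      simp only [Y, Finset.coe_image, Set.mem_image, Finset.mem_coe, Finset.mem_product] at hy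
      obtain ⟨p, ⟨hp, -⟩, rfl⟩ := hy
      exact Subgroup.commutator_mem_commutator (hX hp) trivial
    have hQle : Subgroup.closure (Y : Set G) ⊔ γ (i + 1 + 1) ≤ γ (i + 1) :=
      sup_le ((Subgroup.closure_le _).2 hY) hle
    refine ⟨Y, hY, le_antisymm ?_ hQle⟩
    have : (Subgroup.closure (Y : Set G) ⊔ γ (i + 1 + 1)).Normal :=
      normal_of_between (γ (i + 1)) (γ (i + 1 + 1)) _ le_rfl le_sup_right hQle
    rw [hcomm i]
    refine commutator_le_of_gens _ (γ i) ((X : Set G) ∪ γ (i + 1)) (S : Set G) ?_ ⊤ hS.ge ?_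
    · rw [Subgroup.closure_union, Subgroup.closure_eq]; exact hXe.le
    · rintro x (hx | hx) s hs
      · refine Subgroup.mem_sup_left (Subgroup.subset_closure ?_)
        simp only [Y, Finset.coe_image, Set.mem_image, Finset.mem_coe, Finset.mem_product]
        exact ⟨(x, s), ⟨hx, hs⟩, rfl⟩
      · exact Subgroup.mem_sup_right (Subgroup.commutator_mem_commutator hx trivial)

/-- left-normed commutators of weight `n+1` -/
def simpleComm {G : Type*} [Group G] (X : Set G) : ℕ → Set G
  | 0 => X
  | n + 1 => {z | ∃ y ∈ simpleComm X n, ∃ x ∈ X, z = ⁅y, x⁆}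

/-- If all long left-normed commutators in generators vanish, the group is nilpotent. -/
lemma nilpotent_of_simpleComm : ∀ (n : ℕ) {G : Type*} [Group G] (X : Set G)
    (_ : Subgroup.closure X = ⊤) (_ : ∀ z ∈ simpleComm X n, z = 1), Group.IsNilpotent G := by
  intro n
  induction n with
  | zero =>
    intro G _ X hX h
    have : Subsingleton G := by
      refine ⟨fun a b => ?_⟩
      have : (⊤ : Subgroup G) ≤ ⊥ := by
        rw [← hX, Subgroup.closure_le]; intro x hx; exact h x hx
      rw [this (Subgroup.mem_top a : a ∈ _), this (Subgroup.mem_top b : b ∈ _)]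
    infer_instance
  | succ n ih =>
    intro G _ X hX h
    refine Group.of_quotient_center_nilpotent ?_
    refine ih (QuotientGroup.mk' (Subgroup.center G) '' X) ?_ ?_
    · rw [← MonoidHom.map_closure, hX]
      exact Subgroup.map_top_of_surjective _ (QuotientGroup.mk'_surjective _)
    · have himg : ∀ m, simpleComm (QuotientGroup.mk' (Subgroup.center G) '' X) m ⊆
          QuotientGroup.mk' (Subgroup.center G) '' simpleComm X m := by
        intro m
        induction m with
        | zero => exact subset_rfl
        | succ m ihm =>
          rintro z ⟨y, hy, x, hx, rfl⟩
          obtain ⟨y', hy', rfl⟩ := ihm hy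
          obtain ⟨x', hx', rfl⟩ := hx
          exact ⟨⁅y', x'⁆, ⟨y', hy', x', hx', rfl⟩, map_commutatorElement _ _ _⟩
      intro z hz
      obtain ⟨y, hy, rfl⟩ := himg n hz
      rw [QuotientGroup.mk'_apply, QuotientGroup.eq_one_iff, Subgroup.mem_center_iff]
      intro g
      have hg : g ∈ Subgroup.closure X := by rw [hX]; trivial
      have hc : X ⊆ Subgroup.centralizer {y} := by
        intro x hx
        rw [SetLike.mem_coe, Subgroup.mem_centralizer_singleton_iff]
        exact (commutatorElement_eq_one_iff_mul_comm.1 (h _ ⟨y, hy, x, hx, rfl⟩)).symm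
      have := (Subgroup.closure_le _).2 hc hg
      rwa [Subgroup.mem_centralizer_singleton_iff] at this

/-- An infinite finitely generated abelian group maps nontrivially to the integers. -/
lemma hom_int_of_infinite_comm (B : Type*) [CommGroup B] [Group.FG B] [Infinite B] :
    ∃ f : B →* Multiplicative ℤ, f ≠ 1 := by
  by_contra hcon
  push Not at hcon
  have : Module.Finite ℤ (Additive B) := by
    rw [Module.Finite.iff_addGroup_fg]; infer_instance
  obtain ⟨n, ι, _, p, hp, e, ⟨E⟩⟩ := AddCommGroup.equiv_free_prod_directSum_zmod (Additive B)
  have hz : ∀ g : Additive B →+ ℤ, g = 0 := by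
    intro g
    ext x
    have := DFunLike.congr_fun (hcon (AddMonoidHom.toMultiplicativeRight g)) x
    exact this
  have hn : n = 0 := by
    by_contra hn
    have h0 : 0 < n := Nat.pos_of_ne_zero hn
    have := DFunLike.congr_fun (hz ((Finsupp.applyAddHom (⟨0, h0⟩ : Fin n)).comp
      ((AddMonoidHom.fst _ _).comp E.toAddMonoidHom)))
      (E.symm (Finsupp.single ⟨0, h0⟩ 1, 0))
    simp at this
  subst hn
  have hfin : ∀ i, NeZero (p i ^ e i) := fun i => ⟨pow_ne_zero _ (hp i).ne_zero⟩
  have : Finite (DirectSum ι fun i => ZMod (p i ^ e i)) := by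
    classical
    have : Fintype ι := Fintype.ofFinite ι
    exact Finite.of_equiv _ (DirectSum.addEquivProd (fun i => ZMod (p i ^ e i))).symm.toEquiv
  have : Finite (Additive B) := Finite.of_equiv _ E.symm.toEquiv
  exact not_finite (Additive B)

/-- An infinite finitely generated nilpotent group maps nontrivially to the integers. -/
lemma hom_int_of_infinite_nilpotent (N : Type*) [Group N] [hN : Group.IsNilpotent N] :
    Group.FG N → Infinite N → ∃ f : N →* Multiplicative ℤ, f ≠ 1 := by
  refine Group.nilpotent_center_quotient_ind (P := fun N _ _ => Group.FG N → Infinite N →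
    ∃ f : N →* Multiplicative ℤ, f ≠ 1) N ?_ ?_
  · intro N _ _ _ h; exact absurd h (not_infinite_iff_finite.2 inferInstance)
  · intro N _ _ ih
    intro hfg hinf
    by_cases hq : Infinite (N ⧸ Subgroup.center N)
    · obtain ⟨f, hf⟩ := ih (QuotientGroup.fg _) hq
      refine ⟨f.comp (QuotientGroup.mk' _), fun h => hf ?_⟩
      ext x
      simpa using DFunLike.congr_fun h x
    · rw [not_infinite_iff_finite] at hq
      have hfc : Finite (commutatorSet N) := by
        let g : (N ⧸ Subgroup.center N) × (N ⧸ Subgroup.center N) → N :=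
          fun p => ⁅p.1.out, p.2.out⁆
        refine (Set.finite_range g).subset ?_ |>.to_subtype
        rintro z ⟨a, b, rfl⟩
        refine ⟨((a : N ⧸ Subgroup.center N), (b : N ⧸ Subgroup.center N)), ?_⟩
        obtain ⟨⟨c, hc⟩, h1⟩ := QuotientGroup.mk_out_eq_mul (Subgroup.center N) a
        obtain ⟨⟨d, hd⟩, h2⟩ := QuotientGroup.mk_out_eq_mul (Subgroup.center N) b
        simp only [g, h1, h2]
        rw [Subgroup.mem_center_iff] at hc hd
        simp only [commutatorElement_def, mul_inv_rev]
        have e1 : a * c * (b * d) * (c⁻¹ * a⁻¹) * (d⁻¹ * b⁻¹) = a * (c * (b * d)) * c⁻¹ * a⁻¹ * d⁻¹ * b⁻¹ := by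
          group
        rw [e1, ← hc (b * d)]
        have e2 : a * (b * d * c) * c⁻¹ * a⁻¹ * d⁻¹ * b⁻¹ = a * b * (d * a⁻¹) * d⁻¹ * b⁻¹ := by group
        rw [e2, ← hd a⁻¹]; group
      have hfin : Finite (commutator N) := inferInstance
      have : Infinite (Abelianization N) := by
        by_contra hcon
        rw [not_infinite_iff_finite] at hcon
        have hidx : (commutator N).FiniteIndex :=
          Subgroup.finiteIndex_iff_finite_quotient.2 hcon
        have : Finite N := (Subgroup.finite_iff_finite_and_finiteIndex (commutator N)).2 ⟨hfin, hidx⟩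
        exact not_finite N
      have : Group.FG (Abelianization N) := QuotientGroup.fg _
      obtain ⟨f, hf⟩ := hom_int_of_infinite_comm (Abelianization N)
      refine ⟨f.comp Abelianization.of, fun h => hf ?_⟩
      ext x
      simpa using DFunLike.congr_fun h x

end Gromov

namespace Gromov
open scoped Classical commutatorElement

lemma distort_aux {G : Type*} [Group G] (N : Subgroup G) (hN : N.Normal) (t : G) (j : ℕ) :
    ∀ x ∈ N, x ∈ Subgroup.upperCentralSeries G j → ∃ Y : Finset G, (Y : Set G) ⊆ N ∧ 1 ∈ Y ∧
      ∀ a : ℕ, t ^ a * x * (t ^ a)⁻¹ ∈ Y ^ ((1 + a) ^ j) := by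
  induction j with
  | zero =>
    intro x hx hx0
    rw [Subgroup.upperCentralSeries_zero, Subgroup.mem_bot] at hx0
    subst hx0
    exact ⟨{1}, by simp [N.one_mem], by simp, fun a => by simp⟩
  | succ j ih =>
    intro x hx hxz
    have h1 : ⁅x⁻¹, t⁆ ∈ N := by
      rw [commutatorElement_def, inv_inv, mul_assoc, mul_assoc, ← mul_assoc t]
      exact N.mul_mem (N.inv_mem hx) (hN.conj_mem _ hx _)
    have h2 : ⁅x⁻¹, t⁆ ∈ Subgroup.upperCentralSeries G j :=
      Subgroup.mem_upperCentralSeries_succ_iff.1 (inv_mem hxz) t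
    obtain ⟨Y, hY, hY1, hYa⟩ := ih _ h1 h2
    refine ⟨insert x Y, ?_, Finset.mem_insert_of_mem hY1, ?_⟩
    · rw [Finset.coe_insert, Set.insert_subset_iff]; exact ⟨hx, hY⟩
    · intro a
      induction a with
      | zero => simp
      | succ a iha =>
        have e : t ^ (a + 1) * x * (t ^ (a + 1))⁻¹ =
            (t ^ a * x * (t ^ a)⁻¹) * (t ^ a * ⁅x⁻¹, t⁆ * (t ^ a)⁻¹) := by
          rw [commutatorElement_def, pow_succ]; group
        rw [e]
        have := Finset.mul_mem_mul iha
          (Finset.pow_subset_pow_left (Finset.subset_insert x Y) (hYa a))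
        rw [← pow_add] at this
        refine Finset.pow_subset_pow_right (Finset.mem_insert_of_mem hY1) ?_ this
        calc (1 + a) ^ (j + 1) + (1 + a) ^ j = (1 + a) ^ j * (1 + (a + 1)) := by ring
          _ ≤ (1 + (a + 1)) ^ j * (1 + (a + 1)) :=
            Nat.mul_le_mul_right _ (Nat.pow_le_pow_left (by omega) _)
          _ = _ := by ring

lemma distort {G : Type*} [Group G] (N : Subgroup G) (hN : N.Normal) (t : G) (c : ℕ)
    (hc : Subgroup.upperCentralSeries G c = ⊤) (X : Finset G) (hX : (X : Set G) ⊆ N) :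
    ∃ Y : Finset G, (Y : Set G) ⊆ N ∧ 1 ∈ Y ∧
      ∀ x ∈ X, ∀ a : ℤ, t ^ a * x * (t ^ a)⁻¹ ∈ Y ^ ((1 + a.natAbs) ^ c) := by
  induction X using Finset.induction_on with
  | empty => exact ⟨{1}, by simp [N.one_mem], by simp, by simp⟩
  | insert x s hx ih =>
    rw [Finset.coe_insert, Set.insert_subset_iff] at hX
    obtain ⟨Y, hY, hY1, hYa⟩ := ih hX.2
    obtain ⟨Y1, hY1', hY11, hY1a⟩ := distort_aux N hN t c x hX.1 (by rw [hc]; trivial)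
    obtain ⟨Y2, hY2', hY21, hY2a⟩ := distort_aux N hN t⁻¹ c x hX.1 (by rw [hc]; trivial)
    refine ⟨Y ∪ (Y1 ∪ Y2), ?_, Finset.mem_union_left _ hY1, ?_⟩
    · simp only [Finset.coe_union, Set.union_subset_iff]; exact ⟨hY, hY1', hY2'⟩
    · intro y hy a
      rcases Finset.mem_insert.1 hy with rfl | hy
      · obtain ⟨n, rfl | rfl⟩ := a.eq_nat_or_neg
        · have := hY1a n
          refine Finset.pow_subset_pow_left
            (Finset.subset_union_left.trans Finset.subset_union_right) ?_
          simpa using this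
        · have := hY2a n
          refine Finset.pow_subset_pow_left
            (Finset.subset_union_right.trans Finset.subset_union_right) ?_
          simpa using this
      · exact Finset.pow_subset_pow_left Finset.subset_union_left (hYa y hy a)

/-- polynomial growth of a subgroup -/
def PS {G : Type*} [Group G] (H : Subgroup G) : Prop :=
  ∃ d : ℕ, ∀ F : Finset G, (F : Set G) ⊆ H → ∃ C : ℕ, ∀ n, 1 ≤ n → (F ^ n).card ≤ C * n ^ d

lemma PS.step {G : Type*} [Group G] (N : Subgroup G) (hN : N.Normal) (t : G) (c : ℕ)
    (hc : Subgroup.upperCentralSeries G c = ⊤) (h : PS N) : PS (N ⊔ Subgroup.zpowers t) := by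
  obtain ⟨d, hd⟩ := h
  refine ⟨(c + 1) * d + 1, fun F hF => ?_⟩
  have h1 : ∀ f : F, ∃ p : G × ℤ, p.1 ∈ N ∧ f.1 = p.1 * t ^ p.2 := by
    intro f
    obtain ⟨y, hy, z, hz, e⟩ := Subgroup.mem_sup_of_normal_left.1 (hF f.2)
    obtain ⟨b, rfl⟩ := Subgroup.mem_zpowers_iff.1 hz
    exact ⟨(y, b), hy, e.symm⟩
  choose p hp hpe using h1
  obtain ⟨Y, hY, hY1, hYa⟩ := distort N hN t c hc (Finset.univ.image fun f => (p f).1) (by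
    intro x hx
    simp only [Finset.coe_image, Finset.coe_univ, Set.image_univ, Set.mem_range] at hx
    obtain ⟨f, rfl⟩ := hx
    exact hp f)
  obtain ⟨C, hC⟩ := hd Y hY
  let R : ℕ := ∑ f, (p f).2.natAbs
  have hR : ∀ f, (p f).2.natAbs ≤ R := fun f =>
    Finset.single_le_sum (f := fun f => (p f).2.natAbs) (fun _ _ => Nat.zero_le _)
      (Finset.mem_univ f)
  have key : ∀ n k : ℕ, k ≤ n → ∀ w ∈ F ^ k, ∃ z ∈ Y ^ (k * (1 + R * n) ^ c), ∃ b : ℤ,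
      b.natAbs ≤ R * k ∧ w = z * t ^ b := by
    intro n k
    induction k with
    | zero => intro _ w hw; exact ⟨1, by simp, 0, by simp, by simpa using hw⟩
    | succ k ih =>
      intro hk w hw
      rw [pow_succ] at hw
      obtain ⟨u, hu, f, hf, rfl⟩ := Finset.mem_mul.1 hw
      obtain ⟨z, hz, b, hb, rfl⟩ := ih (by omega) u hu
      have e := hpe ⟨f, hf⟩
      have hf' := hR ⟨f, hf⟩
      have hm := hYa (p ⟨f, hf⟩).1 (Finset.mem_image_of_mem _ (Finset.mem_univ _)) b
      refine ⟨z * (t ^ b * (p ⟨f, hf⟩).1 * (t ^ b)⁻¹), ?_, b + (p ⟨f, hf⟩).2, ?_, ?_⟩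
      · rw [Nat.succ_mul, pow_add]
        refine Finset.mul_mem_mul hz (Finset.pow_subset_pow_right hY1 ?_ hm)
        refine Nat.pow_le_pow_left ?_ _
        have : R * k ≤ R * n := Nat.mul_le_mul_left _ (by omega)
        omega
      · have := Int.natAbs_add_le b (p ⟨f, hf⟩).2
        rw [Nat.mul_succ]; omega
      · simp only at e
        conv_lhs => rw [e]
        rw [zpow_add]; group
  refine ⟨C * (1 + R) ^ (c * d) * (2 * R + 1), fun n hn => ?_⟩
  have hsub : F ^ n ⊆ Y ^ (n * (1 + R * n) ^ c) *
      (Finset.Icc (-((R * n : ℕ) : ℤ)) (R * n : ℕ)).image (fun b => t ^ b) := by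
    intro w hw
    obtain ⟨z, hz, b, hb, rfl⟩ := key n n le_rfl w hw
    refine Finset.mul_mem_mul hz (Finset.mem_image_of_mem _ ?_)
    rw [Finset.mem_Icc]; omega
  have hcard : ((Finset.Icc (-((R * n : ℕ) : ℤ)) (R * n : ℕ)).image (fun b => t ^ b)).card ≤
      2 * R * n + 1 := by
    refine Finset.card_image_le.trans ?_
    rw [Int.card_Icc]
    have : 2 * R * n = 2 * (R * n) := by ring
    omega
  calc (F ^ n).card ≤ _ := Finset.card_le_card hsub
    _ ≤ (Y ^ (n * (1 + R * n) ^ c)).card * (2 * R * n + 1) :=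
      Finset.card_mul_le.trans (Nat.mul_le_mul_left _ hcard)
    _ ≤ (C * (n * (1 + R * n) ^ c) ^ d) * (2 * R * n + n) := by
      refine Nat.mul_le_mul (hC _ ?_) (by omega)
      exact Nat.one_le_iff_ne_zero.2 (by positivity)
    _ ≤ (C * (n * (n + R * n) ^ c) ^ d) * (2 * R * n + n) := by gcongr
    _ = _ := by
      have : n + R * n = (1 + R) * n := by ring
      rw [this, mul_pow (1 + R) n c, mul_pow n, mul_pow ((1 + R) ^ c), ← pow_mul, ← pow_mul,
        show (c + 1) * d + 1 = d + c * d + 1 by ring, pow_succ, pow_add]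
      ring

lemma pg_of_nilpotent {N : Type*} [Group N] [hN : Group.IsNilpotent N] [hfg : Group.FG N] :
    ∃ d, PG d N := by
  obtain ⟨S, hS⟩ := hfg.out
  obtain ⟨c, hc⟩ := hN
  obtain ⟨m, hm⟩ := Subgroup.nilpotent_iff_lowerCentralSeries.1 (⟨c, hc⟩ : Group.IsNilpotent N)
  set γ := (⊤ : Subgroup N).lowerCentralSeries with hγ
  have key : ∀ k, k ≤ m → PS (γ (m - k)) := by
    intro k
    induction k with
    | zero =>
      intro _
      rw [Nat.sub_zero, hm]
      refine ⟨0, fun F hF => ⟨1, fun n _ => ?_⟩⟩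
      have : F ^ n ⊆ {1} := by
        have hF1 : F ⊆ {1} := by intro x hx; simpa using hF hx
        refine (Finset.pow_subset_pow_left hF1).trans ?_
        simp
      simpa using Finset.card_le_card this
    | succ k ih =>
      intro hk
      have ih := ih (by omega)
      obtain ⟨i, hi⟩ : ∃ i, i = m - (k + 1) := ⟨_, rfl⟩
      rw [show m - k = i + 1 by omega] at ih
      rw [← hi]
      obtain ⟨X, hX, hXe⟩ := lcs_fg S hS i
      rw [← hγ] at hX hXe
      rw [hXe]
      have : ∀ Z : Finset N, Z ⊆ X → PS (Subgroup.closure (Z : Set N) ⊔ γ (i + 1)) := by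
        intro Z
        induction Z using Finset.induction_on with
        | empty => intro _; simpa using ih
        | insert z s hz ihs =>
          intro hs
          rw [Finset.insert_subset_iff] at hs
          have hle : Subgroup.closure (s : Set N) ⊔ γ (i + 1) ≤ γ i := by
            refine sup_le ((Subgroup.closure_le _).2 fun x hx => hX (hs.2 hx)) ?_
            exact Subgroup.lowerCentralSeries_antitone _ (Nat.le_succ _)
          have hnorm := normal_of_between (γ i) (γ (i + 1)) _ le_rfl le_sup_right hle
          have := PS.step _ hnorm z c hc (ihs hs.2)
          have e : Subgroup.closure ((insert z s : Finset N) : Set N) ⊔ γ (i + 1) =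
              (Subgroup.closure (s : Set N) ⊔ γ (i + 1)) ⊔ Subgroup.zpowers z := by
            rw [Finset.coe_insert, Set.insert_eq, Subgroup.closure_union,
              Subgroup.zpowers_eq_closure, sup_assoc, sup_comm]
          rw [e]; exact this
      exact this X subset_rfl
  obtain ⟨d, hd⟩ := key m le_rfl
  refine ⟨d, fun F => hd F ?_⟩
  rw [Nat.sub_self]; simp [hγ]

lemma PG.image {d : ℕ} {G H : Type*} [Group G] [Group H] (h : PG d H) (f : H →* G)
    (hf : Function.Injective f) (Y : Finset H) :
    ∃ C : ℕ, ∀ n, 1 ≤ n → ((Y.image f) ^ n).card ≤ C * n ^ d := by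
  obtain ⟨C, hC⟩ := h Y
  refine ⟨C, fun n hn => ?_⟩
  rw [← Finset.image_pow, Finset.card_image_of_injective _ hf]
  exact hC n hn

/-- The easy direction. -/
lemma pg_of_virtually_nilpotent {G : Type*} [Group G] (hfg : Group.FG G) (H : Subgroup G)
    (hH : H.index ≠ 0) (hnil : Group.IsNilpotent H) : ∃ d, PG d G := by
  have : H.FiniteIndex := ⟨hH⟩
  have hHfg : Group.FG H := Subgroup.fg_of_index_ne_zero H
  obtain ⟨d, hd⟩ := pg_of_nilpotent (N := H)
  refine ⟨d, fun F => ?_⟩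
  -- right transversal
  obtain ⟨R', hR', hR1⟩ := H.exists_isComplement_right 1
  have hRfin : R'.Finite := hR'.finite_right_iff.2 this
  set R : Finset G := hRfin.toFinset with hR
  have hR1 : (1 : G) ∈ R := by simpa [hR] using hR1
  have hRc : ∀ g : G, ∃ r ∈ R, g * r⁻¹ ∈ H := by
    intro g
    obtain ⟨⟨h, r⟩, e⟩ := hR'.2 g
    refine ⟨r.1, by simp [hR], ?_⟩
    rw [← e]; simp
  let Y : Finset G := (R * F * R⁻¹).filter (· ∈ H)
  have hRF : R * F ⊆ Y * R := by
    intro g hg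
    obtain ⟨r, hr, hgr⟩ := hRc g
    refine Finset.mem_mul.2 ⟨g * r⁻¹, ?_, r, hr, by simp⟩
    rw [Finset.mem_filter]
    exact ⟨Finset.mul_mem_mul hg (Finset.inv_mem_inv hr), hgr⟩
  have hpow : ∀ n, R * F ^ n ⊆ Y ^ n * R := by
    intro n
    induction n with
    | zero => simp
    | succ n ih =>
      calc R * F ^ (n + 1) = R * F ^ n * F := by rw [pow_succ, mul_assoc]
        _ ⊆ Y ^ n * R * F := Finset.mul_subset_mul_right ih
        _ = Y ^ n * (R * F) := mul_assoc _ _ _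
        _ ⊆ Y ^ n * (Y * R) := Finset.mul_subset_mul_left hRF
        _ = _ := by rw [← mul_assoc, ← pow_succ]
  obtain ⟨C, hC⟩ := hd.image H.subtype H.subtype_injective (Y.subtype (· ∈ H))
  have hYi : (Y.subtype (· ∈ H)).image H.subtype = Y := by
    ext y
    simp only [Finset.mem_image, Finset.mem_subtype, Subgroup.coe_subtype]
    constructor
    · rintro ⟨x, hx, rfl⟩; exact hx
    · intro hy; exact ⟨⟨y, (Finset.mem_filter.1 hy).2⟩, hy, rfl⟩
  refine ⟨C * R.card, fun n hn => ?_⟩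
  calc (F ^ n).card ≤ (Y ^ n * R).card := by
        refine Finset.card_le_card (subset_trans ?_ (hpow n))
        intro x hx
        exact Finset.mem_mul.2 ⟨1, hR1, x, hx, one_mul _⟩
    _ ≤ (Y ^ n).card * R.card := Finset.card_mul_le
    _ ≤ (C * n ^ d) * R.card := by
        refine Nat.mul_le_mul_right _ ?_
        rw [← hYi]
        exact hC n hn
    _ = _ := by ring

end Gromov

namespace Gromov
open scoped Classical commutatorElement
open Filter Topology

/-- weights of a lazy symmetric random walk -/
structure Wt {G : Type*} [Group G] (T : Finset G) (m : G → ℝ) : Prop where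
  one_mem : (1 : G) ∈ T
  symm : ∀ x ∈ T, x⁻¹ ∈ T
  gen : Subgroup.closure (T : Set G) = ⊤
  pos : ∀ s ∈ T, 0 < m s
  inv : ∀ s, m s⁻¹ = m s
  sum : ∑ s ∈ T, m s = 1
  lazy : 1 / 2 ≤ m 1

/-- Markov operator -/
def Pop {G : Type*} [Group G] (T : Finset G) (m : G → ℝ) : (G → ℝ) →ₗ[ℝ] (G → ℝ) where
  toFun f := fun x => ∑ s ∈ T, m s * f (x * s)
  map_add' f g := by ext x; simp [mul_add, Finset.sum_add_distrib]
  map_smul' c f := by ext x; simp [Finset.mul_sum]; refine Finset.sum_congr rfl fun _ _ => by ring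

lemma Pop_apply {G : Type*} [Group G] (T : Finset G) (m : G → ℝ) (f : G → ℝ) (x : G) :
    Pop T m f x = ∑ s ∈ T, m s * f (x * s) := rfl

/-- step distributions -/
noncomputable def pd {G : Type*} [Group G] (T : Finset G) (m : G → ℝ) : ℕ → G → ℝ
  | 0 => fun y => if y = 1 then 1 else 0
  | n + 1 => fun z => ∑ s ∈ T, m s * pd T m n (s⁻¹ * z)

section
variable {G : Type*} [Group G] {T : Finset G} {m : G → ℝ} (hw : Wt T m)
include hw

lemma pd_nonneg (n : ℕ) (y : G) : 0 ≤ pd T m n y := by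
  induction n generalizing y with
  | zero => simp only [pd]; split_ifs <;> norm_num
  | succ n ih => exact Finset.sum_nonneg fun s hs => mul_nonneg (hw.pos s hs).le (ih _)

lemma pd_supp (n : ℕ) (y : G) (h : y ∉ T ^ n) : pd T m n y = 0 := by
  induction n generalizing y with
  | zero => simp only [pd]; rw [if_neg]; simpa using h
  | succ n ih =>
    refine Finset.sum_eq_zero fun s hs => ?_
    rw [ih, mul_zero]
    intro h'
    refine h ?_
    rw [pow_succ']
    exact Finset.mem_mul.2 ⟨s, hs, _, h', by simp⟩

lemma pd_shift (n : ℕ) (s : G) (hs : s ∈ T) (F : G → ℝ → ℝ) (hF : ∀ z, F z 0 = 0) :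
    ∑ y ∈ T ^ n, F (s * y) (pd T m n y) = ∑ z ∈ T ^ (n + 1), F z (pd T m n (s⁻¹ * z)) := by
  have : ∑ y ∈ T ^ n, F (s * y) (pd T m n y) =
      ∑ z ∈ (T ^ n).image (fun y => s * y), F z (pd T m n (s⁻¹ * z)) := by
    rw [Finset.sum_image (by intro a _ b _ h; simpa using h)]
    simp
  rw [this]
  refine Finset.sum_subset ?_ ?_
  · intro z hz
    obtain ⟨y, hy, rfl⟩ := Finset.mem_image.1 hz
    rw [pow_succ']; exact Finset.mul_mem_mul hs hy
  · intro z _ hz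
    rw [pd_supp hw, hF]
    intro h
    exact hz (Finset.mem_image.2 ⟨_, h, by simp⟩)

lemma Pop_pow (n : ℕ) (F : G → ℝ) (x : G) :
    (Pop T m ^ n) F x = ∑ y ∈ T ^ n, pd T m n y * F (x * y) := by
  induction n generalizing x with
  | zero => simp [pd]
  | succ n ih =>
    rw [pow_succ', Module.End.mul_apply, Pop_apply]
    simp only [ih, pd, Finset.sum_mul]
    rw [Finset.sum_comm]
    refine Finset.sum_congr rfl fun s hs => ?_
    have := pd_shift hw n s hs (fun z p => m s * p * F (x * z)) (by simp)
    simp only [mul_assoc] at this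
    simp only [mul_assoc, Finset.mul_sum]
    exact this

lemma Pop_pow_succ (n : ℕ) (F : G → ℝ) :
    (Pop T m ^ (n + 1)) F 1 = ∑ s ∈ T, m s * (Pop T m ^ n) F s := by
  rw [pow_succ', Module.End.mul_apply, Pop_apply]; simp

lemma Pop_at (n : ℕ) (s : G) (hs : s ∈ T) (F : G → ℝ) :
    (Pop T m ^ n) F s = ∑ z ∈ T ^ (n + 1), pd T m n (s⁻¹ * z) * F z := by
  rw [Pop_pow hw]
  exact pd_shift hw n s hs (fun z p => p * F z) (by simp)

lemma Pop_one (n : ℕ) : (Pop T m ^ n) (fun _ => 1) = fun _ => 1 := by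
  induction n with
  | zero => rfl
  | succ n ih =>
    rw [pow_succ', Module.End.mul_apply, ih]; ext x; simp [Pop_apply, hw.sum]

lemma Pop_mono (n : ℕ) {F F' : G → ℝ} (h : ∀ x, F x ≤ F' x) (x : G) :
    (Pop T m ^ n) F x ≤ (Pop T m ^ n) F' x := by
  rw [Pop_pow hw, Pop_pow hw]
  exact Finset.sum_le_sum fun y _ => mul_le_mul_of_nonneg_left (h _) (pd_nonneg hw _ _)

lemma Pop_abs (n : ℕ) {F : G → ℝ} {M : ℝ} (h : ∀ x, |F x| ≤ M) (x : G) :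
    |(Pop T m ^ n) F x| ≤ M := by
  have e : (Pop T m ^ n) (fun _ => M) x = M := by
    have : (fun _ : G => M) = M • (fun _ : G => (1 : ℝ)) := by ext; simp
    rw [this, map_smul, Pop_one hw]; simp
  have e' : (Pop T m ^ n) (fun _ => -M) x = -M := by
    have : (fun _ : G => -M) = (-M) • (fun _ : G => (1 : ℝ)) := by ext; simp
    rw [this, map_smul, Pop_one hw]; simp
  rw [abs_le]
  constructor
  · rw [← e']; exact Pop_mono hw n (fun y => (abs_le.1 (h y)).1) x
  · rw [← e]; exact Pop_mono hw n (fun y => (abs_le.1 (h y)).2) x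

lemma pd_sum (n : ℕ) : ∑ y ∈ T ^ n, pd T m n y = 1 := by
  have := Pop_pow hw n (fun _ => 1) 1
  rw [Pop_one hw] at this
  simpa using this.symm

lemma pd_le (n : ℕ) (s : G) (hs : s ∈ T) (z : G) :
    m s * pd T m n (s⁻¹ * z) ≤ pd T m (n + 1) z :=
  Finset.single_le_sum (f := fun s => m s * pd T m n (s⁻¹ * z))
    (fun s hs => mul_nonneg (hw.pos s hs).le (pd_nonneg hw _ _)) hs

end

/-- entropy -/
noncomputable def Ent {G : Type*} [Group G] (T : Finset G) (m : G → ℝ) (n : ℕ) : ℝ :=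
  - ∑ y ∈ T ^ n, pd T m n y * Real.log (pd T m n y)

section
variable {G : Type*} [Group G] {T : Finset G} {m : G → ℝ} (hw : Wt T m)
include hw

lemma Ent_le (n : ℕ) : Ent T m n ≤ Real.log (T ^ n).card := by
  have hne : (T ^ n).Nonempty := Finset.Nonempty.pow ⟨1, hw.one_mem⟩
  have hN : (0 : ℝ) < (T ^ n).card := by exact_mod_cast hne.card_pos
  have h : ∀ y ∈ T ^ n, -(pd T m n y * Real.log (pd T m n y)) -
      pd T m n y * Real.log (T ^ n).card ≤ 1 / (T ^ n).card - pd T m n y := by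
    intro y _
    rcases (pd_nonneg hw n y).eq_or_lt with h0 | h0
    · rw [← h0]; simp
    · have := Real.log_le_sub_one_of_pos (x := 1 / (pd T m n y * (T ^ n).card)) (by positivity)
      rw [Real.log_div one_ne_zero (by positivity), Real.log_mul h0.ne' hN.ne', Real.log_one] at this
      have := mul_le_mul_of_nonneg_left this h0.le
      have e : pd T m n y * (1 / (pd T m n y * (T ^ n).card) - 1) =
        1 / (T ^ n).card - pd T m n y := by field_simp
      rw [e] at this
      linarith
  have := Finset.sum_le_sum h
  rw [Finset.sum_sub_distrib, Finset.sum_sub_distrib, ← Finset.sum_mul, pd_sum hw,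
    Finset.sum_neg_distrib] at this
  simp only [Finset.sum_const, nsmul_eq_mul] at this
  have e : ((T ^ n).card : ℝ) * (1 / (T ^ n).card) = 1 := by field_simp
  rw [e] at this
  unfold Ent; linarith

/-- Hellinger distance -/
lemma Ent_step (n : ℕ) :
    ∑ s ∈ T, m s * ∑ z ∈ T ^ (n + 1),
      (Real.sqrt (pd T m n (s⁻¹ * z)) - Real.sqrt (pd T m (n + 1) z)) ^ 2 ≤
    Ent T m (n + 1) - Ent T m n := by
  have h1 : Ent T m n = - ∑ s ∈ T, m s * ∑ z ∈ T ^ (n + 1),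
      pd T m n (s⁻¹ * z) * Real.log (pd T m n (s⁻¹ * z)) := by
    have : ∀ s ∈ T, m s * ∑ z ∈ T ^ (n + 1),
      pd T m n (s⁻¹ * z) * Real.log (pd T m n (s⁻¹ * z)) = m s * (- Ent T m n) := by
      intro s hs
      rw [← pd_shift hw n s hs (fun z p => p * Real.log p) (by simp)]
      simp [Ent]
    rw [Finset.sum_congr rfl this, ← Finset.sum_mul, hw.sum]; ring
  have h2 : Ent T m (n + 1) = - ∑ s ∈ T, m s * ∑ z ∈ T ^ (n + 1),
      pd T m n (s⁻¹ * z) * Real.log (pd T m (n + 1) z) := by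
    rw [Ent]
    simp only [Finset.mul_sum]
    rw [Finset.sum_comm]
    congr 1
    refine Finset.sum_congr rfl fun z _ => ?_
    have : pd T m (n + 1) z = ∑ s ∈ T, m s * pd T m n (s⁻¹ * z) := rfl
    generalize Real.log (pd T m (n + 1) z) = L
    rw [this, Finset.sum_mul]
    refine Finset.sum_congr rfl fun s _ => by ring
  rw [h1, h2, neg_sub_neg, ← Finset.sum_sub_distrib]
  refine Finset.sum_le_sum fun s hs => ?_
  rw [← mul_sub, ← Finset.sum_sub_distrib]
  refine mul_le_mul_of_nonneg_left ?_ (hw.pos s hs).le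
  have hq1 : ∑ z ∈ T ^ (n + 1), pd T m n (s⁻¹ * z) = 1 := by
    have := pd_shift hw n s hs (fun _ p => p) (by simp)
    rw [← this]; exact pd_sum hw n
  have h3 : ∀ z ∈ T ^ (n + 1),
      (Real.sqrt (pd T m n (s⁻¹ * z)) - Real.sqrt (pd T m (n + 1) z)) ^ 2 ≤
      (pd T m n (s⁻¹ * z) * Real.log (pd T m n (s⁻¹ * z)) -
        pd T m n (s⁻¹ * z) * Real.log (pd T m (n + 1) z)) +
        (pd T m (n + 1) z - pd T m n (s⁻¹ * z)) := by
    intro z _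
    have hp := pd_nonneg hw (n + 1) z
    rcases (pd_nonneg hw n (s⁻¹ * z)).eq_or_lt with h0 | h0
    · rw [← h0]; simp [Real.sq_sqrt hp]
    · have hp' : 0 < pd T m (n + 1) z :=
        lt_of_lt_of_le (mul_pos (hw.pos s hs) h0) (pd_le hw n s hs z)
      set q := pd T m n (s⁻¹ * z)
      set p := pd T m (n + 1) z
      have a1 : Real.sqrt p ^ 2 = p := Real.sq_sqrt hp
      have a2 : Real.sqrt q ^ 2 = q := Real.sq_sqrt h0.le
      have b1 : 0 < Real.sqrt p := Real.sqrt_pos.2 hp'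
      have b2 : 0 < Real.sqrt q := Real.sqrt_pos.2 h0
      have := Real.log_le_sub_one_of_pos (x := Real.sqrt p / Real.sqrt q) (by positivity)
      rw [Real.log_div b1.ne' b2.ne', Real.log_sqrt hp, Real.log_sqrt h0.le] at this
      have := mul_le_mul_of_nonneg_left this h0.le
      have e : q * (Real.sqrt p / Real.sqrt q - 1) = Real.sqrt p * Real.sqrt q - q := by
        have : q * (Real.sqrt p / Real.sqrt q) = Real.sqrt p * Real.sqrt q := by
          rw [mul_div_assoc', div_eq_iff b2.ne']; nlinarith
        rw [mul_sub, this]; ring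
      rw [e] at this
      nlinarith
  have := Finset.sum_le_sum h3
  rw [Finset.sum_add_distrib, Finset.sum_sub_distrib (f := fun z => pd T m (n + 1) z), hq1,
    pd_sum hw] at this
  linarith

lemma Ent_mono : Monotone (Ent T m) := by
  refine monotone_nat_of_le_succ fun n => ?_
  have := Ent_step hw n
  have h0 : 0 ≤ ∑ s ∈ T, m s * ∑ z ∈ T ^ (n + 1),
      (Real.sqrt (pd T m n (s⁻¹ * z)) - Real.sqrt (pd T m (n + 1) z)) ^ 2 :=
    Finset.sum_nonneg fun s hs => mul_nonneg (hw.pos s hs).le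
      (Finset.sum_nonneg fun _ _ => sq_nonneg _)
  linarith

lemma key_diff : ∃ K : ℝ, 0 < K ∧ ∀ n, ∀ s ∈ T, ∀ F : G → ℝ,
    ((Pop T m ^ n) F s - (Pop T m ^ (n + 1)) F 1) ^ 2 ≤
      K * (Ent T m (n + 1) - Ent T m n) * (Pop T m ^ (n + 1)) (fun x => F x ^ 2) 1 := by
  obtain ⟨δ, hδ, hδm⟩ : ∃ δ : ℝ, 0 < δ ∧ ∀ s ∈ T, δ ≤ m s := by
    obtain ⟨s, hs, h⟩ := Finset.exists_min_image T m ⟨1, hw.one_mem⟩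
    exact ⟨m s, hw.pos s hs, h⟩
  refine ⟨2 * (1 / δ + 1) / δ, by positivity, fun n s hs F => ?_⟩
  set h := ∑ z ∈ T ^ (n + 1),
      (Real.sqrt (pd T m n (s⁻¹ * z)) - Real.sqrt (pd T m (n + 1) z)) ^ 2 with hh
  have hh0 : 0 ≤ h := Finset.sum_nonneg fun _ _ => sq_nonneg _
  have h1 : δ * h ≤ Ent T m (n + 1) - Ent T m n := by
    refine le_trans ?_ (Ent_step hw n)
    refine le_trans (mul_le_mul_of_nonneg_right (hδm s hs) hh0) ?_
    exact Finset.single_le_sum (f := fun s => m s * ∑ z ∈ T ^ (n + 1),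
      (Real.sqrt (pd T m n (s⁻¹ * z)) - Real.sqrt (pd T m (n + 1) z)) ^ 2)
      (fun s hs => mul_nonneg (hw.pos s hs).le (Finset.sum_nonneg fun _ _ => sq_nonneg _)) hs
  rw [Pop_at hw n s hs, Pop_pow hw (n + 1), Pop_pow hw (n + 1)]
  simp only [one_mul]
  set E := ∑ z ∈ T ^ (n + 1), pd T m (n + 1) z * F z ^ 2 with hE
  have hE0 : 0 ≤ E := Finset.sum_nonneg fun _ _ => mul_nonneg (pd_nonneg hw _ _) (sq_nonneg _)
  have e : ∑ z ∈ T ^ (n + 1), pd T m n (s⁻¹ * z) * F z -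
      ∑ z ∈ T ^ (n + 1), pd T m (n + 1) z * F z = ∑ z ∈ T ^ (n + 1),
      (Real.sqrt (pd T m n (s⁻¹ * z)) - Real.sqrt (pd T m (n + 1) z)) *
      ((Real.sqrt (pd T m n (s⁻¹ * z)) + Real.sqrt (pd T m (n + 1) z)) * F z) := by
    rw [← Finset.sum_sub_distrib]
    refine Finset.sum_congr rfl fun z _ => ?_
    have a1 := Real.sq_sqrt (pd_nonneg hw n (s⁻¹ * z))
    have a2 := Real.sq_sqrt (pd_nonneg hw (n + 1) z)
    conv_lhs => rw [← a1, ← a2]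
    ring
  rw [e]
  refine (Finset.sum_mul_sq_le_sq_mul_sq _ _ _).trans ?_
  rw [← hh]
  have h2 : ∑ z ∈ T ^ (n + 1),
      ((Real.sqrt (pd T m n (s⁻¹ * z)) + Real.sqrt (pd T m (n + 1) z)) * F z) ^ 2 ≤
      2 * (1 / δ + 1) * E := by
    rw [hE, Finset.mul_sum]
    refine Finset.sum_le_sum fun z _ => ?_
    have a1 := Real.sq_sqrt (pd_nonneg hw n (s⁻¹ * z))
    have a2 := Real.sq_sqrt (pd_nonneg hw (n + 1) z)
    have a3 : pd T m n (s⁻¹ * z) ≤ 1 / δ * pd T m (n + 1) z := by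
      have := (mul_le_mul_of_nonneg_right (hδm s hs) (pd_nonneg hw n (s⁻¹ * z))).trans
        (pd_le hw n s hs z)
      rw [one_div, ← div_eq_inv_mul, le_div_iff₀ hδ]; linarith
    rw [mul_pow, ← mul_assoc]
    refine mul_le_mul_of_nonneg_right ?_ (sq_nonneg _)
    nlinarith [sq_nonneg (Real.sqrt (pd T m n (s⁻¹ * z)) - Real.sqrt (pd T m (n + 1) z))]
  calc _ ≤ h * (2 * (1 / δ + 1) * E) := mul_le_mul_of_nonneg_left h2 hh0
    _ = 2 * (1 / δ + 1) / δ * (δ * h) * E := by field_simp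
    _ ≤ _ := by gcongr

end
end Gromov

namespace Gromov
open scoped Classical commutatorElement
open Filter Topology

/-- bounded function -/
def Bd {X : Type*} (φ : X → ℝ) : Prop := ∃ M : ℝ, ∀ x, |φ x| ≤ M

section
variable {G : Type*} [Group G] {T : Finset G} {m : G → ℝ} (hw : Wt T m)
include hw

lemma Ent_log {d : ℕ} (hG : PG d G) : ∃ a : ℝ, ∀ n : ℕ, 1 ≤ n →
    Ent T m n ≤ a + d * Real.log n := by
  obtain ⟨C, hC⟩ := hG T
  refine ⟨Real.log C, fun n hn => (Ent_le hw n).trans ?_⟩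
  have hne : (T ^ n).Nonempty := Finset.Nonempty.pow ⟨1, hw.one_mem⟩
  have hN : (0 : ℝ) < (T ^ n).card := by exact_mod_cast hne.card_pos
  have hC0 : C ≠ 0 := by
    rintro rfl
    have := hC n hn
    have := hne.card_pos
    omega
  have hn0 : (n : ℝ) ≠ 0 := by exact_mod_cast (by omega : n ≠ 0)
  rw [← Real.log_pow, ← Real.log_mul (by exact_mod_cast hC0) (pow_ne_zero _ hn0)]
  exact Real.log_le_log hN (by exact_mod_cast hC n hn)

lemma Ent_good {d : ℕ} (hG : PG d G) :
    ∃ᶠ n : ℕ in atTop, ((n : ℝ) + 1) * (Ent T m (n + 1) - Ent T m n) ≤ d + 1 := by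
  intro h
  obtain ⟨N, hN⟩ := eventually_atTop.1 h
  obtain ⟨a, ha⟩ := Ent_log hw hG
  have key : ∀ n, N ≤ n → Ent T m N - (d + 1) * Real.log (N + 1) ≤
      Ent T m n - (d + 1) * Real.log (n + 1) := by
    intro n hn
    induction n, hn using Nat.le_induction with
    | base => exact le_rfl
    | succ n hn ih =>
      refine ih.trans ?_
      have h1 := hN n hn
      push Not at h1
      have hp : (0 : ℝ) < n + 1 := by positivity
      have h2 : Real.log ((n : ℝ) + 1 + 1) - Real.log (n + 1) ≤ 1 / (n + 1) := by
        rw [← Real.log_div (by positivity) (by positivity)]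
        refine (Real.log_le_sub_one_of_pos (by positivity)).trans (le_of_eq ?_)
        field_simp; ring
      have h3 : (d + 1) * (1 / ((n : ℝ) + 1)) ≤ Ent T m (n + 1) - Ent T m n := by
        rw [mul_one_div, div_le_iff₀ hp]; linarith
      have h4 := mul_le_mul_of_nonneg_left h2 (by positivity : (0 : ℝ) ≤ d + 1)
      push_cast
      linarith
  have hlog : Tendsto (fun n : ℕ => Real.log n) atTop atTop :=
    Real.tendsto_log_atTop.comp tendsto_natCast_atTop_atTop
  obtain ⟨n, hn1, hn2⟩ := ((hlog.eventually_gt_atTop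
    (a - (Ent T m N - (d + 1) * Real.log (N + 1)))).and (eventually_ge_atTop (N + 1))).exists
  have h1 := key n (by omega)
  have h2 := ha n (by omega)
  have h3 : Real.log n ≤ Real.log (n + 1) :=
    Real.log_le_log (by exact_mod_cast (by omega : 0 < n)) (by linarith)
  have h4 := mul_le_mul_of_nonneg_left h3 (by positivity : (0 : ℝ) ≤ d + 1)
  linarith

lemma Ent_small {d : ℕ} (hG : PG d G) :
    Tendsto (fun n : ℕ => Ent T m (n + 1) / ((n : ℝ) + 1)) atTop (𝓝 0) := by
  obtain ⟨a, ha⟩ := Ent_log hw hG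
  have h0 : Ent T m 0 = 0 := by simp [Ent, pd]
  have t1 : Tendsto (fun x : ℝ => Real.log x / x) atTop (𝓝 0) :=
    Real.isLittleO_log_id_atTop.tendsto_div_nhds_zero
  have t2 : Tendsto (fun n : ℕ => (n : ℝ) + 1) atTop atTop :=
    tendsto_atTop_add_const_right _ _ tendsto_natCast_atTop_atTop
  have t3 : Tendsto (fun n : ℕ => a / ((n : ℝ) + 1) + d * (Real.log ((n : ℝ) + 1) / ((n : ℝ) + 1)))
      atTop (𝓝 (0 + d * 0)) :=
    (t2.const_div_atTop a).add ((t1.comp t2).const_mul _)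
  rw [mul_zero, add_zero] at t3
  refine tendsto_of_tendsto_of_tendsto_of_le_of_le tendsto_const_nhds t3 (fun n => ?_) fun n => ?_
  · have : Ent T m 0 ≤ Ent T m (n + 1) := Ent_mono hw (Nat.zero_le _)
    rw [h0] at this
    positivity
  · have := ha (n + 1) (by omega)
    push_cast at this
    simp only
    rw [mul_div_assoc', ← add_div]
    gcongr
end

/-- averages along the walk -/
noncomputable def av {G : Type*} [Group G] (T : Finset G) (m : G → ℝ) (n : ℕ) :
    (G → ℝ) →ₗ[ℝ] ℝ :=
  ((n : ℝ) + 1)⁻¹ • ∑ k ∈ Finset.range (n + 1), (LinearMap.proj (1 : G)) ∘ₗ (Pop T m ^ k)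

lemma av_apply {G : Type*} [Group G] (T : Finset G) (m : G → ℝ) (n : ℕ) (φ : G → ℝ) :
    av T m n φ = ((n : ℝ) + 1)⁻¹ * ∑ k ∈ Finset.range (n + 1), (Pop T m ^ k) φ 1 := by
  simp [av]

section
variable {G : Type*} [Group G] {T : Finset G} {m : G → ℝ} (hw : Wt T m)
include hw

lemma Pop_left (n : ℕ) (F : G → ℝ) (g x : G) :
    (Pop T m ^ n) (fun y => F (g * y)) x = (Pop T m ^ n) F (g * x) := by
  rw [Pop_pow hw, Pop_pow hw]; simp [mul_assoc]

lemma av_abs (n : ℕ) {φ : G → ℝ} {M : ℝ} (h : ∀ x, |φ x| ≤ M) : |av T m n φ| ≤ M := by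
  rw [av_apply, abs_mul, abs_of_nonneg (by positivity), inv_mul_le_iff₀ (by positivity)]
  refine (Finset.abs_sum_le_sum_abs _ _).trans ?_
  refine (Finset.sum_le_sum fun k _ => Pop_abs hw k h 1).trans ?_
  simp

lemma av_inv {d : ℕ} (hG : PG d G) {φ : G → ℝ} (hφ : Bd φ) (s : G) (hs : s ∈ T) :
    Tendsto (fun n => av T m n (fun x => φ (s * x)) - av T m n φ) atTop (𝓝 0) := by
  obtain ⟨M, hM⟩ := hφ
  have hM0 : 0 ≤ M := (abs_nonneg _).trans (hM 1)
  obtain ⟨K, hK, hd⟩ := key_diff hw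
  have hΔ : ∀ k, 0 ≤ Ent T m (k + 1) - Ent T m k := fun k => by
    have := Ent_mono hw (Nat.le_succ k); simp only [Nat.succ_eq_add_one] at this; linarith
  have h0 : Ent T m 0 = 0 := by simp [Ent, pd]
  have b1 : ∀ k, |(Pop T m ^ k) φ s - (Pop T m ^ (k + 1)) φ 1| ≤
      Real.sqrt (K * M ^ 2) * Real.sqrt (Ent T m (k + 1) - Ent T m k) := by
    intro k
    rw [← Real.sqrt_mul (by positivity)]
    refine Real.abs_le_sqrt ((hd k s hs φ).trans ?_)
    have : (Pop T m ^ (k + 1)) (fun x => φ x ^ 2) 1 ≤ M ^ 2 := by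
      refine (le_abs_self _).trans (Pop_abs hw _ (fun x => ?_) 1)
      rw [abs_pow]; exact pow_le_pow_left₀ (abs_nonneg _) (hM x) 2
    have := mul_le_mul_of_nonneg_left this (mul_nonneg hK.le (hΔ k))
    linarith
  have b2 : ∀ n : ℕ, ∑ k ∈ Finset.range (n + 1), Real.sqrt (Ent T m (k + 1) - Ent T m k) ≤
      Real.sqrt (((n : ℝ) + 1) * Ent T m (n + 1)) := by
    intro n
    refine Real.le_sqrt_of_sq_le ?_
    have := Finset.sum_mul_sq_le_sq_mul_sq (Finset.range (n + 1)) (fun _ => (1 : ℝ))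
      (fun k => Real.sqrt (Ent T m (k + 1) - Ent T m k))
    simp only [one_mul, one_pow, Finset.sum_const, Finset.card_range, nsmul_eq_mul, mul_one,
      Real.sq_sqrt (hΔ _), Finset.sum_range_sub, h0, sub_zero] at this
    exact_mod_cast this
  have t1 : Tendsto (fun n : ℕ => Real.sqrt (K * M ^ 2) *
      Real.sqrt (Ent T m (n + 1) / ((n : ℝ) + 1)) + 2 * M / ((n : ℝ) + 1)) atTop
      (𝓝 (Real.sqrt (K * M ^ 2) * Real.sqrt 0 + 0)) := by
    refine (((Ent_small hw hG).sqrt).const_mul _).add ?_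
    exact (tendsto_atTop_add_const_right _ _ tendsto_natCast_atTop_atTop).const_div_atTop _
  rw [Real.sqrt_zero, mul_zero, add_zero] at t1
  refine squeeze_zero_norm (fun n => ?_) t1
  rw [Real.norm_eq_abs, av_apply, av_apply, ← mul_sub]
  simp only [Pop_left hw, mul_one]
  have hp : (0 : ℝ) < n + 1 := by positivity
  rw [abs_mul, abs_of_nonneg (by positivity), inv_mul_le_iff₀ hp]
  have e : ∑ k ∈ Finset.range (n + 1), (Pop T m ^ k) φ s -
      ∑ k ∈ Finset.range (n + 1), (Pop T m ^ k) φ 1 =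
      ∑ k ∈ Finset.range (n + 1), ((Pop T m ^ k) φ s - (Pop T m ^ (k + 1)) φ 1) +
      ((Pop T m ^ (n + 1)) φ 1 - (Pop T m ^ 0) φ 1) := by
    rw [← Finset.sum_range_sub (fun k => (Pop T m ^ k) φ 1), ← Finset.sum_add_distrib,
      ← Finset.sum_sub_distrib]
    refine Finset.sum_congr rfl fun k _ => by ring
  rw [e]
  refine (abs_add_le _ _).trans ?_
  rw [mul_add]
  refine add_le_add ?_ ?_
  · refine (Finset.abs_sum_le_sum_abs _ _).trans ((Finset.sum_le_sum fun k _ => b1 k).trans ?_)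
    rw [← Finset.mul_sum, mul_left_comm]
    refine mul_le_mul_of_nonneg_left ((b2 n).trans (le_of_eq ?_)) (Real.sqrt_nonneg _)
    rw [show ((n : ℝ) + 1) * Ent T m (n + 1) =
      ((n : ℝ) + 1) ^ 2 * (Ent T m (n + 1) / ((n : ℝ) + 1)) by field_simp,
      Real.sqrt_mul (by positivity), Real.sqrt_sq hp.le]
  · refine (abs_sub _ _).trans ?_
    rw [mul_div_cancel₀ _ hp.ne']
    have := Pop_abs hw (n + 1) hM 1
    have := Pop_abs hw 0 hM 1
    linarith

/-- energy density -/
lemma harm_energy (f : G → ℝ) (hf : Pop T m f = f) (h1 : f 1 = 0) (n : ℕ) :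
    (Pop T m ^ (n + 1)) (fun x => f x ^ 2) 1 =
      ((n : ℝ) + 1) * av T m n (fun x => ∑ s ∈ T, m s * (f (x * s) - f x) ^ 2) := by
  have e : Pop T m (fun x => f x ^ 2) =
      (fun x => f x ^ 2) + (fun x => ∑ s ∈ T, m s * (f (x * s) - f x) ^ 2) := by
    ext x
    have hx := congrFun hf x
    rw [Pop_apply] at hx ⊢
    simp only [Pi.add_apply]
    have : ∑ s ∈ T, m s * (f (x * s) - f x) ^ 2 = ∑ s ∈ T, m s * f (x * s) ^ 2 -
        2 * f x * ∑ s ∈ T, m s * f (x * s) + (∑ s ∈ T, m s) * f x ^ 2 := by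
      rw [Finset.mul_sum, Finset.sum_mul, ← Finset.sum_sub_distrib, ← Finset.sum_add_distrib]
      refine Finset.sum_congr rfl fun s _ => by ring
    rw [this, hx, hw.sum]; ring
  rw [av_apply, mul_inv_cancel_left₀ (by positivity)]
  induction n with
  | zero => simp [e, h1]
  | succ n ih =>
    rw [Finset.sum_range_succ, ← ih, pow_succ, Module.End.mul_apply, e, map_add]
    rfl

theorem exists_mean {d : ℕ} (hG : PG d G) : ∃ Λ : (G → ℝ) →ₗ[ℝ] ℝ, ∃ K : ℝ, 0 < K ∧
    (∀ φ, Bd φ → (∀ x, 0 ≤ φ x) → 0 ≤ Λ φ) ∧ Λ (fun _ => 1) = 1 ∧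
    (∀ φ, Bd φ → ∀ g : G, Λ (fun x => φ (g * x)) = Λ φ) ∧
    (∀ f : G → ℝ, Pop T m f = f → (∃ L, ∀ x, ∀ s ∈ T, |f (x * s) - f x| ≤ L) →
      ∀ s ∈ T, (f s - f 1) ^ 2 ≤ K * Λ (fun x => ∑ s ∈ T, m s * (f (x * s) - f x) ^ 2)) := by
  have hne := (frequently_iff_neBot (l := atTop)).1 (Ent_good hw hG)
  obtain ⟨U, hU⟩ := Ultrafilter.exists_le _ (h := hne)
  have hU1 : (U : Filter ℕ) ≤ atTop := hU.trans inf_le_left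
  have hU2 := le_principal_iff.1 (hU.trans inf_le_right)
  have hlim : ∀ φ : G → ℝ, Bd φ → ∃ l, Tendsto (fun n => av T m n φ) U (𝓝 l) := by
    rintro φ ⟨M, hM⟩
    have hc : IsCompact (Set.Icc (-M) M) := isCompact_Icc
    obtain ⟨l, -, hl⟩ := hc.ultrafilter_le_nhds (U.map fun n => av T m n φ) (by
      rw [le_principal_iff]
      refine Ultrafilter.mem_coe.2 (Ultrafilter.mem_map.2 (univ_mem' fun n => ?_))
      exact abs_le.1 (av_abs hw n hM))
    exact ⟨l, hl⟩
  have hbadd : ∀ φ ψ : G → ℝ, Bd φ → Bd ψ → Bd (φ + ψ) := by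
    rintro φ ψ ⟨M, hM⟩ ⟨M', hM'⟩
    exact ⟨M + M', fun x => (abs_add_le _ _).trans (add_le_add (hM x) (hM' x))⟩
  have hbsmul : ∀ (c : ℝ) (φ : G → ℝ), Bd φ → Bd (c • φ) := by
    rintro c φ ⟨M, hM⟩
    exact ⟨|c| * M, fun x => by
      simp only [Pi.smul_apply, smul_eq_mul, abs_mul]
      exact mul_le_mul_of_nonneg_left (hM x) (abs_nonneg _)⟩
  let W : Submodule ℝ (G → ℝ) :=
    { carrier := {φ | Bd φ}
      add_mem' := fun ha hb => hbadd _ _ ha hb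
      zero_mem' := ⟨0, by simp⟩
      smul_mem' := fun c _ h => hbsmul c _ h }
  choose! lim hlim using hlim
  let Λ0 : W →ₗ[ℝ] ℝ :=
    { toFun := fun φ => lim φ.1
      map_add' := fun φ ψ => by
        refine tendsto_nhds_unique (hlim _ (φ + ψ).2) ?_
        simpa using (hlim _ φ.2).add (hlim _ ψ.2)
      map_smul' := fun c φ => by
        refine tendsto_nhds_unique (hlim _ (c • φ).2) ?_
        simpa using (hlim _ φ.2).const_mul c }
  obtain ⟨Λ, hΛ⟩ := LinearMap.exists_extend Λ0
  have hΛt : ∀ φ, Bd φ → Tendsto (fun n => av T m n φ) U (𝓝 (Λ φ)) := by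
    intro φ hφ
    have : Λ φ = lim φ := by
      have := LinearMap.congr_fun hΛ (⟨φ, hφ⟩ : W)
      exact this
    rw [this]; exact hlim φ hφ
  obtain ⟨K, hK, hd⟩ := key_diff hw
  have hB1 : Bd (fun _ : G => (1 : ℝ)) := ⟨1, by simp⟩
  have hinv : ∀ s ∈ T, ∀ φ, Bd φ → Λ (fun x => φ (s * x)) = Λ φ := by
    intro s hs φ hφ
    have hφ' : Bd (fun x => φ (s * x)) := by
      obtain ⟨M, hM⟩ := hφ; exact ⟨M, fun x => hM _⟩
    have t := (hΛt _ hφ').sub (hΛt _ hφ)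
    have := tendsto_nhds_unique t ((av_inv hw hG hφ s hs).mono_left hU1)
    linarith
  refine ⟨Λ, K * (d + 1), by positivity, ?_, ?_, ?_, ?_⟩
  · intro φ hφ h0
    refine ge_of_tendsto' (hΛt φ hφ) fun n => ?_
    rw [av_apply]
    refine mul_nonneg (by positivity) (Finset.sum_nonneg fun k _ => ?_)
    have := Pop_mono hw k (F := 0) (F' := φ) h0 1
    simpa using this
  · refine tendsto_nhds_unique (hΛt _ hB1) (Tendsto.congr (f₁ := fun _ => 1) (fun n => ?_)
      tendsto_const_nhds)
    rw [av_apply]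
    simp only [Pop_one hw, Finset.sum_const, Finset.card_range, nsmul_eq_mul, mul_one]
    push_cast
    rw [inv_mul_cancel₀ (by positivity)]
  · intro φ hφ g
    have hg : g ∈ Subgroup.closure (T : Set G) := by rw [hw.gen]; trivial
    induction hg using Subgroup.closure_induction generalizing φ with
    | mem s hs => exact hinv s hs φ hφ
    | one => simp
    | mul a b _ _ ha hb =>
      have hφ' : Bd (fun x => φ (a * x)) := by
        obtain ⟨M, hM⟩ := hφ; exact ⟨M, fun x => hM _⟩
      have := hb _ hφ'
      rw [← ha φ hφ, ← this]
      simp [mul_assoc]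
    | inv a _ ha =>
      have hφ' : Bd (fun x => φ (a⁻¹ * x)) := by
        obtain ⟨M, hM⟩ := hφ; exact ⟨M, fun x => hM _⟩
      have := ha _ hφ'
      rw [← this]; simp
  · rintro f hf ⟨L, hL⟩ s hs
    have hB : Bd (fun x => ∑ s ∈ T, m s * (f (x * s) - f x) ^ 2) := by
      refine ⟨∑ s ∈ T, m s * L ^ 2, fun x => ?_⟩
      rw [abs_of_nonneg (Finset.sum_nonneg fun s hs => mul_nonneg (hw.pos s hs).le (sq_nonneg _))]
      refine Finset.sum_le_sum fun s hs => mul_le_mul_of_nonneg_left ?_ (hw.pos s hs).le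
      rw [← sq_abs]; exact pow_le_pow_left₀ (abs_nonneg _) (hL x s hs) 2
    refine ge_of_tendsto ((hΛt _ hB).const_mul _) (mem_of_superset hU2 fun n hn => ?_)
    set f0 : G → ℝ := fun x => f x - f 1 with hf0
    have hf0h : Pop T m f0 = f0 := by
      have : f0 = f - f 1 • (fun _ => 1) := by ext x; simp [hf0]
      have h1 := Pop_one hw 1
      rw [pow_one] at h1
      rw [this, map_sub, map_smul, hf, h1]
    have hpow : ∀ k, (Pop T m ^ k) f0 = f0 := by
      intro k
      induction k with
      | zero => rfl
      | succ k ih => rw [pow_succ, Module.End.mul_apply, hf0h, ih]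
    have h10 : f0 1 = 0 := by simp [hf0]
    have h2 := hd n s hs f0
    rw [hpow, hpow, h10, sub_zero, harm_energy hw f0 hf0h h10] at h2
    have e : (fun x => ∑ s ∈ T, m s * (f0 (x * s) - f0 x) ^ 2) =
        (fun x => ∑ s ∈ T, m s * (f (x * s) - f x) ^ 2) := by
      ext x; simp [hf0]
    rw [e] at h2
    refine h2.trans ?_
    have hav : 0 ≤ av T m n (fun x => ∑ s ∈ T, m s * (f (x * s) - f x) ^ 2) := by
      rw [av_apply]
      refine mul_nonneg (by positivity) (Finset.sum_nonneg fun k _ => ?_)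
      have := Pop_mono hw k (F := 0) (F' := (fun x => ∑ s ∈ T, m s * (f (x * s) - f x) ^ 2))
        (fun x => Finset.sum_nonneg fun s hs => mul_nonneg (hw.pos s hs).le (sq_nonneg _)) 1
      simpa using this
    have h3 := mul_le_mul_of_nonneg_right (mul_le_mul_of_nonneg_left hn hK.le) hav
    refine le_trans (le_of_eq ?_) h3
    ring
end
end Gromov

namespace Gromov
open scoped Classical commutatorElement ENNReal
open Filter Topology

theorem trace_bound {V X ι : Type*} [AddCommGroup V] [Module ℝ V] [Fintype ι]
    (ev : X → ι → V →ₗ[ℝ] ℝ) (w : ι → ℝ) (hw : ∀ i, 0 ≤ w i) (hw1 : ∑ i, w i = 1)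
    (Λ : (X → ℝ) →ₗ[ℝ] ℝ) (K : ℝ) (hK : 0 < K)
    (hpos : ∀ φ, Bd φ → (∀ x, 0 ≤ φ x) → 0 ≤ Λ φ) (hone : Λ (fun _ => 1) = 1)
    (hbd : ∀ v, ∃ L : ℝ, ∀ x i, |ev x i v| ≤ L)
    (hev : ∀ v x i, (ev x i v) ^ 2 ≤ K * Λ (fun y => ∑ j, w j * (ev y j v * ev y j v)))
    (hsep : ∀ v, (∀ x i, ev x i v = 0) → v = 0) : FiniteDimensional ℝ V := by
  let D : V → V → X → ℝ := fun F F' x => ∑ s, w s * (ev x s F * ev x s F')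
  let B : LinearMap.BilinForm ℝ V := LinearMap.mk₂ ℝ (fun F F' => Λ (D F F'))
    (fun a b c => by
      rw [← map_add]; congr 1; ext x
      simp only [D, Pi.add_apply, ← Finset.sum_add_distrib, map_add]
      refine Finset.sum_congr rfl fun s _ => by ring)
    (fun r a b => by
      rw [← map_smul]; congr 1; ext x
      simp only [D, Pi.smul_apply, smul_eq_mul, Finset.mul_sum, map_smul]
      refine Finset.sum_congr rfl fun s _ => by ring)
    (fun a b c => by
      rw [← map_add]; congr 1; ext x
      simp only [D, Pi.add_apply, ← Finset.sum_add_distrib, map_add]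
      refine Finset.sum_congr rfl fun s _ => by ring)
    (fun r a b => by
      rw [← map_smul]; congr 1; ext x
      simp only [D, Pi.smul_apply, smul_eq_mul, Finset.mul_sum, map_smul]
      refine Finset.sum_congr rfl fun s _ => by ring)
  have hB : ∀ F F', B F F' = Λ (D F F') := fun F F' => rfl
  have hBs : ∀ F F', B F F' = B F' F := fun F F' => by
    rw [hB, hB]; congr 1; ext x
    exact Finset.sum_congr rfl fun s _ => by ring
  replace hev : ∀ v x i, (ev x i v) ^ 2 ≤ K * B v v := hev
  have hD0 : ∀ F x, 0 ≤ D F F x := fun F x =>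
    Finset.sum_nonneg fun s _ => mul_nonneg (hw s) (mul_self_nonneg _)
  have hBd2 : ∀ F, Bd (D F F) := by
    intro F
    obtain ⟨L, hL⟩ := hbd F
    refine ⟨∑ s, w s * (L * L), fun y => (Finset.abs_sum_le_sum_abs _ _).trans ?_⟩
    refine Finset.sum_le_sum fun s _ => ?_
    rw [abs_mul, abs_of_nonneg (hw s), abs_mul]
    refine mul_le_mul_of_nonneg_left ?_ (hw s)
    exact mul_le_mul (hL _ _) (hL _ _) (abs_nonneg _) ((abs_nonneg _).trans (hL y s))
  have hB0 : ∀ F, B F F = 0 → F = 0 := by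
    intro F h
    refine hsep F fun x s => ?_
    have := hev F x s
    rw [h, mul_zero] at this
    exact pow_eq_zero_iff (two_ne_zero) |>.1 (le_antisymm this (sq_nonneg _))
  have hBp : ∀ F, 0 ≤ B F F := fun F => hpos _ (hBd2 F) (hD0 F)
  have hrank : Module.rank ℝ V ≤ (⌈K⌉₊ : ℕ) := by
    refine rank_le fun S hS => ?_
    set U := Submodule.span ℝ (Set.range fun i : S => (i : V)) with hU
    have hfin : FiniteDimensional ℝ U := FiniteDimensional.span_of_finite ℝ (Set.finite_range _)
    have hcard : Module.finrank ℝ U = S.card := by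
      rw [hU, finrank_span_eq_card hS, Fintype.card_coe]
    let B' : LinearMap.BilinForm ℝ U := B.domRestrict₁₂ U U
    obtain ⟨v, hv⟩ := LinearMap.BilinForm.exists_orthogonal_basis (B := B')
      ⟨fun x y => hBs _ _⟩
    have hvo : ∀ i j, i ≠ j → B (v i).1 (v j).1 = 0 := fun i j hij => hv hij
    have hbp : ∀ i, 0 < B (v i).1 (v i).1 := fun i => lt_of_le_of_ne (hBp _) fun h => by
      exact v.ne_zero i (Subtype.ext (hB0 _ h.symm))
    have hpt : ∀ x s, ∑ i, (ev x s (v i).1) ^ 2 / B (v i).1 (v i).1 ≤ K := by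
      intro x s
      set t := ∑ i, (ev x s (v i).1) ^ 2 / B (v i).1 (v i).1 with ht
      let c : Fin (Module.finrank ℝ U) → ℝ := fun i => (ev x s (v i).1) / B (v i).1 (v i).1
      let F : V := ∑ i, c i • (v i).1
      have h1 : ev x s F = t := by
        simp only [F, map_sum, map_smul, ht]
        refine Finset.sum_congr rfl fun i _ => by simp only [c, smul_eq_mul]; ring
      have h2 : B F F = t := by
        simp only [F, map_sum, LinearMap.sum_apply, map_smul, LinearMap.smul_apply, smul_eq_mul]
        rw [ht]
        refine Finset.sum_congr rfl fun i _ => ?_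
        rw [Finset.sum_eq_single i]
        · have := (hbp i).ne'
          simp only [c]; field_simp
        · intro j _ hj; rw [hvo _ _ hj]; ring
        · simp
      have h3 := hev F x s
      rw [h1, h2] at h3
      have ht0 : 0 ≤ t := by rw [← h2]; exact hBp F
      rcases ht0.eq_or_lt with h | h
      · rw [← h]; exact hK.le
      · nlinarith
    have hfinal : (Module.finrank ℝ U : ℝ) ≤ K := by
      have e1 : Λ (∑ i, (B (v i).1 (v i).1)⁻¹ • D (v i).1 (v i).1) = Module.finrank ℝ U := by
        rw [map_sum]
        have : ∀ i ∈ Finset.univ, Λ ((B (v i).1 (v i).1)⁻¹ • D (v i).1 (v i).1) = 1 := by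
          intro i _
          rw [map_smul, ← hB, smul_eq_mul, inv_mul_cancel₀ (hbp i).ne']
        rw [Finset.sum_congr rfl this]; simp
      have e2 : 0 ≤ Λ (K • (fun _ => 1) - ∑ i, (B (v i).1 (v i).1)⁻¹ • D (v i).1 (v i).1) := by
        have hle : ∀ x, 0 ≤ (K • (fun _ => 1) -
            ∑ i, (B (v i).1 (v i).1)⁻¹ • D (v i).1 (v i).1 : X → ℝ) x := by
          intro x
          have : (∑ i, (B (v i).1 (v i).1)⁻¹ • D (v i).1 (v i).1 : X → ℝ) x =
              ∑ s, w s * ∑ i, (ev x s (v i).1) ^ 2 / B (v i).1 (v i).1 := by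
            simp only [Finset.sum_apply, Pi.smul_apply, smul_eq_mul, D, Finset.mul_sum]
            rw [Finset.sum_comm]
            refine Finset.sum_congr rfl fun s _ => Finset.sum_congr rfl fun i _ => ?_
            rw [div_eq_mul_inv]; ring
          rw [Pi.sub_apply, this]
          have h5 : ∑ s, w s * ∑ i, (ev x s (v i).1) ^ 2 / B (v i).1 (v i).1 ≤
              ∑ s, w s * K :=
            Finset.sum_le_sum fun s _ => mul_le_mul_of_nonneg_left (hpt x s) (hw s)
          rw [← Finset.sum_mul, hw1] at h5
          simp only [Pi.smul_apply, smul_eq_mul]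
          linarith
        refine hpos _ ⟨K, fun x => ?_⟩ hle
        rw [abs_of_nonneg (hle x)]
        simp only [Pi.sub_apply, Pi.smul_apply, smul_eq_mul, mul_one, Finset.sum_apply]
        rw [sub_le_self_iff]
        exact Finset.sum_nonneg fun i _ => mul_nonneg (inv_nonneg.2 (hbp i).le) (hD0 _ _)
      rw [map_sub, map_smul, hone, e1] at e2
      simpa using e2
    rw [← hcard]
    exact_mod_cast hfinal.trans (Nat.le_ceil K)
  exact Module.rank_lt_aleph0_iff.1 (hrank.trans_lt (Cardinal.natCast_lt_aleph0))

lemma memlp_top {ι : Type*} {f : ι → ℝ} : Memℓp (E := fun _ => ℝ) f ∞ ↔ Bd f := by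
  rw [memℓp_infty_iff]
  constructor
  · rintro ⟨M, hM⟩; exact ⟨M, fun x => hM ⟨x, rfl⟩⟩
  · rintro ⟨M, hM⟩; exact ⟨M, by rintro _ ⟨x, rfl⟩; exact hM x⟩

/-- gradients of Lipschitz harmonic functions -/
def HW {G : Type*} [Group G] (T : Finset G) (m : G → ℝ) :
    Submodule ℝ (lp (fun _ : G × T => ℝ) ∞) where
  carrier := {F | ∃ f, Pop T m f = f ∧ ∀ x (s : T), F (x, s) = f (x * s) - f x}
  add_mem' := by
    rintro F F' ⟨f, hf, h⟩ ⟨f', hf', h'⟩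
    exact ⟨f + f', by rw [map_add, hf, hf'], fun x s => by simp [h, h']; ring⟩
  zero_mem' := ⟨0, by simp, by simp⟩
  smul_mem' := by
    rintro c F ⟨f, hf, h⟩
    exact ⟨c • f, by rw [map_smul, hf], fun x s => by simp [h]; ring⟩

lemma Pop_left1 {G : Type*} [Group G] (T : Finset G) (m : G → ℝ) (f : G → ℝ) (hf : Pop T m f = f)
    (g : G) : Pop T m (fun x => f (g * x)) = fun x => f (g * x) := by
  ext x
  have := congrFun hf (g * x)
  rw [Pop_apply] at this ⊢
  simpa [mul_assoc] using this

/-- left translation -/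
noncomputable def shift {G : Type*} [Group G] (T : Finset G) (m : G → ℝ) (g : G) :
    HW T m →ₗ[ℝ] HW T m where
  toFun F := ⟨⟨fun p => F.1 (g⁻¹ * p.1, p.2), memlp_top.2 (by
      obtain ⟨M, hM⟩ := memlp_top.1 F.1.2
      exact ⟨M, fun x => hM _⟩)⟩, by
    obtain ⟨f, hf, h⟩ := F.2
    exact ⟨fun x => f (g⁻¹ * x), Pop_left1 T m f hf _, fun x s => by
      have := h (g⁻¹ * x) s; rw [mul_assoc] at this; exact this⟩⟩
  map_add' F F' := rfl
  map_smul' c F := rfl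

lemma shift_apply {G : Type*} [Group G] (T : Finset G) (m : G → ℝ) (g : G) (F : HW T m)
    (x : G) (s : T) : (shift T m g F).1 (x, s) = F.1 (g⁻¹ * x, s) := rfl

lemma shift_norm {G : Type*} [Group G] (T : Finset G) (m : G → ℝ) (g : G) (F : HW T m) :
    ‖shift T m g F‖ ≤ 1 * ‖F‖ := by
  rw [one_mul]
  refine lp.norm_le_of_forall_le (norm_nonneg _) fun p => ?_
  exact lp.norm_apply_le_norm (by simp) F.1 _

/-- translation representation -/
noncomputable def rep {G : Type*} [Group G] (T : Finset G) (m : G → ℝ) :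
    G →* Module.End ℝ (HW T m) where
  toFun g := shift T m g
  map_one' := by
    ext F ⟨x, s⟩
    change F.1 (1⁻¹ * x, s) = F.1 (x, s)
    simp
  map_mul' g h := by
    ext F ⟨x, s⟩
    change F.1 ((g * h)⁻¹ * x, s) = F.1 (h⁻¹ * (g⁻¹ * x), s)
    simp [mul_assoc]

lemma rep_norm {G : Type*} [Group G] (T : Finset G) (m : G → ℝ) (g : G) (F : HW T m) :
    ‖rep T m g F‖ ≤ ‖F‖ := by
  have := shift_norm T m g F
  rwa [one_mul] at this

lemma rep_apply {G : Type*} [Group G] (T : Finset G) (m : G → ℝ) (g : G) (F : HW T m)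
    (x : G) (s : T) : (rep T m g F).1 (x, s) = F.1 (g⁻¹ * x, s) := rfl

/-- evaluation functionals -/
def evT {G : Type*} [Group G] (T : Finset G) (m : G → ℝ) (x : G) (s : T) : HW T m →ₗ[ℝ] ℝ where
  toFun F := F.1 (x, s)
  map_add' _ _ := rfl
  map_smul' _ _ := rfl

theorem HW_finite {G : Type*} [Group G] {T : Finset G} {m : G → ℝ} (hw : Wt T m)
    {d : ℕ} (hG : PG d G) : FiniteDimensional ℝ (HW T m) := by
  obtain ⟨Λ, K, hK, hpos, hone, hinv, hharm⟩ := exists_mean hw hG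
  refine trace_bound (X := G) (ι := T)
    (evT T m) (fun s => m s) (fun s => (hw.pos s s.2).le)
    (by rw [Finset.sum_coe_sort T, hw.sum]) Λ K hK hpos hone ?_ ?_ ?_
  · intro F
    obtain ⟨L, hL⟩ := memlp_top.1 F.1.2
    exact ⟨L, fun x s => hL _⟩
  · intro F x s
    change F.1 (x, s) ^ 2 ≤ K * Λ (fun y => ∑ j : T, m j * (F.1 (y, j) * F.1 (y, j)))
    obtain ⟨f, hf, h⟩ := F.2
    obtain ⟨L, hL⟩ := memlp_top.1 F.1.2
    have h1 := hharm (fun y => f (x * y)) (Pop_left1 T m f hf x) ⟨L, fun y s hs => by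
      have := h (x * y) ⟨s, hs⟩
      simp only [← mul_assoc]
      rw [← this]; exact hL _⟩ s s.2
    simp only [mul_one, ← h] at h1
    refine h1.trans (le_of_eq ?_)
    congr 1
    have hBd : Bd (fun y => ∑ j : T, m j * (F.1 (y, j) * F.1 (y, j))) := by
      refine ⟨∑ s : T, m s * L ^ 2, fun y => (Finset.abs_sum_le_sum_abs _ _).trans ?_⟩
      refine Finset.sum_le_sum fun s _ => ?_
      rw [abs_mul, abs_of_pos (hw.pos s s.2), ← sq, abs_pow]
      refine mul_le_mul_of_nonneg_left ?_ (hw.pos s s.2).le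
      exact pow_le_pow_left₀ (abs_nonneg _) (hL _) 2
    rw [← hinv _ hBd x]
    congr 1
    ext y
    rw [← Finset.sum_coe_sort T]
    refine Finset.sum_congr rfl fun s _ => ?_
    rw [← mul_assoc, ← h, sq]
  · intro F h
    ext ⟨x, s⟩
    exact h x s

end Gromov

namespace Gromov
open scoped Classical commutatorElement
open Filter Topology

section
variable {G : Type*} [Group G] {T : Finset G} {m : G → ℝ} (hw : Wt T m)
variable {V : Type*} [AddCommGroup V] [Module ℝ V] (U : G →* Module.End ℝ V)
  (B : LinearMap.BilinForm ℝ V) (hs : ∀ u v, B u v = B v u) (hp : ∀ u, 0 ≤ B u u)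
  (hU : ∀ g u v, B (U g u) (U g v) = B u v)

/-- averaging operator -/
noncomputable def avg (T : Finset G) (m : G → ℝ) (U : G →* Module.End ℝ V) : Module.End ℝ V :=
  ∑ s ∈ T, m s • U s

lemma avg_apply (u : V) : avg T m U u = ∑ s ∈ T, m s • U s u := by
  simp [avg]

include hU in
lemma U_adj (g : G) (u v : V) : B (U g u) v = B u (U g⁻¹ v) := by
  rw [← hU g u (U g⁻¹ v), ← Module.End.mul_apply (U g), ← map_mul]; simp

include hw hU in
lemma avg_adj (u v : V) : B (avg T m U u) v = B u (avg T m U v) := by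
  rw [avg_apply, avg_apply]
  simp only [map_sum, LinearMap.sum_apply, map_smul, LinearMap.smul_apply, smul_eq_mul]
  refine Finset.sum_bij' (fun s _ => s⁻¹) (fun s _ => s⁻¹) (fun s h => hw.symm s h)
    (fun s h => hw.symm s h) (by simp) (by simp) ?_
  intro s _
  rw [U_adj U B hU, hw.inv]

include hs hU in
lemma B_diff (g : G) (w : V) : B (U g w - w) (U g w - w) = 2 * B w w - 2 * B (U g w) w := by
  simp only [map_sub, LinearMap.sub_apply]
  rw [hU, hs w (U g w)]; ring

include hs hU in
lemma B_sum (g : G) (w : V) : B (U g w + w) (U g w + w) = 2 * B w w + 2 * B (U g w) w := by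
  simp only [map_add, LinearMap.add_apply]
  rw [hU, hs w (U g w)]; ring

include hw hs hp hU in
lemma avg_psd (w : V) : 0 ≤ B (avg T m U w) w := by
  rw [avg_apply]
  simp only [map_sum, LinearMap.sum_apply, map_smul, LinearMap.smul_apply, smul_eq_mul]
  rw [← Finset.add_sum_erase T _ hw.one_mem]
  have h1 : -(1 - m 1) * B w w ≤ ∑ s ∈ T.erase 1, m s * B (U s w) w := by
    have : ∑ s ∈ T.erase 1, m s * (- B w w) ≤ ∑ s ∈ T.erase 1, m s * B (U s w) w := by
      refine Finset.sum_le_sum fun s h => ?_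
      refine mul_le_mul_of_nonneg_left ?_ (hw.pos s (Finset.mem_of_mem_erase h)).le
      have := B_sum U B hs hU s w
      have := hp (U s w + w)
      linarith
    rw [← Finset.sum_mul] at this
    have e := Finset.add_sum_erase T m hw.one_mem
    rw [hw.sum] at e
    have h6 : ∑ s ∈ T.erase 1, m s = 1 - m 1 := by linarith
    rw [h6] at this
    linarith
  have h2 := hw.lazy
  have h3 := hp w
  simp only [map_one, Module.End.one_apply]
  nlinarith

include hw hs hU in
lemma avg_dir (w : V) : ∑ s ∈ T, m s * B (U s w - w) (U s w - w) =
    2 * B (w - avg T m U w) w := by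
  rw [map_sub, LinearMap.sub_apply, avg_apply]
  simp only [map_sum, LinearMap.sum_apply, map_smul, LinearMap.smul_apply, smul_eq_mul]
  have : ∀ s ∈ T, m s * B (U s w - w) (U s w - w) =
      2 * (m s * B w w) - 2 * (m s * B (U s w) w) := fun s _ => by
    rw [B_diff U B hs hU]; ring
  rw [Finset.sum_congr rfl this, Finset.sum_sub_distrib, ← Finset.mul_sum, ← Finset.mul_sum,
    ← Finset.sum_mul, hw.sum]
  ring

include hw hs hp hU in
lemma avg_dir_nonneg (w : V) : 0 ≤ B (w - avg T m U w) w := by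
  have := avg_dir hw U B hs hU w
  have h2 : 0 ≤ ∑ s ∈ T, m s * B (U s w - w) (U s w - w) :=
    Finset.sum_nonneg fun s h => mul_nonneg (hw.pos s h).le (hp _)
  linarith

include hw hs hp hU in
/-- the basic spectral inequalities -/
lemma avg_ineq (w : V) :
    B (w - avg T m U w) w ≤ B w w - B (avg T m U w) (avg T m U w) ∧
    B w w - B (avg T m U w) (avg T m U w) ≤ 2 * B (w - avg T m U w) w ∧
    B (avg T m U w - avg T m U (avg T m U w)) (avg T m U w) ≤
      B (w - avg T m U w) w - B (w - avg T m U w) (w - avg T m U w) := by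
  set A := avg T m U with hA
  have ad := avg_adj hw U B hU
  rw [← hA] at ad
  have h1 := avg_psd hw U B hs hp hU (w - A w)
  have h2 := avg_dir_nonneg hw U B hs hp hU (A w)
  have h3 := avg_dir_nonneg hw U B hs hp hU w
  have h4 := hp (w - A w)
  rw [← hA] at h1 h2 h3
  have e1 := ad w (A w)
  have e2 := ad w w
  have e3 := ad (A w) w
  have e4 := ad (A w) (A w)
  simp only [map_sub, LinearMap.sub_apply] at *
  have e5 := hs w (A w)
  refine ⟨?_, ?_, ?_⟩ <;> linarith

include hw hs hp hU in
theorem harm_abs [Infinite G] {d : ℕ} (hG : PG d G) (v0 : V)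
    (hq : ∀ (F : Finset G) (n : ℕ),
      ∑ g ∈ F, B (U g ((avg T m U ^ n) v0)) ((avg T m U ^ n) v0) ≤ 1)
    (hlow : ∀ n, (1 : ℝ) ≤ (T ^ n).card * B ((avg T m U ^ n) v0) ((avg T m U ^ n) v0)) :
    ∃ f : G → ℝ, Pop T m f = f ∧ (∃ L, ∀ x, ∀ s ∈ T, |f (x * s) - f x| ≤ L) ∧
      ∃ s, f s ≠ f 1 := by
  set A := avg T m U with hA
  set v : ℕ → V := fun n => (A ^ n) v0 with hv
  have hvs : ∀ n, v (n + 1) = A (v n) := fun n => by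
    simp only [hv]; rw [pow_succ', Module.End.mul_apply]
  set q : ℕ → ℝ := fun n => B (v n) (v n) with hqd
  set D : ℕ → ℝ := fun n => B (v n - A (v n)) (v n) with hD
  set e : ℕ → ℝ := fun n => B (v n - A (v n)) (v n - A (v n)) with he
  have hD0 : ∀ n, 0 ≤ D n := fun n => avg_dir_nonneg hw U B hs hp hU (v n)
  have he0 : ∀ n, 0 ≤ e n := fun n => hp _
  have hq0 : ∀ n, 0 ≤ q n := fun n => hp _
  have i1 : ∀ n, D n ≤ q n - q (n + 1) := fun n => by
    have := (avg_ineq hw U B hs hp hU (v n)).1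
    simp only [hD, hqd]; rw [hvs]; exact this
  have i2 : ∀ n, q n - q (n + 1) ≤ 2 * D n := fun n => by
    have := (avg_ineq hw U B hs hp hU (v n)).2.1
    simp only [hD, hqd]; rw [hvs]; exact this
  have i3 : ∀ n, D (n + 1) ≤ D n - e n := fun n => by
    have := (avg_ineq hw U B hs hp hU (v n)).2.2
    simp only [hD, he]; rw [hvs]; exact this
  have hqanti : Antitone q := antitone_nat_of_succ_le fun n => by
    have := i1 n; have := hD0 n; linarith
  have hDanti : Antitone D := antitone_nat_of_succ_le fun n => by
    have := i3 n; have := he0 n; linarith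
  have hqlim := tendsto_atTop_ciInf hqanti ⟨0, by rintro _ ⟨n, rfl⟩; exact hq0 n⟩
  have hDlim : Tendsto D atTop (𝓝 0) := by
    have h1 := hqlim.sub (hqlim.comp (tendsto_add_atTop_nat 1))
    rw [sub_self] at h1
    exact squeeze_zero hD0 i1 h1
  -- displacement bounds
  have hc : ∀ g : G, ∃ c : ℝ, 0 ≤ c ∧ ∀ n, B (U g (v n) - v n) (U g (v n) - v n) ≤ c * D n := by
    intro g
    have hg : g ∈ Subgroup.closure (T : Set G) := by rw [hw.gen]; trivial
    induction hg using Subgroup.closure_induction with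
    | mem s h =>
      refine ⟨2 / m s, by have := hw.pos s h; positivity, fun n => ?_⟩
      have h1 := avg_dir hw U B hs hU (v n)
      have h2 := Finset.single_le_sum (f := fun s => m s * B (U s (v n) - v n) (U s (v n) - v n))
        (fun s h => mul_nonneg (hw.pos s h).le (hp _)) h
      rw [h1] at h2
      rw [div_mul_eq_mul_div, le_div_iff₀ (hw.pos s h)]
      simp only [hD]
      linarith
    | one => exact ⟨0, le_rfl, fun n => by simp⟩
    | mul a b _ _ ha hb =>
      obtain ⟨c, hc0, hc⟩ := ha
      obtain ⟨c', hc0', hc'⟩ := hb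
      refine ⟨2 * (c + c'), by positivity, fun n => ?_⟩
      have e1 : U (a * b) (v n) - v n = U a (U b (v n) - v n) + (U a (v n) - v n) := by
        rw [map_mul, Module.End.mul_apply, map_sub]; abel
      set x := U a (U b (v n) - v n)
      set y := U a (v n) - v n
      have h1 := hp (x - y)
      have h2 : B x x ≤ c' * D n := by rw [hU]; exact hc' n
      have h3 : B y y ≤ c * D n := hc n
      rw [e1]
      simp only [map_add, map_sub, LinearMap.add_apply, LinearMap.sub_apply] at h1 ⊢
      have := hs x y
      linarith
    | inv a _ ha =>
      obtain ⟨c, hc0, hc⟩ := ha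
      refine ⟨c, hc0, fun n => ?_⟩
      have e1 : U a⁻¹ (v n) - v n = - U a⁻¹ (U a (v n) - v n) := by
        have : U a⁻¹ (U a (v n)) = v n := by
          rw [← Module.End.mul_apply (U a⁻¹) (U a), ← map_mul]; simp
        rw [map_sub, this]; abel
      rw [e1]
      simp only [map_neg, LinearMap.neg_apply, neg_neg]
      rw [hU]; exact hc n
  have hqz : Tendsto q atTop (𝓝 0) := by
    set l := ⨅ n, q n with hl
    have hl0 : 0 ≤ l := ge_of_tendsto' hqlim hq0
    suffices l = 0 by rw [this] at hqlim; exact hqlim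
    by_contra hne
    have hlp : 0 < l := lt_of_le_of_ne hl0 (Ne.symm hne)
    have hlim2 : ∀ g, Tendsto (fun n => B (U g (v n)) (v n)) atTop (𝓝 l) := by
      intro g
      obtain ⟨c, hc0, hc⟩ := hc g
      have t1 : Tendsto (fun n => B (U g (v n) - v n) (U g (v n) - v n)) atTop (𝓝 0) := by
        refine squeeze_zero (fun n => hp _) hc ?_
        simpa using hDlim.const_mul c
      have t2 := hqlim.sub (t1.div_const 2)
      rw [zero_div, sub_zero] at t2
      refine t2.congr fun n => ?_
      rw [B_diff U B hs hU]; simp only [hqd]; ring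
    obtain ⟨N, hN⟩ := exists_nat_gt (1 / l)
    obtain ⟨F, hF⟩ := Infinite.exists_subset_card_eq G N
    have t := tendsto_finsetSum F (fun g _ => hlim2 g)
    have h1 := le_of_tendsto' t (hq F)
    rw [Finset.sum_const, hF, nsmul_eq_mul] at h1
    rw [div_lt_iff₀ hlp] at hN
    linarith
  have hqp : ∀ n, 0 < q n := fun n => by
    have := hlow n
    by_contra h
    have h0 : q n = 0 := le_antisymm (not_lt.1 h) (hq0 n)
    simp only [hqd, hv] at h0
    rw [h0] at this; norm_num at this
  have hDp : ∀ n, 0 < D n := by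
    intro n
    by_contra h
    have h0 : D n = 0 := le_antisymm (not_lt.1 h) (hD0 n)
    have hk : ∀ k, q (n + k) = q n := by
      intro k
      induction k with
      | zero => rfl
      | succ k ih =>
        have a1 : D (n + k) ≤ 0 := h0 ▸ hDanti (Nat.le_add_right n k)
        have a2 := i2 (n + k)
        have a3 := hqanti (Nat.le_succ (n + k))
        rw [← ih]
        refine le_antisymm a3 ?_
        rw [show n + (k + 1) = n + k + 1 by ring]; linarith
    have t : Tendsto (fun k => q (n + k)) atTop (𝓝 0) := by
      have := hqz.comp (tendsto_add_atTop_nat n)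
      refine this.congr fun k => by simp [add_comm]
    simp only [hk] at t
    have := tendsto_nhds_unique t tendsto_const_nhds
    have := hqp n
    linarith
  -- small ratio
  have hratio : ∀ ε : ℝ, 0 < ε → ε < 1 → ∃ n, e n < ε * D n := by
    intro ε hε hε1
    by_contra! hcon
    have hr : ∀ n, q n - 2 / ε * D n ≤ 0 := by
      have hmono : Monotone (fun n => q n - 2 / ε * D n) := monotone_nat_of_le_succ fun n => by
        have a1 := i2 n
        have a2 := i3 n
        have a3 := hcon n
        have a4 : 2 / ε * (ε * D n) ≤ 2 / ε * (D n - D (n + 1)) :=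
          mul_le_mul_of_nonneg_left (by linarith) (by positivity)
        rw [← mul_assoc, div_mul_cancel₀ _ hε.ne'] at a4
        linarith
      have t : Tendsto (fun n => q n - 2 / ε * D n) atTop (𝓝 0) := by
        simpa using hqz.sub (hDlim.const_mul (2 / ε))
      exact fun n => hmono.ge_of_tendsto t n
    have hgeo : ∀ n, D n ≤ (1 - ε) ^ n * D 0 := by
      intro n
      induction n with
      | zero => simp
      | succ n ih =>
        have a2 := i3 n
        have a3 := hcon n
        have := mul_le_mul_of_nonneg_left ih (by linarith : 0 ≤ 1 - ε)
        rw [pow_succ]; linarith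
    obtain ⟨C, hC⟩ := hG T
    have t := (tendsto_pow_const_mul_const_pow_of_lt_one d (by linarith : 0 ≤ 1 - ε)
      (by linarith : 1 - ε < 1)).const_mul (C * (2 / ε * D 0))
    rw [mul_zero] at t
    obtain ⟨n, hn, hn1⟩ := ((t.eventually_lt_const zero_lt_one).and (eventually_ge_atTop 1)).exists
    have a1 := hlow n
    have a2 : ((T ^ n).card : ℝ) ≤ C * n ^ d := by exact_mod_cast hC n hn1
    have a3 : q n ≤ 2 / ε * ((1 - ε) ^ n * D 0) := by
      have := hr n
      have := mul_le_mul_of_nonneg_left (hgeo n) (by positivity : 0 ≤ 2 / ε)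
      linarith
    have a4 : (1 : ℝ) ≤ C * n ^ d * (2 / ε * ((1 - ε) ^ n * D 0)) :=
      a1.trans (mul_le_mul a2 a3 (hq0 n) (by positivity))
    linarith [show (C * n ^ d * (2 / ε * ((1 - ε) ^ n * D 0)) : ℝ) =
      C * (2 / ε * D 0) * (n ^ d * (1 - ε) ^ n) by ring]
  choose! c hc0 hc using hc
  have hch : ∀ j : ℕ, ∃ n, e n < 1 / ((j : ℝ) + 2) * D n := fun j =>
    hratio _ (by positivity) (by
      rw [div_lt_one (by positivity)]; have : (0 : ℝ) ≤ j := by positivity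
      linarith)
  choose k hk using hch
  have cs : ∀ x y : V, (B x y) ^ 2 ≤ B x x * B y y := fun x y =>
    LinearMap.BilinForm.apply_sq_le_of_symm B hp ⟨fun a b => hs a b⟩ x y
  -- general bound
  have hbound : ∀ (x y : V) (a b Dn : ℝ), 0 < Dn → 0 ≤ a → B x x ≤ a * Dn → B y y ≤ b * Dn →
      |B x y / Dn| ≤ Real.sqrt (a * b) := by
    intro x y a b Dn hDn ha hx hy
    refine Real.abs_le_sqrt ?_
    rw [div_pow, div_le_iff₀ (by positivity)]
    refine (cs x y).trans ((mul_le_mul hx hy (hp y) (by positivity)).trans (le_of_eq (by ring)))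
  let φ : G → G → ℕ → ℝ := fun s g j =>
    B (U g (v (k j)) - v (k j)) (U s (v (k j)) - v (k j)) / D (k j)
  let W : Ultrafilter ℕ := Ultrafilter.of atTop
  have hW : (W : Filter ℕ) ≤ atTop := Ultrafilter.of_le _
  have hlim : ∀ s g, ∃ l, Tendsto (φ s g) W (𝓝 l) := by
    intro s g
    have hcm : IsCompact (Set.Icc (-Real.sqrt (c g * c s)) (Real.sqrt (c g * c s))) := isCompact_Icc
    obtain ⟨l, -, hl⟩ := hcm.ultrafilter_le_nhds (W.map (φ s g)) (by
      rw [le_principal_iff]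
      refine Ultrafilter.mem_coe.2 (Ultrafilter.mem_map.2 (univ_mem' fun n => ?_))
      exact abs_le.1 (hbound _ _ _ _ _ (hDp _) (hc0 g) (hc g _) (hc s _)))
    exact ⟨l, hl⟩
  choose f hf using hlim
  have hf1 : ∀ s, f s 1 = 0 := fun s => by
    refine tendsto_nhds_unique (hf s 1) ?_
    simp [φ]
  have hharm : ∀ s, Pop T m (f s) = f s := by
    intro s
    ext g
    have t1 : Tendsto (fun j => ∑ t ∈ T, m t * φ s (g * t) j) W (𝓝 (Pop T m (f s) g)) :=
      tendsto_finsetSum T fun t _ => (hf s (g * t)).const_mul _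
    have t2 := t1.sub (hf s g)
    have t3 : Tendsto (fun j => ∑ t ∈ T, m t * φ s (g * t) j - φ s g j) W (𝓝 0) := by
      have t4 : Tendsto (fun j : ℕ => Real.sqrt (1 / ((j : ℝ) + 2) * c s)) W (𝓝 0) := by
        have : Tendsto (fun j : ℕ => 1 / ((j : ℝ) + 2)) atTop (𝓝 0) :=
          (tendsto_atTop_add_const_right _ _ tendsto_natCast_atTop_atTop).const_div_atTop _
        have := ((this.mul_const (c s)).sqrt).mono_left hW
        simpa using this
      refine squeeze_zero_norm (fun j => ?_) t4
      set w := v (k j) with hwd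
      have e1 : ∑ t ∈ T, m t * φ s (g * t) j - φ s g j =
          B (- U g (w - A w)) (U s w - w) / D (k j) := by
        have e2 : - U g (w - A w) = ∑ t ∈ T, m t • (U (g * t) w - w) - (U g w - w) := by
          rw [hA, avg_apply]
          simp only [smul_sub, Finset.sum_sub_distrib, ← Finset.sum_smul, hw.sum, map_sub, map_sum,
            map_smul, map_mul, Module.End.mul_apply, one_smul]
          abel
        rw [e2]
        simp only [φ, ← hwd]
        simp only [map_sub, map_sum, map_smul, LinearMap.sub_apply, LinearMap.sum_apply,
          LinearMap.smul_apply, smul_eq_mul, sub_div, Finset.sum_div, mul_sub, mul_div_assoc,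
          Finset.sum_sub_distrib]
        ring
      rw [e1, Real.norm_eq_abs]
      refine hbound _ _ _ _ _ (hDp _) (by positivity) ?_ (hc s _)
      simp only [map_neg, LinearMap.neg_apply, neg_neg]
      rw [hU]; exact (hk j).le
    have := tendsto_nhds_unique t2 t3
    linarith
  have hsum : ∑ s ∈ T, m s * f s s = 2 := by
    refine tendsto_nhds_unique (tendsto_finsetSum T fun s _ => (hf s s).const_mul (m s)) ?_
    refine Tendsto.congr (f₁ := fun _ => 2) (fun j => ?_) tendsto_const_nhds
    have := avg_dir hw U B hs hU (v (k j))
    simp only [φ, ← mul_div_assoc, ← Finset.sum_div]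
    rw [this, eq_div_iff (hDp _).ne']
  obtain ⟨s, hsT, hs0⟩ : ∃ s ∈ T, f s s ≠ 0 := by
    by_contra! h
    rw [Finset.sum_eq_zero fun s hs => by rw [h s hs, mul_zero]] at hsum
    norm_num at hsum
  refine ⟨f s, hharm s, ⟨∑ t ∈ T, Real.sqrt (c t * c s), fun x t ht => ?_⟩, s, by
    rw [hf1]; exact hs0⟩
  refine le_trans ?_ (Finset.single_le_sum (f := fun t => Real.sqrt (c t * c s))
    (fun _ _ => Real.sqrt_nonneg _) ht)
  refine le_of_tendsto' ((hf s (x * t)).sub (hf s x)).abs fun j => ?_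
  set w := v (k j) with hwd
  have e1 : φ s (x * t) j - φ s x j = B (U x (U t w - w)) (U s w - w) / D (k j) := by
    have e2 : U x (U t w - w) = (U (x * t) w - w) - (U x w - w) := by
      rw [map_sub, map_mul, Module.End.mul_apply]; abel
    rw [e2]
    simp only [φ, ← hwd]
    simp only [map_sub, LinearMap.sub_apply]; ring
  rw [e1]
  refine hbound _ _ _ _ _ (hDp _) (hc0 t) ?_ (hc s _)
  rw [hU]; exact hc t _
end
end Gromov

namespace Gromov
open scoped Classical commutatorElement
open Filter Topology

/-- regular representation on finitely supported functions -/
noncomputable def Ureg (G : Type*) [Group G] : G →* Module.End ℝ (G →₀ ℝ) where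
  toFun g := Finsupp.lmapDomain ℝ ℝ (fun x => g * x)
  map_one' := by ext a; simp
  map_mul' g h := by ext a; simp [mul_assoc]

/-- the inner product -/
noncomputable def Breg (G : Type*) [Group G] : LinearMap.BilinForm ℝ (G →₀ ℝ) :=
  Finsupp.linearCombination ℝ (fun x => (Finsupp.lapply x : (G →₀ ℝ) →ₗ[ℝ] ℝ))

lemma Breg_single {G : Type*} [Group G] (a : G) (r : ℝ) (v : G →₀ ℝ) :
    Breg G (Finsupp.single a r) v = r * v a := by
  simp [Breg]

lemma Ureg_single {G : Type*} [Group G] (g a : G) (r : ℝ) :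
    Ureg G g (Finsupp.single a r) = Finsupp.single (g * a) r := by
  simp [Ureg]

lemma Ureg_apply {G : Type*} [Group G] (g x : G) (v : G →₀ ℝ) :
    Ureg G g v (g * x) = v x := by
  simp only [Ureg, MonoidHom.coe_mk, OneHom.coe_mk, Finsupp.lmapDomain_apply]
  exact Finsupp.mapDomain_apply (mul_right_injective g) v x

lemma Ureg_apply' {G : Type*} [Group G] (g x : G) (v : G →₀ ℝ) :
    Ureg G g v x = v (g⁻¹ * x) := by
  have := Ureg_apply g (g⁻¹ * x) v
  rwa [mul_inv_cancel_left] at this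

lemma Breg_eq {G : Type*} [Group G] (u v : G →₀ ℝ) (A : Finset G) (h : u.support ⊆ A) :
    Breg G u v = ∑ x ∈ A, u x * v x := by
  rw [Breg, Finsupp.linearCombination_apply, Finsupp.sum_of_support_subset _ h _ (by simp)]
  simp

lemma Breg_symm {G : Type*} [Group G] (u v : G →₀ ℝ) : Breg G u v = Breg G v u := by
  rw [Breg_eq u v (u.support ∪ v.support) Finset.subset_union_left,
    Breg_eq v u (u.support ∪ v.support) Finset.subset_union_right]
  exact Finset.sum_congr rfl fun x _ => mul_comm _ _

lemma Breg_inv {G : Type*} [Group G] (g : G) (u v : G →₀ ℝ) :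
    Breg G (Ureg G g u) (Ureg G g v) = Breg G u v := by
  induction u using Finsupp.induction_linear with
  | zero => simp
  | add a b ha hb => simp only [map_add, LinearMap.add_apply, ha, hb]
  | single a r => rw [Ureg_single, Breg_single, Breg_single, Ureg_apply]

theorem harm_exists {G : Type*} [Group G] {T : Finset G} {m : G → ℝ} (hw : Wt T m) [Infinite G]
    {d : ℕ} (hG : PG d G) :
    ∃ f : G → ℝ, Pop T m f = f ∧ (∃ L, ∀ x, ∀ s ∈ T, |f (x * s) - f x| ≤ L) ∧
      ∃ s, f s ≠ f 1 := by
  have hpd : ∀ n x, ((avg T m (Ureg G) ^ n) (Finsupp.single 1 1)) x = pd T m n x := by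
    intro n
    induction n with
    | zero => intro x; simp [pd, Finsupp.single_apply, eq_comm]
    | succ n ih =>
      intro x
      rw [pow_succ', Module.End.mul_apply, avg_apply]
      simp only [Finsupp.coe_finsetSum, Finset.sum_apply, Finsupp.smul_apply, Ureg_apply', ih,
        smul_eq_mul]
      rfl
  have hsupp : ∀ n, ((avg T m (Ureg G) ^ n) (Finsupp.single 1 1)).support ⊆ T ^ n := by
    intro n x hx
    by_contra h
    rw [Finsupp.mem_support_iff, hpd, pd_supp hw n x h] at hx
    exact hx rfl
  refine harm_abs hw (Ureg G) (Breg G) Breg_symm (fun u => ?_) Breg_inv hG (Finsupp.single 1 1) ?_ ?_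
  · rw [Breg_eq u u _ subset_rfl]
    exact Finset.sum_nonneg fun _ _ => mul_self_nonneg _
  · intro F n
    have h1 : ∀ g ∈ F, Breg G (Ureg G g ((avg T m (Ureg G) ^ n) (Finsupp.single 1 1)))
        ((avg T m (Ureg G) ^ n) (Finsupp.single 1 1)) =
        ∑ x ∈ T ^ n, pd T m n x * pd T m n (g⁻¹ * x) := by
      intro g _
      rw [Breg_symm, Breg_eq _ _ _ (hsupp n)]
      simp only [Ureg_apply', hpd]
    rw [Finset.sum_congr rfl h1, Finset.sum_comm, ← pd_sum hw n]
    refine Finset.sum_le_sum fun x _ => ?_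
    rw [← Finset.mul_sum]
    refine mul_le_of_le_one_right (pd_nonneg hw n x) ?_
    have h2 : ∑ g ∈ F, pd T m n (g⁻¹ * x) = ∑ y ∈ F.image (fun g => g⁻¹ * x), pd T m n y := by
      rw [Finset.sum_image (by intro a _ b _ h; simpa using h)]
    rw [h2, ← pd_sum hw n, ← Finset.sum_filter_add_sum_filter_not _ (fun y => y ∈ T ^ n),
      Finset.sum_eq_zero (s := Finset.filter (fun y => ¬ y ∈ T ^ n) _)
        fun y hy => pd_supp hw n y (Finset.mem_filter.1 hy).2, add_zero]
    exact Finset.sum_le_sum_of_subset_of_nonneg (fun y hy => (Finset.mem_filter.1 hy).2)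
      fun y _ _ => pd_nonneg hw n y
  · intro n
    rw [Breg_eq _ _ _ (hsupp n)]
    simp only [hpd]
    have := sq_sum_le_card_mul_sum_sq (s := T ^ n) (f := fun x => pd T m n x)
    rw [pd_sum hw n] at this
    simpa [sq] using this

end Gromov

namespace Gromov
open scoped Classical commutatorElement

section
variable {G A : Type*} [Group G] [NormedRing A] (u : G →* A) (hu : ∀ g, ‖u g‖ ≤ 1)

lemma u_inv (g : G) : u g * u g⁻¹ = 1 := by rw [← map_mul]; simp

lemma u_inv' (g : G) : u g⁻¹ * u g = 1 := by rw [← map_mul]; simp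

include hu in
lemma del_mul (g h : G) : ‖u (g * h) - 1‖ ≤ ‖u g - 1‖ + ‖u h - 1‖ := by
  have : u (g * h) - 1 = u g * (u h - 1) + (u g - 1) := by rw [map_mul]; noncomm_ring
  rw [this]
  have h1 := norm_add_le (u g * (u h - 1)) (u g - 1)
  have h2 := norm_mul_le (u g) (u h - 1)
  have h3 := mul_le_mul_of_nonneg_right (hu g) (norm_nonneg (u h - 1))
  linarith

include hu in
lemma del_inv (g : G) : ‖u g⁻¹ - 1‖ ≤ ‖u g - 1‖ := by
  have : u g⁻¹ - 1 = u g⁻¹ * (1 - u g) := by rw [mul_sub, u_inv']; simp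
  rw [this, norm_sub_rev (u g)]
  have h2 := norm_mul_le (u g⁻¹) (1 - u g)
  have h3 := mul_le_mul_of_nonneg_right (hu g⁻¹) (norm_nonneg (1 - u g))
  linarith

include hu in
lemma del_comm (g h : G) : ‖u ⁅g, h⁆ - 1‖ ≤ 2 * ‖u g - 1‖ * ‖u h - 1‖ := by
  have : u ⁅g, h⁆ - 1 = ((u g - 1) * (u h - 1) - (u h - 1) * (u g - 1)) * u (g⁻¹ * h⁻¹) := by
    have e : (u g - 1) * (u h - 1) - (u h - 1) * (u g - 1) = u (g * h) - u (h * g) := by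
      rw [map_mul, map_mul]; noncomm_ring
    rw [e, sub_mul, ← map_mul, ← map_mul, commutatorElement_def]
    congr 2
    · group
    · rw [show h * g * (g⁻¹ * h⁻¹) = 1 by group, map_one]
  rw [this]
  have h1 := norm_mul_le ((u g - 1) * (u h - 1) - (u h - 1) * (u g - 1)) (u (g⁻¹ * h⁻¹))
  have h2 := norm_sub_le ((u g - 1) * (u h - 1)) ((u h - 1) * (u g - 1))
  have h3 := norm_mul_le (u g - 1) (u h - 1)
  have h4 := norm_mul_le (u h - 1) (u g - 1)
  have h5 := mul_le_mul_of_nonneg_left (hu (g⁻¹ * h⁻¹))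
    (norm_nonneg ((u g - 1) * (u h - 1) - (u h - 1) * (u g - 1)))
  linarith

include hu in
lemma del_pow (g : G) (n : ℕ) : ‖u (g ^ n) - 1‖ ≤ n * ‖u g - 1‖ := by
  induction n with
  | zero => simp
  | succ n ih =>
    rw [pow_succ]
    have := del_mul u hu (g ^ n) g
    push_cast
    linarith

include hu in
lemma del_pow_lb (g : G) (n : ℕ) :
    ‖u (g ^ n) - 1 - n • (u g - 1)‖ ≤ n * n * ‖u g - 1‖ * ‖u g - 1‖ := by
  induction n with
  | zero => simp
  | succ n ih =>
    have : u (g ^ (n + 1)) - 1 - (n + 1) • (u g - 1) =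
        (u (g ^ n) - 1 - n • (u g - 1)) + (u (g ^ n) - 1) * (u g - 1) := by
      rw [pow_succ, map_mul, succ_nsmul]; noncomm_ring
    rw [this]
    have h1 := norm_add_le (u (g ^ n) - 1 - n • (u g - 1)) ((u (g ^ n) - 1) * (u g - 1))
    have h2 := norm_mul_le (u (g ^ n) - 1) (u g - 1)
    have h3 := mul_le_mul_of_nonneg_right (del_pow u hu g n) (norm_nonneg (u g - 1))
    push_cast
    have := mul_nonneg (norm_nonneg (u g - 1)) (norm_nonneg (u g - 1))
    have : (0:ℝ) ≤ n * (‖u g - 1‖ * ‖u g - 1‖) := by positivity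
    nlinarith

include hu in
lemma del_pow_sep [NormedAlgebra ℝ A] (g : G) (a : ℕ) (ha : 1 ≤ a) {N : ℕ} (haN : a ≤ N)
    (hs : ‖u g - 1‖ * (2 * N) ≤ 1) : ‖u g - 1‖ / 2 ≤ ‖u (g ^ a) - 1‖ := by
  have h1 := del_pow_lb u hu g a
  have h0 := norm_nonneg (u g - 1)
  have h2 : (a : ℝ) * ‖u g - 1‖ ≤ ‖u (g ^ a) - 1‖ + ‖u (g ^ a) - 1 - a • (u g - 1)‖ := by
    have e : ‖a • (u g - 1)‖ = (a : ℝ) * ‖u g - 1‖ := by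
      rw [← Nat.cast_smul_eq_nsmul ℝ, norm_smul]; simp
    rw [← e]
    have := norm_sub_le (u (g ^ a) - 1) (u (g ^ a) - 1 - a • (u g - 1))
    rwa [sub_sub_cancel] at this
  have ha' : (1 : ℝ) ≤ a := by exact_mod_cast ha
  have haN' : (a : ℝ) ≤ N := by exact_mod_cast haN
  have h3 : a * ‖u g - 1‖ ≤ 1 / 2 := by nlinarith
  have h4 : (a * ‖u g - 1‖) * (a * ‖u g - 1‖) ≤ (1 / 2) * (a * ‖u g - 1‖) :=
    mul_le_mul_of_nonneg_right h3 (by positivity)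
  nlinarith

include hu in
lemma del_pow_sep2 [NormedAlgebra ℝ A] (g : G) (a b : ℕ) (hab : a ≠ b) {N : ℕ} (ha : a ≤ N)
    (hb : b ≤ N) (hs : ‖u g - 1‖ * (2 * N) ≤ 1) :
    ‖u g - 1‖ / 2 ≤ ‖u ((g ^ a)⁻¹ * g ^ b) - 1‖ := by
  rcases lt_or_gt_of_ne hab with h | h
  · obtain ⟨c, rfl⟩ := Nat.exists_eq_add_of_lt h
    rw [show a + c + 1 = a + (c + 1) by ring, pow_add, inv_mul_cancel_left]
    exact del_pow_sep u hu g (c + 1) (by omega) (by omega) hs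
  · obtain ⟨c, rfl⟩ := Nat.exists_eq_add_of_lt h
    rw [show b + c + 1 = b + (c + 1) by ring, pow_add]
    have h1 := del_pow_sep u hu g (c + 1) (N := N) (by omega) (by omega) hs
    have h2 := del_inv u hu (((g ^ b * g ^ (c + 1))⁻¹ * g ^ b))
    rw [mul_inv_rev, inv_inv, inv_mul_cancel_left] at h2
    exact h1.trans h2

include hu in
lemma sep_step [NormedAlgebra ℝ A] (z : G) {N : ℕ} (hs : ‖u z - 1‖ * (2 * N) ≤ 1) (hz : u z ≠ 1)
    (P : Finset G) (hP : ∀ p ∈ P, ∀ q ∈ P, p ≠ q →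
      (1 / 2 + 2 * N) * ‖u z - 1‖ ≤ ‖u (p⁻¹ * q) - 1‖) :
    ∃ P' : Finset G, (∀ x ∈ P', ∃ p ∈ P, ∃ a ≤ N, x = p * z ^ a) ∧
      P'.card = P.card * (N + 1) ∧ ∀ p ∈ P', ∀ q ∈ P', p ≠ q →
        ‖u z - 1‖ / 2 ≤ ‖u (p⁻¹ * q) - 1‖ := by
  have hz0 : 0 < ‖u z - 1‖ := norm_pos_iff.2 (sub_ne_zero.2 hz)
  have key : ∀ p ∈ P, ∀ q ∈ P, ∀ a ≤ N, ∀ b ≤ N, (p, a) ≠ (q, b) →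
      ‖u z - 1‖ / 2 ≤ ‖u ((p * z ^ a)⁻¹ * (q * z ^ b)) - 1‖ := by
    intro p hp q hq a ha b hb hne
    by_cases hpq : p = q
    · subst hpq
      have : (p * z ^ a)⁻¹ * (p * z ^ b) = (z ^ a)⁻¹ * z ^ b := by group
      rw [this]
      exact del_pow_sep2 u hu z a b (by rintro rfl; exact hne rfl) ha hb hs
    · have h1 := hP p hp q hq hpq
      set w := (p * z ^ a)⁻¹ * (q * z ^ b) with hw
      have e : p⁻¹ * q = z ^ a * (w * (z ^ b)⁻¹) := by rw [hw]; group
      rw [e] at h1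
      have h2 := del_mul u hu (z ^ a) (w * (z ^ b)⁻¹)
      have h3 := del_mul u hu w (z ^ b)⁻¹
      have h4 := del_inv u hu (z ^ b)
      have h5 := del_pow u hu z a
      have h6 := del_pow u hu z b
      have ha' : (a : ℝ) ≤ N := by exact_mod_cast ha
      have hb' : (b : ℝ) ≤ N := by exact_mod_cast hb
      have h7 := mul_le_mul_of_nonneg_right ha' hz0.le
      have h8 := mul_le_mul_of_nonneg_right hb' hz0.le
      linarith
  refine ⟨(P ×ˢ Finset.range (N + 1)).image (fun x => x.1 * z ^ x.2), ?_, ?_, ?_⟩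
  · intro x hx
    simp only [Finset.mem_image, Finset.mem_product, Finset.mem_range] at hx
    obtain ⟨⟨p, a⟩, ⟨hp, ha⟩, rfl⟩ := hx
    exact ⟨p, hp, a, by omega, rfl⟩
  · rw [Finset.card_image_of_injOn, Finset.card_product, Finset.card_range]
    rintro ⟨p, a⟩ hx ⟨q, b⟩ hy hxy
    simp only [Finset.coe_product, Set.mem_prod, Finset.mem_coe, Finset.mem_range] at hx hy hxy
    by_contra hne
    have := key p hx.1 q hy.1 a (by omega) b (by omega) hne
    rw [hxy] at this
    simp at this
    linarith
  · intro x hx y hy hxy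
    simp only [Finset.mem_image, Finset.mem_product, Finset.mem_range] at hx hy
    obtain ⟨⟨p, a⟩, ⟨hp, ha⟩, rfl⟩ := hx
    obtain ⟨⟨q, b⟩, ⟨hq, hb⟩, rfl⟩ := hy
    refine key p hp q hq a (by omega) b (by omega) ?_
    rintro h
    simp only [Prod.mk.injEq] at h
    exact hxy (by rw [h.1, h.2])

lemma inv_mem_pow' {F : Finset G} (hF : ∀ x ∈ F, x⁻¹ ∈ F) {n : ℕ} {x : G} (hx : x ∈ F ^ n) :
    x⁻¹ ∈ F ^ n := by
  have h : F⁻¹ = F := by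
    ext y; rw [Finset.mem_inv']; exact ⟨fun h => by simpa using hF _ h, hF y⟩
  rw [← h, inv_pow, Finset.mem_inv']
  simpa using hx

include hu in
lemma chain [NormedAlgebra ℝ A] (X F : Finset G) (hXF : X ⊆ F) (h1 : 1 ∈ F)
    (hF : ∀ x ∈ F, x⁻¹ ∈ F) {N : ℕ} (hN : 1 ≤ N) (hX : ∀ x ∈ X, ‖u x - 1‖ * (16 * N) ≤ 1)
    (m : ℕ) : ∀ z ∈ simpleComm (X : Set G) m, z ∈ F ^ (4 ^ m) ∧ ‖u z - 1‖ * (16 * N) ≤ 1 ∧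
      (u z ≠ 1 → ∃ P : Finset G, P ⊆ F ^ (2 * N * 4 ^ m) ∧ P.card = (N + 1) ^ (m + 1) ∧
        ∀ p ∈ P, ∀ q ∈ P, p ≠ q → ‖u z - 1‖ / 2 ≤ ‖u (p⁻¹ * q) - 1‖) := by
  have hN' : (1 : ℝ) ≤ N := by exact_mod_cast hN
  induction m with
  | zero =>
    intro z hz
    have hz' := hX z hz
    have h0 := norm_nonneg (u z - 1)
    refine ⟨by simpa using hXF hz, hz', fun hne => ?_⟩
    obtain ⟨P, hP1, hP2, hP3⟩ := sep_step u hu z (N := N) (by nlinarith) hne {1} (by simp)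
    refine ⟨P, fun x hx => ?_, by simpa using hP2, hP3⟩
    obtain ⟨p, hp, a, ha, rfl⟩ := hP1 x hx
    rw [Finset.mem_singleton.1 hp, one_mul]
    exact Finset.pow_subset_pow_right h1 (by omega) (Finset.pow_mem_pow (hXF hz))
  | succ m ih =>
    rintro z ⟨y, hy, x, hx, rfl⟩
    obtain ⟨ih1, ih2, ih3⟩ := ih y hy
    have hx' := hX x hx
    have hc := del_comm u hu y x
    have h0 := norm_nonneg (u ⁅y, x⁆ - 1)
    have h0y := norm_nonneg (u y - 1)
    have h0x := norm_nonneg (u x - 1)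
    have hc2 : ‖u ⁅y, x⁆ - 1‖ * (8 * N) ≤ ‖u y - 1‖ := by
      have : ‖u ⁅y, x⁆ - 1‖ * (8 * N) ≤ (2 * ‖u y - 1‖ * ‖u x - 1‖) * (8 * N) :=
        mul_le_mul_of_nonneg_right hc (by positivity)
      have := mul_le_mul_of_nonneg_left hx' h0y
      linarith
    have hmem : ⁅y, x⁆ ∈ F ^ (4 ^ (m + 1)) := by
      refine Finset.pow_subset_pow_right h1 (show 4 ^ m + 1 + 4 ^ m + 1 ≤ 4 ^ (m + 1) by
        have := Nat.one_le_pow m 4 (by norm_num)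
        rw [pow_succ]; omega) ?_
      rw [commutatorElement_def, pow_succ, pow_add, pow_succ]
      exact Finset.mul_mem_mul (Finset.mul_mem_mul (Finset.mul_mem_mul ih1 (hXF hx))
        (inv_mem_pow' hF ih1)) (hF _ (hXF hx))
    have hs : ‖u ⁅y, x⁆ - 1‖ * (16 * N) ≤ 1 := by nlinarith
    refine ⟨hmem, hs, fun hne => ?_⟩
    have hpos : 0 < ‖u ⁅y, x⁆ - 1‖ := norm_pos_iff.2 (sub_ne_zero.2 hne)
    have hyne : u y ≠ 1 := by
      intro h
      rw [h] at hc
      simp at hc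
      exact hne (sub_eq_zero.1 hc)
    obtain ⟨P, hP1, hP2, hP3⟩ := ih3 hyne
    obtain ⟨P', hP1', hP2', hP3'⟩ := sep_step u hu ⁅y, x⁆ (N := N) (by nlinarith) hne P
      (fun p hp q hq hpq => by have := hP3 p hp q hq hpq; nlinarith)
    refine ⟨P', fun w hw => ?_, by rw [hP2', hP2]; ring, hP3'⟩
    obtain ⟨p, hp, a, ha, rfl⟩ := hP1' w hw
    refine Finset.pow_subset_pow_right h1 (show 2 * N * 4 ^ m + 4 ^ (m + 1) * a ≤ _ from ?_) ?_
    · have := Nat.mul_le_mul_left (4 ^ (m + 1)) ha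
      have e : 2 * N * 4 ^ (m + 1) = 2 * (4 ^ (m + 1) * N) := by ring
      have e2 : 2 * N * 4 ^ m * 4 = 2 * (4 ^ (m + 1) * N) := by ring
      omega
    · rw [pow_add, pow_mul F (4 ^ (m + 1)) a]
      exact Finset.mul_mem_mul (hP1 hp) (Finset.pow_mem_pow hmem)

include hu in
lemma lin1 [NormedAlgebra ℝ A] {d : ℕ} (hG : PG d G) (X : Finset G)
    (hgen : Subgroup.closure (X : Set G) = ⊤)
    (hX : ∀ x ∈ X, ‖u x - 1‖ * (16 * (2 * 4 ^ d)) ≤ 1) : Group.IsNilpotent (G ⧸ u.ker) := by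
  set N : ℕ := 2 * 4 ^ d with hN
  set F : Finset G := X ∪ X⁻¹ ∪ {1} with hF
  have hN1 : 1 ≤ N := by have := Nat.one_le_pow d 4 (by norm_num); omega
  obtain ⟨C, hC⟩ := hG F
  set m := C * (2 * N) ^ d
  have hch := chain u hu X F (by intro x; simp +contextual [hF]) (by simp [hF])
    (by intro x; simp only [hF, Finset.mem_union, Finset.mem_inv', Finset.mem_singleton, inv_inv,
          inv_eq_one]; tauto) hN1 (by simpa [hN] using hX) m
  have htriv : ∀ z ∈ simpleComm (X : Set G) m, u z = 1 := by
    intro z hz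
    by_contra hne
    obtain ⟨-, -, h3⟩ := hch z hz
    obtain ⟨P, hP1, hP2, -⟩ := h3 hne
    have h4 := Finset.card_le_card hP1
    have h5 := hC (2 * N * 4 ^ m) (Nat.mul_pos (by omega) (by positivity))
    rw [hP2] at h4
    have h6 : C * (2 * N * 4 ^ m) ^ d = m * (4 ^ d) ^ m := by
      rw [mul_pow, ← pow_mul, mul_comm m d, pow_mul, ← mul_assoc]
    have h7 : 2 ^ m * (4 ^ d) ^ m ≤ (N + 1) ^ (m + 1) := by
      rw [← mul_pow]
      exact (Nat.pow_le_pow_left (by omega) m).trans (Nat.pow_le_pow_right (by omega) (by omega))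
    have h8 : 2 ^ m * (4 ^ d) ^ m ≤ m * (4 ^ d) ^ m := by
      rw [← h6]; exact h7.trans (h4.trans h5)
    have h9 := Nat.le_of_mul_le_mul_right h8 (by positivity)
    exact absurd h9 (not_le.2 Nat.lt_two_pow_self)
  have himg : ∀ k, simpleComm (QuotientGroup.mk' u.ker '' (X : Set G)) k ⊆
      QuotientGroup.mk' u.ker '' simpleComm (X : Set G) k := by
    intro k
    induction k with
    | zero => exact subset_rfl
    | succ k ihk =>
      rintro z ⟨y, hy, x, hx, rfl⟩
      obtain ⟨y', hy', rfl⟩ := ihk hy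
      obtain ⟨x', hx', rfl⟩ := hx
      exact ⟨⁅y', x'⁆, ⟨y', hy', x', hx', rfl⟩, map_commutatorElement _ _ _⟩
  refine nilpotent_of_simpleComm m (QuotientGroup.mk' u.ker '' (X : Set G)) ?_ ?_
  · rw [← MonoidHom.map_closure, hgen]
    exact Subgroup.map_top_of_surjective _ (QuotientGroup.mk'_surjective _)
  · intro z hz
    obtain ⟨y, hy, rfl⟩ := himg m hz
    exact (QuotientGroup.eq_one_iff y).2 (htriv y hy)

lemma exists_finite_closure (Y : Set G) (g : G) (hg : g ∈ Subgroup.closure Y) :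
    ∃ X : Finset G, (X : Set G) ⊆ Y ∧ g ∈ Subgroup.closure (X : Set G) := by
  induction hg using Subgroup.closure_induction with
  | mem x hx => exact ⟨{x}, by simpa using hx, Subgroup.subset_closure (by simp)⟩
  | one => exact ⟨∅, by simp, one_mem _⟩
  | mul x y _ _ h1 h2 =>
    obtain ⟨X, a, b⟩ := h1
    obtain ⟨Z, a', b'⟩ := h2
    exact ⟨X ∪ Z, by simp [a, a'], mul_mem (Subgroup.closure_mono (by simp) b)
      (Subgroup.closure_mono (by simp) b')⟩
  | inv x _ h =>
    obtain ⟨X, a, b⟩ := h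
    exact ⟨X, a, inv_mem b⟩

include hu in
lemma lin2 [NormedAlgebra ℝ A] [ProperSpace A] [Group.FG G] {d : ℕ} (hG : PG d G) :
    ∃ H : Subgroup G, H.FiniteIndex ∧ Group.IsNilpotent (H ⧸ (u.comp H.subtype).ker) := by
  set ε : ℝ := 1 / (16 * (2 * 4 ^ d)) with hε
  have hε0 : 0 < ε := by positivity
  set Y : Set G := {g | ‖u g - 1‖ ≤ ε} with hY
  set H := Subgroup.closure Y with hH
  have hfi : H.FiniteIndex := by
    have htb : TotallyBounded (Set.range u) :=
      (isCompact_closedBall (0 : A) 1).totallyBounded.subset (by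
        rintro _ ⟨g, rfl⟩; simpa using hu g)
    obtain ⟨t, htf, ht⟩ := Metric.totallyBounded_iff.1 htb (ε / 2) (by positivity)
    have hch : ∀ q : G ⧸ H, ∃ y : t, dist (u q.out) y < ε / 2 := by
      intro q
      have := ht ⟨q.out, rfl⟩
      simp only [Set.mem_iUnion, Metric.mem_ball] at this
      obtain ⟨y, hy, h⟩ := this
      exact ⟨⟨y, hy⟩, h⟩
    choose c hc using hch
    have hinj : Function.Injective c := by
      intro p q hpq
      have h1 := hc p
      have h2 := hc q
      rw [← hpq] at h2
      have h3 : dist (u q.out) (u p.out) < ε := by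
        have := dist_triangle_right (u q.out) (u p.out) (c p)
        linarith
      rw [← QuotientGroup.out_eq' p, ← QuotientGroup.out_eq' q]
      rw [QuotientGroup.eq]
      refine Subgroup.subset_closure ?_
      show ‖u (p.out⁻¹ * q.out) - 1‖ ≤ ε
      rw [map_mul, ← u_inv' u p.out, ← mul_sub]
      rw [dist_eq_norm] at h3
      have h4 := norm_mul_le (u p.out⁻¹) (u q.out - u p.out)
      have h5 := mul_le_mul_of_nonneg_right (hu p.out⁻¹) (norm_nonneg (u q.out - u p.out))
      linarith
    have := htf.to_subtype
    have : Finite (G ⧸ H) := Finite.of_injective c hinj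
    exact Subgroup.finiteIndex_of_finite_quotient
  refine ⟨H, hfi, ?_⟩
  have hfg : Group.FG H := Subgroup.fg_of_index_ne_zero H
  obtain ⟨X0, hX0⟩ := hfg.out
  have hcl : Subgroup.closure ((↑) ⁻¹' Y : Set H) = ⊤ := Subgroup.closure_closure_coe_preimage
  have hch : ∀ x : H, ∃ X : Finset H, (X : Set H) ⊆ (↑) ⁻¹' Y ∧
      x ∈ Subgroup.closure (X : Set H) := fun x =>
    exists_finite_closure _ x (by rw [hcl]; trivial)
  choose c hc1 hc2 using hch
  refine lin1 (u.comp H.subtype) (fun g => hu g) (hG.subgroup H) (X0.biUnion c) ?_ ?_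
  · rw [eq_top_iff, ← hX0, Subgroup.closure_le]
    intro x hx
    exact Subgroup.closure_mono (by
      exact_mod_cast Finset.subset_biUnion_of_mem c hx) (hc2 x)
  · intro x hx
    obtain ⟨y, -, hy⟩ := Finset.mem_biUnion.1 hx
    have : ‖u x - 1‖ ≤ ε := hc1 y hy
    rw [hε, le_div_iff₀ (by positivity)] at this
    exact this

end
end Gromov

namespace Gromov
open scoped Classical commutatorElement ENNReal

lemma lin3 {G E : Type*} [Group G] [Group.FG G] [NormedAddCommGroup E] [NormedSpace ℝ E]
    [FiniteDimensional ℝ E] (ρ : G →* Module.End ℝ E) (hρ : ∀ g v, ‖ρ g v‖ ≤ ‖v‖) {d : ℕ}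
    (hG : PG d G) :
    ∃ H : Subgroup G, H.FiniteIndex ∧ Group.IsNilpotent (H ⧸ (ρ.comp H.subtype).ker) := by
  set e : Module.End ℝ E →* (E →L[ℝ] E) := MonoidHomClass.toMonoidHom (Module.End.toContinuousLinearMap E)
  have : ProperSpace (E →L[ℝ] E) := FiniteDimensional.proper ℝ _
  have he : Function.Injective e := (Module.End.toContinuousLinearMap E).injective
  obtain ⟨H, h1, h2⟩ := lin2 (e.comp ρ) (fun g => by
    refine ContinuousLinearMap.opNorm_le_bound _ zero_le_one fun v => ?_
    rw [one_mul]
    exact hρ g v) hG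
  refine ⟨H, h1, ?_⟩
  have hk : ((e.comp ρ).comp H.subtype).ker = (ρ.comp H.subtype).ker := by
    ext x
    simp only [MonoidHom.mem_ker, MonoidHom.comp_apply]
    exact ⟨fun h => he (by rw [h, map_one]), fun h => by rw [h, map_one]⟩
  exact Group.nilpotent_of_mulEquiv (QuotientGroup.quotientMulEquivOfEq hk)

lemma exists_wt {G : Type*} [Group G] [hfg : Group.FG G] : ∃ (T : Finset G) (m : G → ℝ), Wt T m := by
  obtain ⟨X, hX⟩ := hfg.out
  set T : Finset G := X ∪ X⁻¹ ∪ {1} with hT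
  have h1 : (1 : G) ∈ T := by simp [hT]
  have hc : (0 : ℝ) < T.card := by exact_mod_cast Finset.card_pos.2 ⟨1, h1⟩
  refine ⟨T, fun s => (if s = 1 then 1 / 2 else 0) + 1 / (2 * T.card), h1, ?_, ?_, ?_, ?_, ?_, ?_⟩
  · intro x
    simp only [hT, Finset.mem_union, Finset.mem_inv', Finset.mem_singleton, inv_inv, inv_eq_one]
    tauto
  · rw [eq_top_iff, ← hX]
    exact Subgroup.closure_mono (by intro x hx; simp [hT, Finset.mem_coe.1 hx])
  · intro s _
    have : (0 : ℝ) ≤ if s = 1 then 1 / 2 else 0 := by split_ifs <;> norm_num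
    positivity
  · intro s; simp
  · rw [Finset.sum_add_distrib, Finset.sum_ite_eq' T 1, if_pos h1, Finset.sum_const, nsmul_eq_mul]
    field_simp
    norm_num
  · simp

/-- maximum principle -/
lemma max_principle {G : Type*} [Group G] {T : Finset G} {m : G → ℝ} (hw : Wt T m) (f : G → ℝ)
    (hf : Pop T m f = f) (hfin : (Set.range f).Finite) (x : G) : f x = f 1 := by
  obtain ⟨_, ⟨x0, rfl⟩, hx0⟩ := hfin.exists_maximal ⟨f 1, 1, rfl⟩
  have hmax : ∀ y, f y ≤ f x0 := fun y => by
    rcases le_total (f y) (f x0) with h | h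
    · exact h
    · exact hx0 ⟨y, rfl⟩ h
  have step : ∀ y, f y = f x0 → ∀ s ∈ T, f (y * s) = f x0 := by
    intro y hy s hs
    have h1 := congrFun hf y
    rw [Pop_apply] at h1
    have h2 : ∑ s ∈ T, m s * (f x0 - f (y * s)) = 0 := by
      simp only [mul_sub, Finset.sum_sub_distrib, ← Finset.sum_mul, hw.sum, h1, hy]; ring
    have h3 := (Finset.sum_eq_zero_iff_of_nonneg (fun s hs =>
      mul_nonneg (hw.pos s hs).le (sub_nonneg.2 (hmax _)))).1 h2 s hs
    rcases mul_eq_zero.1 h3 with h | h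
    · exact absurd h (hw.pos s hs).ne'
    · linarith
  have all : ∀ g : G, ∀ y, f y = f x0 ↔ f (y * g) = f x0 := by
    intro g
    have hg : g ∈ Subgroup.closure (T : Set G) := by rw [hw.gen]; trivial
    induction hg using Subgroup.closure_induction with
    | mem s hs =>
      refine fun y => ⟨fun hy => step y hy s hs, fun hy => ?_⟩
      simpa using step _ hy _ (hw.symm s hs)
    | one => simp
    | mul a b _ _ ha hb => intro y; rw [← mul_assoc, ha, hb]
    | inv a ha h => intro y; rw [h (y * a⁻¹), inv_mul_cancel_right]
  have h1 := (all (x0⁻¹ * x) x0).1 rfl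
  have h2 := (all (x0⁻¹) x0).1 rfl
  simp at h1 h2
  rw [h1, h2]

theorem hom_exists {G : Type*} [Group G] [Infinite G] [Group.FG G] {d : ℕ} (hG : PG d G) :
    ∃ H : Subgroup G, H.index ≠ 0 ∧ ∃ φ : H →* Multiplicative ℤ, φ ≠ 1 := by
  obtain ⟨T, m, hw⟩ := exists_wt (G := G)
  obtain ⟨f, hf, ⟨L, hL⟩, s0, hs0⟩ := harm_exists hw hG
  have := HW_finite hw hG
  obtain ⟨H, hH, hnil⟩ := lin3 (rep T m) (rep_norm T m) hG
  have hHfg : Group.FG H := Subgroup.fg_of_index_ne_zero H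
  by_cases hQ : Finite (H ⧸ ((rep T m).comp H.subtype).ker)
  swap
  · obtain ⟨φ, hφ⟩ := hom_int_of_infinite_nilpotent _ (inferInstance) (not_finite_iff_infinite.1 hQ)
    refine ⟨H, hH.index_ne_zero, φ.comp (QuotientGroup.mk' _), fun h => hφ ?_⟩
    refine MonoidHom.ext fun x => ?_
    obtain ⟨y, rfl⟩ := QuotientGroup.mk'_surjective _ x
    exact DFunLike.congr_fun h y
  · set K := (rep T m).ker ⊓ H with hK
    have hKi : K.index ≠ 0 := by
      rw [← Subgroup.relIndex_mul_index (inf_le_right : K ≤ H)]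
      refine mul_ne_zero ?_ hH.index_ne_zero
      rw [Subgroup.inf_relIndex_right, Subgroup.relIndex,
        show (rep T m).ker.subgroupOf H = ((rep T m).comp H.subtype).ker from rfl]
      exact Subgroup.index_ne_zero_of_finite
    have hKf : K.FiniteIndex := ⟨hKi⟩
    let F : HW T m := ⟨⟨fun p => f (p.1 * p.2) - f p.1, memlp_top.2 ⟨L, fun p => hL p.1 p.2 p.2.2⟩⟩,
      f, hf, fun x s => rfl⟩
    have hstep : ∀ k ∈ K, ∀ x, ∀ s ∈ T, f (k * (x * s)) - f (x * s) = f (k * x) - f x := by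
      intro k hk x s hs
      have h1 : rep T m k⁻¹ = 1 := ((rep T m).ker.inv_mem hk.1)
      have h2 := rep_apply T m k⁻¹ F x ⟨s, hs⟩
      rw [h1, inv_inv] at h2
      have h3 : f (x * s) - f x = f (k * x * s) - f (k * x) := h2
      rw [← mul_assoc]; linarith
    have hconst : ∀ k ∈ K, ∀ g x, f (k * (x * g)) - f (x * g) = f (k * x) - f x := by
      intro k hk g
      have hg : g ∈ Subgroup.closure (T : Set G) := by rw [hw.gen]; trivial
      induction hg using Subgroup.closure_induction with
      | mem s hs => exact fun x => hstep k hk x s hs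
      | one => simp
      | mul a b _ _ ha hb => intro x; rw [← mul_assoc x a b, hb, ha]
      | inv a ha h => intro x; rw [← h (x * a⁻¹), inv_mul_cancel_right]
    have hc : ∀ k ∈ K, ∀ x, f (k * x) = f x + (f k - f 1) := by
      intro k hk x
      have := hconst k hk x 1
      simp at this
      linarith
    let c : K →* Multiplicative ℝ :=
      { toFun := fun k => Multiplicative.ofAdd (f k - f 1)
        map_one' := by simp
        map_mul' := fun k l => by
          rw [← ofAdd_add, Subgroup.coe_mul, hc k k.2 l]; congr 1; ring }
    have hcne : ∃ k, c k ≠ 1 := by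
      by_contra hcon
      push Not at hcon
      have hcon' : ∀ k ∈ K, f k - f 1 = 0 := fun k hk => hcon ⟨k, hk⟩
      refine hs0 (max_principle hw f hf ?_ s0)
      have : Finite (G ⧸ K) := K.finite_quotient_of_finiteIndex
      refine (Set.finite_range (fun q : G ⧸ K => f q.out⁻¹)).subset ?_
      rintro _ ⟨x, rfl⟩
      refine ⟨(x⁻¹ : G), ?_⟩
      obtain ⟨k, hk⟩ := QuotientGroup.mk_out_eq_mul K x⁻¹
      show f ((x⁻¹ : G) : G ⧸ K).out⁻¹ = f x
      rw [hk, mul_inv_rev, inv_inv, hc _ (K.inv_mem k.2), hcon' _ (K.inv_mem k.2), add_zero]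
    obtain ⟨k, hk⟩ := hcne
    have hKfg : Group.FG K := Subgroup.fg_of_index_ne_zero K
    have : Group.FG c.range := Group.fg_range c
    have : Infinite c.range := by
      refine Infinite.of_injective (fun n : ℕ => (c.rangeRestrict k) ^ n) fun a b hab => ?_
      have h1 := congrArg Subtype.val hab
      have h2 : (a : ℝ) * (f k - f 1) = b * (f k - f 1) := by
        have h3 := congrArg Multiplicative.toAdd h1
        simpa [c, toAdd_pow] using h3
      have h4 : f k - f 1 ≠ 0 := hk
      exact_mod_cast mul_right_cancel₀ h4 h2
    obtain ⟨φ, hφ⟩ := hom_int_of_infinite_comm c.range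
    refine ⟨K, hKi, φ.comp c.rangeRestrict, fun h => hφ ?_⟩
    ext x
    obtain ⟨y, rfl⟩ := c.rangeRestrict_surjective x
    exact congrArg Multiplicative.toAdd (DFunLike.congr_fun h y)

end Gromov

namespace Gromov
open scoped Classical commutatorElement
open Polynomial

/-- Kronecker -/
lemma kron1 (q : ℚ[X]) (hq : ∀ z : ℂ, aeval z q = 0 → ‖z‖ ≤ 1) (z : ℂ) (hz : aeval z q = 0)
    (hz0 : z ≠ 0) (hint : IsIntegral ℤ z) : ∃ n : ℕ, 0 < n ∧ z ^ n = 1 := by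
  let K := IntermediateField.adjoin ℚ {z}
  let : NumberField K := {
    to_charZero := K.charZero
    to_finiteDimensional := IntermediateField.adjoin.finiteDimensional hint.tower_top }
  let y : K := ⟨z, IntermediateField.mem_adjoin_simple_self ℚ z⟩
  have hy : aeval y q = 0 := by
    have h1 : algebraMap K ℂ (aeval y q) = aeval z q := (aeval_algebraMap_apply ℂ y q).symm
    rw [hz] at h1
    exact (map_eq_zero_iff _ (FaithfulSMul.algebraMap_injective ↥K ℂ)).1 h1
  obtain ⟨n, hn₀, hn₁⟩ := NumberField.Embeddings.pow_eq_one_of_norm_le_one (x := y) K ℂ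
    (fun h => hz0 (congrArg (algebraMap K ℂ) h))
    (IntermediateField.coe_isIntegral_iff.mp hint) (fun φ => hq _ (by
      have : aeval (φ.toRatAlgHom y) q = φ.toRatAlgHom (aeval y q) := aeval_algHom_apply _ _ _
      rw [hy, map_zero] at this
      exact this))
  exact ⟨n, hn₀, congrArg (algebraMap K ℂ) hn₁⟩

lemma prod_dvd_pow {R : Type*} [CommRing R] (g : R[X]) (s : Multiset R)
    (h : ∀ r ∈ s, (X - C r) ∣ g) : (s.map fun r => X - C r).prod ∣ g ^ s.card := by
  induction s using Multiset.induction with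
  | empty => simp
  | cons a s ih =>
    rw [Multiset.map_cons, Multiset.prod_cons, Multiset.card_cons, pow_succ']
    exact mul_dvd_mul (h a (by simp)) (ih fun r hr => h r (by simp [hr]))

lemma kron2 (I : Ideal ℤ[X]) (p0 : ℤ[X]) (hp0 : p0.Monic) (hp0I : p0 ∈ I)
    (hI : ∀ z : ℂ, (∀ p ∈ I, aeval z p = 0) → ‖z‖ ≤ 1) :
    ∃ k m : ℕ, ∃ n : ℤ, 1 ≤ k ∧ n ≠ 0 ∧ C n * (X * (X ^ k - 1)) ^ m ∈ I := by
  let _ : Algebra ℤ[X] ℚ[X] := Polynomial.algebra ℤ ℚ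
  have hloc : IsLocalization ((nonZeroDivisors ℤ).map (C : ℤ →+* ℤ[X])) ℚ[X] :=
    Polynomial.isLocalization (nonZeroDivisors ℤ) ℚ
  have halg : ∀ p : ℤ[X], algebraMap ℤ[X] ℚ[X] p = p.map (algebraMap ℤ ℚ) := fun p => rfl
  set J := I.map (algebraMap ℤ[X] ℚ[X]) with hJ
  set q := Submodule.IsPrincipal.generator J with hqdef
  have hqJ : ∀ p, p ∈ J ↔ q ∣ p := fun p => Submodule.IsPrincipal.mem_iff_generator_dvd J
  have hroot : ∀ z : ℂ, aeval z q = 0 → ∀ p ∈ I, aeval z p = 0 := by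
    intro z hz p hp
    obtain ⟨r, hr⟩ := (hqJ _).1 (Ideal.mem_map_of_mem (algebraMap ℤ[X] ℚ[X]) hp)
    rw [halg] at hr
    have := congrArg (aeval z) hr
    rwa [aeval_map_algebraMap, map_mul, hz, zero_mul] at this
  have hq0 : q ≠ 0 := by
    intro h
    have := (hqJ _).1 (Ideal.mem_map_of_mem (algebraMap ℤ[X] ℚ[X]) hp0I)
    rw [h, zero_dvd_iff, halg] at this
    exact (hp0.map (algebraMap ℤ ℚ)).ne_zero this
  have hunit : ∀ z : ℂ, aeval z q = 0 → ∃ n : ℕ, 0 < n ∧ (z = 0 ∨ z ^ n = 1) := by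
    intro z hz
    by_cases hz0 : z = 0
    · exact ⟨1, one_pos, Or.inl hz0⟩
    obtain ⟨n, h1, h2⟩ := kron1 q (fun z hz => hI z (hroot z hz)) z hz hz0
      ⟨p0, hp0, hroot z hz p0 hp0I⟩
    exact ⟨n, h1, Or.inr h2⟩
  choose! ord hord1 hord2 using hunit
  set Q := q.map (algebraMap ℚ ℂ) with hQ
  have hQ0 : Q ≠ 0 := (Polynomial.map_ne_zero_iff (algebraMap ℚ ℂ).injective).2 hq0
  have hQr : ∀ z ∈ Q.roots, aeval z q = 0 := by
    intro z hz
    have := (mem_roots hQ0).1 hz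
    rw [IsRoot.def, hQ, eval_map_algebraMap] at this
    exact this
  set k := ∏ z ∈ Q.roots.toFinset, ord z with hk
  have hk1 : 1 ≤ k := Finset.prod_pos fun z hz => hord1 z (hQr z (by simpa using hz))
  have hdvd : Q ∣ (X * (X ^ k - 1)) ^ Q.roots.card := by
    have hspl : Q = C Q.leadingCoeff * (Q.roots.map fun r => X - C r).prod :=
      (IsAlgClosed.splits Q).eq_prod_roots
    have h1 := prod_dvd_pow (X * (X ^ k - 1)) Q.roots (by
      intro z hz
      rw [dvd_iff_isRoot, IsRoot.def]
      simp only [eval_mul, eval_X, eval_sub, eval_pow, eval_one]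
      rcases hord2 z (hQr z hz) with h | h
      · rw [h, zero_mul]
      · obtain ⟨c, hc⟩ : ord z ∣ k := Finset.dvd_prod_of_mem ord (by simpa using hz)
        rw [hc, pow_mul, h, one_pow, sub_self, mul_zero])
    have hu : IsUnit (C Q.leadingCoeff) :=
      isUnit_C.2 (isUnit_iff_ne_zero.2 (leadingCoeff_ne_zero.2 hQ0))
    conv_lhs => rw [hspl]
    exact (hu.mul_left_dvd).2 h1
  have hdvd' : q ∣ (X * (X ^ k - 1)) ^ Q.roots.card := by
    rw [← Polynomial.map_dvd_map' (algebraMap ℚ ℂ)]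
    simpa using hdvd
  obtain ⟨⟨⟨p, hp⟩, ⟨_, n, hn, rfl⟩⟩, h⟩ :=
    (IsLocalization.mem_map_algebraMap_iff ((nonZeroDivisors ℤ).map (C : ℤ →+* ℤ[X])) ℚ[X]).1
      ((hqJ _).2 hdvd')
  refine ⟨k, Q.roots.card, n, hk1, nonZeroDivisors.ne_zero hn, ?_⟩
  have : C n * (X * (X ^ k - 1)) ^ Q.roots.card = p := by
    apply Polynomial.map_injective (algebraMap ℤ ℚ) (algebraMap ℤ ℚ).injective_int
    rw [← halg p, ← h, halg, mul_comm]
    simp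
  rw [this]; exact hp

lemma small_root (η : ℤ[X]) (h0 : η ≠ 0) (h1 : ∀ i, |η.coeff i| ≤ 1) (z : ℂ) (hz : aeval z η = 0) :
    ‖z‖ < 2 := by
  set p := η.map (algebraMap ℤ ℂ)
  have hp0 : p ≠ 0 := (Polynomial.map_ne_zero_iff (algebraMap ℤ ℂ).injective_int).2 h0
  have hr : p.IsRoot z := by rw [IsRoot.def, eval_map_algebraMap]; exact hz
  have hb := hr.norm_lt_cauchyBound hp0
  have hlead : 1 ≤ ‖p.leadingCoeff‖₊ := by
    rw [leadingCoeff_map_of_injective (algebraMap ℤ ℂ).injective_int]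
    have := Int.one_le_abs (leadingCoeff_ne_zero.2 h0)
    rw [← NNReal.coe_le_coe]
    simp only [eq_intCast, coe_nnnorm, NNReal.coe_one, Complex.norm_intCast]
    exact_mod_cast this
  have hsup : (Finset.range p.natDegree).sup (fun i => ‖p.coeff i‖₊) ≤ 1 := by
    refine Finset.sup_le fun i _ => ?_
    rw [← NNReal.coe_le_coe]
    simp only [p, coeff_map, eq_intCast, coe_nnnorm, NNReal.coe_one, Complex.norm_intCast]
    exact_mod_cast h1 i
  have : p.cauchyBound ≤ 2 := by
    unfold cauchyBound
    have : (Finset.range p.natDegree).sup (fun i => ‖p.coeff i‖₊) / ‖p.leadingCoeff‖₊ ≤ 1 :=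
      div_le_one_of_le₀ (hsup.trans hlead) (by simp)
    calc _ ≤ (1 : NNReal) + 1 := by gcongr
      _ = 2 := by norm_num
  have h2 : (p.cauchyBound : ℝ) ≤ 2 := by exact_mod_cast this
  linarith

lemma norm_le_one_of_pow (z : ℂ) (h : ∀ k : ℕ, 1 ≤ k → ‖z ^ k‖ < 2) : ‖z‖ ≤ 1 := by
  by_contra hz
  push Not at hz
  obtain ⟨k, hk⟩ := pow_unbounded_of_one_lt 2 hz
  rcases Nat.eq_zero_or_pos k with rfl | hk0
  · norm_num at hk
  · have := h k hk0
    rw [norm_pow] at this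
    linarith

theorem unip {A : Type*} [AddCommGroup A] [Module.Finite ℤ A] (T : Module.End ℤ A)
    (hT : Function.Injective T)
    (h : ∀ e : A, ∀ k : ℕ, 1 ≤ k → ∃ η : ℤ[X], η ≠ 0 ∧ (∀ i, |η.coeff i| ≤ 1) ∧
      aeval (T ^ k) η e = 0) :
    ∃ k0 m : ℕ, 1 ≤ k0 ∧ ∀ k, k0 ∣ k → (T ^ k - 1) ^ m = 0 := by
  obtain ⟨p0, hp0, hp0e⟩ : IsIntegral ℤ T := Algebra.IsIntegral.isIntegral T
  set I : Ideal ℤ[X] := RingHom.ker (aeval T : ℤ[X] →ₐ[ℤ] Module.End ℤ A) with hIdef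
  obtain ⟨E, hE⟩ := (Module.Finite.fg_top : (⊤ : Submodule ℤ A).FG)
  choose! η hη0 hη1 hη2 using h
  have hprod : ∀ k, 1 ≤ k → (∏ e ∈ E, expand ℤ k (η e k)) ∈ I := by
    intro k hk
    rw [hIdef, RingHom.mem_ker]
    refine LinearMap.ext_on_range (v := ((↑) : E → A)) (by simpa using hE) fun e => ?_
    have h1 : (expand ℤ k (η e k)) ∣ ∏ e ∈ E, expand ℤ k (η e k) := Finset.dvd_prod_of_mem _ e.2
    obtain ⟨r, hr⟩ := h1
    change aeval T (∏ e ∈ E, expand ℤ k (η e k)) _ = _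
    rw [hr, mul_comm, map_mul, Module.End.mul_apply, expand_aeval, hη2 e k hk, map_zero]
    rfl
  obtain ⟨k, m, n, hk, hn, hmem⟩ := kron2 I p0 hp0 hp0e (by
    intro z hz
    refine norm_le_one_of_pow z fun k hk => ?_
    have := hz _ (hprod k hk)
    rw [map_prod, Finset.prod_eq_zero_iff] at this
    obtain ⟨e, -, he⟩ := this
    rw [expand_aeval] at he
    exact small_root _ (hη0 e k hk) (hη1 e k hk) _ he)
  have hTpow : ∀ j, Function.Injective (T ^ j : Module.End ℤ A) := by
    intro j
    rw [Module.End.coe_pow]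
    exact hT.iterate j
  have hker : ∀ a, n • ((T ^ k - 1) ^ m) a = 0 := by
    intro a
    have h1 : aeval T (C n * (X * (X ^ k - 1)) ^ m) = 0 := hmem
    rw [mul_pow, mul_left_comm, map_mul] at h1
    have h2 := DFunLike.congr_fun h1 a
    rw [Module.End.mul_apply, LinearMap.zero_apply] at h2
    have h3 : aeval T (C n * (X ^ k - 1) ^ m) a = 0 := by
      apply hTpow m
      simpa using h2
    simpa using h3
  set B := Submodule.torsionBy ℤ A n with hB
  have hBT : ∀ x ∈ B, T x ∈ B := by
    intro x hx
    rw [hB, Submodule.mem_torsionBy_iff] at hx ⊢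
    rw [← map_zsmul, hx, map_zero]
  have hBfin : Finite B := Module.finite_of_fg_torsion B (by
    intro x
    exact ⟨⟨n, mem_nonZeroDivisors_of_ne_zero hn⟩, Subtype.ext x.2⟩)
  let R : B → B := fun x => ⟨T x, hBT x x.2⟩
  have hRinj : Function.Injective R := fun x y hxy => Subtype.ext (hT (congrArg Subtype.val hxy))
  let e : Equiv.Perm B := Equiv.ofBijective R (Finite.injective_iff_bijective.1 hRinj)
  have hRe : ∀ j (x : B), ((e ^ j) x : A) = (T ^ j) x := by
    intro j
    induction j with
    | zero => simp
    | succ j ih =>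
      intro x
      rw [pow_succ', pow_succ', Equiv.Perm.mul_apply, Module.End.mul_apply, ← ih]
      rfl
  set o := orderOf e
  have ho : 0 < o := orderOf_pos e
  have hfix : ∀ x ∈ B, (T ^ o) x = x := by
    intro x hx
    rw [← hRe o ⟨x, hx⟩, pow_orderOf_eq_one]; rfl
  refine ⟨k * o, m + 1, Nat.mul_pos hk ho, fun j hj => ?_⟩
  have hpd : ((X : ℤ[X]) ^ k - 1) ^ m ∣ (X ^ j - 1) ^ m := by
    obtain ⟨c, hc⟩ := (Dvd.intro _ rfl : k ∣ k * o).trans hj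
    refine pow_dvd_pow_of_dvd ?_ m
    rw [hc, pow_mul]
    simpa using sub_dvd_pow_sub_pow ((X : ℤ[X]) ^ k) 1 c
  obtain ⟨W, hW⟩ := hpd
  obtain ⟨c, hc⟩ := (Dvd.intro_left _ rfl : o ∣ k * o).trans hj
  have hfix2 : ∀ x ∈ B, (T ^ j) x = x := by
    intro x hx
    rw [hc, pow_mul]
    clear hc
    induction c with
    | zero => simp
    | succ c ih => rw [pow_succ, Module.End.mul_apply, hfix x hx, ih]
  ext a
  have h1 := congrArg (aeval T) hW
  simp only [map_pow, map_sub, aeval_X, map_one, map_mul] at h1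
  have h2 : ((T ^ j - 1) ^ m) a ∈ B := by
    rw [h1, hB, Submodule.mem_torsionBy_iff]
    exact hker _
  rw [pow_succ', Module.End.mul_apply, LinearMap.sub_apply, hfix2 _ h2]
  simp

end Gromov

namespace Gromov
open scoped Classical commutatorElement
open Polynomial

/-- polynomial of a word -/
noncomputable def lpoly : List Bool → ℤ[X]
  | [] => 0
  | b :: l => C (if b then 1 else 0) + X * lpoly l

lemma lpoly_coeff (l : List Bool) (i : ℕ) : 0 ≤ (lpoly l).coeff i ∧ (lpoly l).coeff i ≤ 1 := by
  induction l generalizing i with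
  | nil => simp [lpoly]
  | cons b l ih =>
    cases i with
    | zero => simp only [lpoly, coeff_add, coeff_C_zero, mul_coeff_zero, coeff_X_zero, zero_mul,
        add_zero]; split_ifs <;> simp
    | succ i => simp only [lpoly, coeff_add, coeff_C_succ, coeff_X_mul, zero_add]; exact ih i

lemma lpoly_inj : ∀ l l' : List Bool, l.length = l'.length → lpoly l = lpoly l' → l = l'
  | [], [], _, _ => rfl
  | [], _ :: _, h, _ => by simp at h
  | _ :: _, [], h, _ => by simp at h
  | b :: l, b' :: l', h, hp => by
    have h0 := congrArg (fun p => p.coeff 0) hp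
    simp only [lpoly, coeff_add, coeff_C_zero, mul_coeff_zero, coeff_X_zero, zero_mul,
        add_zero] at h0
    have hb : b = b' := by cases b <;> cases b' <;> simp_all
    subst hb
    simp only [lpoly, add_right_inj] at hp
    rw [lpoly_inj l l' (by simpa using h) (mul_left_cancel₀ X_ne_zero hp)]

theorem unip_group {G : Type*} [Group G] {d : ℕ} (hG : PG d G) (A : Subgroup G) [A.Normal]
    (hfg : Group.FG A) (hab : ∀ a ∈ A, ∀ b ∈ A, a * b = b * a) (t : G) :
    ∃ k0 m : ℕ, 1 ≤ k0 ∧ ∀ k, k0 ∣ k → ∀ a ∈ A, (fun x => ⁅t ^ k, x⁆)^[m] a = 1 := by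
  let _ : CommGroup A := { (inferInstance : Group A) with
    mul_comm := fun a b => Subtype.ext (hab a a.2 b b.2) }
  have : Module.Finite ℤ (Additive A) := Module.Finite.iff_addGroup_fg.2 inferInstance
  let c : A →* A := (MulAut.conjNormal t : A ≃* A).toMonoidHom
  let T : Module.End ℤ (Additive A) := (MonoidHom.toAdditive c).toIntLinearMap
  have hT : ∀ (k : ℕ) (x : Additive A),
      ((Additive.toMul ((T ^ k) x) : A) : G) = t ^ k * (Additive.toMul x : A) * (t ^ k)⁻¹ := by
    intro k
    induction k with
    | zero => simp
    | succ k ih =>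
      intro x
      rw [pow_succ', Module.End.mul_apply]
      change t * ((Additive.toMul ((T ^ k) x) : A) : G) * t⁻¹ = _
      rw [ih]; group
  obtain ⟨k0, m, hk0, hm⟩ := unip T (fun x y h => (MulAut.conjNormal t : A ≃* A).injective h) (by
    intro e k hk
    set s := t ^ k with hs
    set g : G := ((Additive.toMul e : A) : G) with hg
    obtain ⟨l, l', h1, h2, h3⟩ := hG.collision (fun b => (if b then g else 1) * s)
    have key : ∀ l : List Bool, (l.map (fun b => (if b then g else 1) * s)).prod =
        ((Additive.toMul (aeval (T ^ k) (lpoly l) e) : A) : G) * s ^ l.length := by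
      intro l
      induction l with
      | nil => simp [lpoly]
      | cons b l ih =>
        have h4 : aeval (T ^ k) (lpoly (b :: l)) e = (if b then e else 0) +
            (T ^ k) (aeval (T ^ k) (lpoly l) e) := by
          cases b <;> simp [lpoly]
        rw [List.map_cons, List.prod_cons, ih, h4, toMul_add, Subgroup.coe_mul, hT,
          List.length_cons, pow_succ']
        cases b
        · simp [hs, mul_assoc]
        · simp [hs, hg, mul_assoc]
    rw [key, key, h1, mul_left_inj] at h3
    refine ⟨lpoly l - lpoly l', fun h => h2 (lpoly_inj _ _ h1 (sub_eq_zero.1 h)), fun i => ?_, ?_⟩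
    · have ha := lpoly_coeff l i
      have hb := lpoly_coeff l' i
      rw [coeff_sub, abs_le]
      omega
    · rw [map_sub, LinearMap.sub_apply, sub_eq_zero]
      exact Subtype.ext h3)
  refine ⟨k0, m, hk0, fun k hk a ha => ?_⟩
  have key : ∀ (j : ℕ) (x : Additive A), (((Additive.toMul (((T ^ k - 1) ^ j) x) : A)) : G) =
      (fun x : G => ⁅t ^ k, x⁆)^[j] ((Additive.toMul x : A) : G) := by
    intro j
    induction j with
    | zero => simp
    | succ j ih =>
      intro x
      rw [pow_succ, Module.End.mul_apply, ih, Function.iterate_succ_apply]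
      congr 1
      rw [LinearMap.sub_apply, toMul_sub, Subgroup.coe_div, hT, commutatorElement_def,
        div_eq_mul_inv]
      rfl
  have := key m (Additive.ofMul ⟨a, ha⟩)
  rw [hm k hk] at this
  exact this.symm

/-- unipotency along the lower central series -/
theorem unip_lcs {G : Type*} [Group G] {d : ℕ} (hG : PG d G) (K : Subgroup G) [K.Normal]
    (hfg : Group.FG K) (t : G) (i : ℕ) :
    ∃ k0 m : ℕ, 1 ≤ k0 ∧ ∀ k, k0 ∣ k → ∀ a ∈ K.lowerCentralSeries i,
      (fun x => ⁅t ^ k, x⁆)^[m] a ∈ K.lowerCentralSeries (i + 1) := by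
  set π := QuotientGroup.mk' (K.lowerCentralSeries (i + 1)) with hπ
  have hsurj : Function.Surjective π := QuotientGroup.mk'_surjective _
  set A := (K.lowerCentralSeries i).map π with hA
  have hAn : A.Normal := Subgroup.Normal.map inferInstance π hsurj
  have hAfg : Group.FG A := by
    obtain ⟨S, hS⟩ := hfg.out
    obtain ⟨X, hX1, hX2⟩ := lcs_fg S hS i
    rw [Group.fg_iff_subgroup_fg]
    refine ⟨(X.image K.subtype).image π, ?_⟩
    have h1 := congrArg (Subgroup.map K.subtype) hX2
    rw [Subgroup.map_sup, Subgroup.top_subtype_lowerCentralSeries,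
      Subgroup.top_subtype_lowerCentralSeries, MonoidHom.map_closure] at h1
    rw [hA, h1, Subgroup.map_sup, MonoidHom.map_closure]
    have h2 : Subgroup.map π (K.lowerCentralSeries (i + 1)) = ⊥ := by
      rw [Subgroup.map_eq_bot_iff, hπ, QuotientGroup.ker_mk']
    rw [h2, sup_bot_eq, Finset.coe_image, Finset.coe_image]
  obtain ⟨k0, m, hk0, h⟩ := unip_group (hG.of_surjective π hsurj) A hAfg (by
    rintro _ ⟨a, ha, rfl⟩ _ ⟨b, hb, rfl⟩
    have : π ⁅a, b⁆ = 1 := by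
      rw [hπ, QuotientGroup.mk'_apply, QuotientGroup.eq_one_iff]
      exact Subgroup.commutator_mem_commutator ha (Subgroup.lowerCentralSeries_le_self K i hb)
    rw [map_commutatorElement, commutatorElement_eq_one_iff_mul_comm] at this
    exact this) (π t)
  refine ⟨k0, m, hk0, fun k hk a ha => ?_⟩
  have h1 := h k hk (π a) ⟨a, ha, rfl⟩
  have key : ∀ (j : ℕ) (x : G), π ((fun x => ⁅t ^ k, x⁆)^[j] x) =
      (fun x => ⁅π t ^ k, x⁆)^[j] (π x) := by
    intro j
    induction j with
    | zero => simp
    | succ j ih =>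
      intro x
      rw [Function.iterate_succ_apply, Function.iterate_succ_apply, ih, map_commutatorElement,
        map_pow]
  rw [← key] at h1
  exact (QuotientGroup.eq_one_iff _).1 h1

lemma comm_gen {G : Type*} [Group G] (Z : Subgroup G) [Z.Normal] (Y : Set G)
    (hY : Subgroup.closure Y = ⊤) (x : G) (h : ∀ y ∈ Y, ⁅x, y⁆ ∈ Z) (y : G) : ⁅x, y⁆ ∈ Z := by
  have h1 := commutator_le_of_gens Z (Subgroup.zpowers x) {x} Y
    (by rw [Subgroup.zpowers_eq_closure]) ⊤ hY.ge (by rintro _ rfl y hy; exact h y hy)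
  exact h1 (Subgroup.commutator_mem_commutator (Subgroup.mem_zpowers x) trivial)

lemma nilp_crit {G : Type*} [Group G] (K : Subgroup G) [K.Normal] (s : G)
    (hgen : K ⊔ Subgroup.zpowers s = ⊤) (c : ℕ) (hc : K.lowerCentralSeries c = ⊥)
    (h : ∀ i, ∃ m : ℕ, ∀ a ∈ K.lowerCentralSeries i,
      (fun x => ⁅s, x⁆)^[m] a ∈ K.lowerCentralSeries (i + 1)) : Group.IsNilpotent G := by
  have hY : Subgroup.closure ((K : Set G) ∪ {s}) = ⊤ := by
    rw [Subgroup.closure_union, Subgroup.closure_eq, ← Subgroup.zpowers_eq_closure, hgen]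
  have key : ∀ i ≤ c, ∃ n, K.lowerCentralSeries (c - i) ≤ Subgroup.upperCentralSeries G n := by
    intro i
    induction i with
    | zero => intro _; exact ⟨0, by rw [Nat.sub_zero, hc]; exact bot_le⟩
    | succ i ih =>
      intro hi
      obtain ⟨n, hn⟩ := ih (by omega)
      obtain ⟨m, hm⟩ := h (c - (i + 1))
      rw [show c - (i + 1) + 1 = c - i by omega] at hm
      refine ⟨n + m, fun a ha => ?_⟩
      have main : ∀ (j : ℕ) (x : G), x ∈ K.lowerCentralSeries (c - (i + 1)) →
          (fun x => ⁅s, x⁆)^[j] x ∈ K.lowerCentralSeries (c - i) →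
          x ∈ Subgroup.upperCentralSeries G (n + j) := by
        intro j
        induction j with
        | zero => intro x _ hx; exact hn hx
        | succ j ihj =>
          intro x hx hx2
          rw [Function.iterate_succ_apply] at hx2
          have hsx : ⁅s, x⁆ ∈ K.lowerCentralSeries (c - (i + 1)) := by
            rw [commutatorElement_def]
            exact mul_mem (Subgroup.Normal.conj_mem inferInstance x hx s) (inv_mem hx)
          have h1 := ihj _ hsx hx2
          rw [← add_assoc, Subgroup.mem_upperCentralSeries_succ_iff]
          intro y
          refine comm_gen (Subgroup.upperCentralSeries G (n + j)) _ hY x ?_ y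
          rintro y (hy | rfl)
          · refine Subgroup.upperCentralSeries_mono G (Nat.le_add_right n j) (hn ?_)
            rw [show c - i = c - (i + 1) + 1 by omega]
            exact Subgroup.commutator_mem_commutator hx hy
          · rw [← commutatorElement_inv]; exact inv_mem h1
      exact main m a ha (hm a ha)
  obtain ⟨n, hn⟩ := key c le_rfl
  rw [Nat.sub_self, Subgroup.lowerCentralSeries_zero] at hn
  refine ⟨⟨n + 1, ?_⟩⟩
  rw [eq_top_iff]
  rintro x -
  rw [Subgroup.mem_upperCentralSeries_succ_iff]
  intro y
  have h1 := commutator_le_of_gens (Subgroup.upperCentralSeries G n) ⊤ _ _ hY.ge ⊤ hY.ge (by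
    rintro x hx y hy
    rcases hx with hx | rfl
    · rw [commutatorElement_def, mul_assoc, mul_assoc, ← mul_assoc y]
      exact mul_mem (hn hx) (Subgroup.Normal.conj_mem inferInstance _ (inv_mem (hn hx)) y)
    · rcases hy with hy | rfl
      · rw [commutatorElement_def]
        exact mul_mem (Subgroup.Normal.conj_mem inferInstance _ (hn hy) _) (inv_mem (hn hy))
      · simp)
  exact h1 (Subgroup.commutator_mem_commutator trivial trivial)

theorem ext_nilp {G : Type*} [Group G] {d : ℕ} (hG : PG d G) (K : Subgroup G) [K.Normal]
    (hfg : Group.FG K) (hnil : Group.IsNilpotent K) (t : G) :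
    ∃ k : ℕ, 1 ≤ k ∧ Group.IsNilpotent (K ⊔ Subgroup.zpowers (t ^ k) : Subgroup G) := by
  obtain ⟨c, hc⟩ := (Subgroup.isNilpotent_iff_lowerCentralSeries K).1 hnil
  choose k0 m hk0 hm using unip_lcs hG K hfg t
  set k := ∏ i ∈ Finset.range c, k0 i with hk
  refine ⟨k, Nat.succ_le_of_lt (Finset.prod_pos fun i _ => hk0 i), ?_⟩
  set L := K ⊔ Subgroup.zpowers (t ^ k) with hL
  have hKL : K ≤ L := le_sup_left
  have hs : t ^ k ∈ L := (le_sup_right : _ ≤ L) (Subgroup.mem_zpowers _)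
  have hmap : (K.subgroupOf L).map L.subtype = K := by
    rw [Subgroup.map_subgroupOf_eq_of_le hKL]
  have hlcs : ∀ i, ((K.subgroupOf L).lowerCentralSeries i).map L.subtype =
      K.lowerCentralSeries i := fun i => by rw [Subgroup.map_lowerCentralSeries, hmap]
  have hmem : ∀ i (x : L), x ∈ (K.subgroupOf L).lowerCentralSeries i ↔
      (x : G) ∈ K.lowerCentralSeries i := by
    intro i x
    rw [← hlcs]
    exact (Subgroup.mem_map_iff_mem L.subtype_injective).symm
  refine nilp_crit (K.subgroupOf L) ⟨t ^ k, hs⟩ ?_ c ?_ ?_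
  · apply Subgroup.map_injective L.subtype_injective
    rw [Subgroup.map_sup, hmap, MonoidHom.map_zpowers, ← MonoidHom.range_eq_map,
      Subgroup.range_subtype]
    rfl
  · apply Subgroup.map_injective L.subtype_injective
    rw [hlcs, hc, Subgroup.map_bot]
  · intro i
    by_cases hi : i < c
    · refine ⟨m i, fun a ha => ?_⟩
      rw [hmem] at ha ⊢
      have h1 := hm i k (Finset.dvd_prod_of_mem k0 (Finset.mem_range.2 hi)) a ha
      have key : ∀ (j : ℕ) (x : L), (((fun x => ⁅(⟨t ^ k, hs⟩ : L), x⁆)^[j] x : L) : G) =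
          (fun x => ⁅t ^ k, x⁆)^[j] (x : G) := by
        intro j
        induction j with
        | zero => simp
        | succ j ih =>
          intro x
          rw [Function.iterate_succ_apply, Function.iterate_succ_apply, ih]
          rfl
      rw [key]; exact h1
    · refine ⟨0, fun a ha => ?_⟩
      rw [hmem] at ha ⊢
      have h1 := K.lowerCentralSeries_antitone (not_lt.1 hi) ha
      rw [hc, Subgroup.mem_bot] at h1
      simp [h1]

end Gromov

namespace Gromov
open scoped Classical commutatorElement

section
variable {G : Type*} [Group G]

/-- group generated by the first conjugates -/
def CV (t e : G) (r : ℕ) : Subgroup G :=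
  Subgroup.closure ((fun i : ℕ => t ^ i * e * (t ^ i)⁻¹) '' (Finset.range r : Set ℕ))

lemma CV_mono (t e : G) {r r' : ℕ} (h : r ≤ r') : CV t e r ≤ CV t e r' :=
  Subgroup.closure_mono (Set.image_mono (by exact_mod_cast Finset.range_mono h))

lemma CV_mem (t e : G) {r i : ℕ} (h : i < r) : t ^ i * e * (t ^ i)⁻¹ ∈ CV t e r :=
  Subgroup.subset_closure ⟨i, by simpa using h, rfl⟩

lemma CV_conj (t e : G) (r : ℕ) (x : G) (hx : x ∈ CV t e r) : t * x * t⁻¹ ∈ CV t e (r + 1) := by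
  have : CV t e r ≤ (CV t e (r + 1)).comap (MulAut.conj t).toMonoidHom := by
    rw [CV, Subgroup.closure_le]
    rintro _ ⟨i, hi, rfl⟩
    have h2 := CV_mem t e (r := r + 1) (i := i + 1) (by simpa using hi)
    have h3 : t * (t ^ i * e * (t ^ i)⁻¹) * t⁻¹ = t ^ (i + 1) * e * (t ^ (i + 1))⁻¹ := by
      rw [pow_succ']; group
    rw [← h3] at h2
    exact h2
  exact this hx

lemma CV_word (t e : G) (l : List Bool) :
    (l.map (fun b => (if b then e else 1) * t)).prod * (t ^ l.length)⁻¹ ∈ CV t e l.length := by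
  induction l with
  | nil => simp
  | cons b l ih =>
    have h1 := CV_conj t e _ _ ih
    have h2 : (if b then e else 1) ∈ CV t e (l.length + 1) := by
      cases b
      · exact one_mem _
      · simpa using CV_mem t e (Nat.succ_pos l.length)
    have h3 := mul_mem h2 h1
    rw [List.map_cons, List.prod_cons, List.length_cons]
    convert h3 using 1
    rw [pow_succ']; group

lemma CV_back {d : ℕ} (hG : PG d G) (t e : G) : ∃ r, t⁻¹ * e * t ∈ CV t e r := by
  obtain ⟨l, l', h1, h2, h3⟩ := hG.collision (fun b => (if b then e else 1) * t)
  suffices ∀ l l' : List Bool, l.length = l'.length → l ≠ l' →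
      (l.map (fun b => (if b then e else 1) * t)).prod =
      (l'.map (fun b => (if b then e else 1) * t)).prod → ∃ r, t⁻¹ * e * t ∈ CV t e r from
    this l l' h1 h2 h3
  clear h1 h2 h3 l l'
  have aux : ∀ l l' : List Bool, l.length = l'.length →
      ((e * t) * (l.map (fun b => (if b then e else 1) * t)).prod =
      t * (l'.map (fun b => (if b then e else 1) * t)).prod) → ∃ r, t⁻¹ * e * t ∈ CV t e r := by
    intro l l' hl h
    refine ⟨l.length, ?_⟩
    have h1 := CV_word t e l
    have h2 := CV_word t e l'
    rw [← hl] at h2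
    convert mul_mem h2 (inv_mem h1) using 1
    have h4 : (l'.map (fun b => (if b then e else 1) * t)).prod =
      t⁻¹ * (e * t) * (l.map (fun b => (if b then e else 1) * t)).prod := by
      rw [mul_assoc, h, inv_mul_cancel_left]
    rw [h4]; group
  intro l
  induction l with
  | nil => intro l' h1 h2; exact absurd (List.length_eq_zero_iff.1 h1.symm).symm h2
  | cons b l ih =>
    intro l' h1 h2 h3
    cases l' with
    | nil => simp at h1
    | cons b' l' =>
      have hl : l.length = l'.length := by simpa using h1
      rw [List.map_cons, List.map_cons, List.prod_cons, List.prod_cons] at h3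
      cases b <;> cases b'
      · exact ih l' hl (fun h => h2 (by rw [h])) (mul_left_cancel h3)
      · exact aux l' l hl.symm (by simpa using h3.symm)
      · exact aux l l' hl (by simpa using h3)
      · exact ih l' hl (fun h => h2 (by rw [h])) (mul_left_cancel h3)

lemma CV_back_all {d : ℕ} (hG : PG d G) (t e : G) :
    ∃ r, ∀ j : ℕ, (t ^ j)⁻¹ * e * t ^ j ∈ CV t e r := by
  obtain ⟨r, hr⟩ := CV_back hG t e
  refine ⟨r + 1, fun j => ?_⟩
  have hst : CV t e (r + 1) ≤ (CV t e (r + 1)).comap (MulAut.conj t⁻¹).toMonoidHom := by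
    conv_lhs => rw [CV]
    rw [Subgroup.closure_le]
    rintro _ ⟨i, hi, rfl⟩
    have hi' : i < r + 1 := by simpa using hi
    change t⁻¹ * (t ^ i * e * (t ^ i)⁻¹) * t⁻¹⁻¹ ∈ CV t e (r + 1)
    cases i with
    | zero => simpa using CV_mono t e (Nat.le_succ r) hr
    | succ i =>
      convert CV_mem t e (r := r + 1) (i := i) (by omega) using 1
      rw [pow_succ']; group
  induction j with
  | zero => simpa using CV_mem t e (Nat.succ_pos r)
  | succ j ih =>
    have := hst ih
    change t⁻¹ * ((t ^ j)⁻¹ * e * t ^ j) * t⁻¹⁻¹ ∈ CV t e (r + 1) at this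
    convert this using 1
    rw [pow_succ]; group

lemma CV_fg (t e : G) (r : ℕ) : (CV t e r).FG :=
  ⟨(Finset.range r).image (fun i : ℕ => t ^ i * e * (t ^ i)⁻¹), by rw [CV, Finset.coe_image]⟩

/-- the normal-by-t closure of `e` is finitely generated -/
lemma conj_fg {d : ℕ} (hG : PG d G) (t e : G) :
    (Subgroup.closure (Set.range fun j : ℤ => t ^ j * e * (t ^ j)⁻¹)).FG := by
  obtain ⟨r, hr⟩ := CV_back_all hG t e
  obtain ⟨r', hr'⟩ := CV_back_all hG t⁻¹ e
  have : Subgroup.closure (Set.range fun j : ℤ => t ^ j * e * (t ^ j)⁻¹) =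
      CV t e r ⊔ CV t⁻¹ e r' := by
    apply le_antisymm
    · rw [Subgroup.closure_le]
      rintro _ ⟨j, rfl⟩
      obtain ⟨n, rfl | rfl⟩ := j.eq_nat_or_neg
      · refine (le_sup_right : CV t⁻¹ e r' ≤ _) ?_
        simpa using hr' n
      · refine (le_sup_left : CV t e r ≤ _) ?_
        simpa using hr n
    · refine sup_le ?_ ?_
      · rw [CV]
        refine Subgroup.closure_mono ?_
        rintro _ ⟨i, -, rfl⟩
        exact ⟨i, by simp⟩
      · rw [CV]
        refine Subgroup.closure_mono ?_
        rintro _ ⟨i, -, rfl⟩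
        exact ⟨-i, by simp⟩
  rw [this]
  exact (CV_fg t e r).sup (CV_fg _ e r')

variable (N : Subgroup G) [N.Normal] (t : G) (hcov : ∀ g, ∃ n : ℤ, ∃ y ∈ N, g = y * t ^ n)
  (htn : ∀ n : ℤ, t ^ n ∈ N → n = 0)

include hcov htn in
lemma ker_fg {d : ℕ} (hG : PG d G) (hfg : Group.FG G) : Group.FG N := by
  obtain ⟨X, hX⟩ := hfg.out
  choose n y hy hxy using hcov
  set M : Subgroup G := ⨆ x ∈ X,
    Subgroup.closure (Set.range fun j : ℤ => t ^ j * y x * (t ^ j)⁻¹) with hM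
  have hMfg : M.FG := by
    rw [hM]
    exact Subgroup.FG.biSup_finset X _ fun x _ => conj_fg hG t (y x)
  have hMN : M ≤ N := by
    refine iSup₂_le fun x _ => ?_
    rw [Subgroup.closure_le]
    rintro _ ⟨j, rfl⟩
    exact Subgroup.Normal.conj_mem inferInstance _ (hy x) _
  have hMt : ∀ k : ℤ, ∀ m ∈ M, t ^ k * m * (t ^ k)⁻¹ ∈ M := by
    intro k m hm
    have : M ≤ M.comap (MulAut.conj (t ^ k)).toMonoidHom := by
      conv_lhs => rw [hM]
      refine iSup₂_le fun x hx => ?_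
      rw [Subgroup.closure_le]
      rintro _ ⟨j, rfl⟩
      change t ^ k * (t ^ j * y x * (t ^ j)⁻¹) * (t ^ k)⁻¹ ∈ M
      refine (le_iSup₂_of_le x hx le_rfl : _ ≤ M) (Subgroup.subset_closure ⟨k + j, ?_⟩)
      simp only [zpow_add]; group
    exact this hm
  have hall : ∀ g : G, ∃ m ∈ M, ∃ k : ℤ, g = m * t ^ k := by
    intro g
    have hg : g ∈ Subgroup.closure (X : Set G) := by rw [hX]; trivial
    induction hg using Subgroup.closure_induction with
    | mem x hx =>
      exact ⟨y x, (le_iSup₂_of_le x hx le_rfl : _ ≤ M) (Subgroup.subset_closure ⟨0, by simp⟩),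
        n x, hxy x⟩
    | one => exact ⟨1, one_mem _, 0, by simp⟩
    | mul a b _ _ ha hb =>
      obtain ⟨m, hm, k, rfl⟩ := ha
      obtain ⟨m', hm', k', rfl⟩ := hb
      refine ⟨m * (t ^ k * m' * (t ^ k)⁻¹), mul_mem hm (hMt k m' hm'), k + k', ?_⟩
      rw [zpow_add]; group
    | inv a _ ha =>
      obtain ⟨m, hm, k, rfl⟩ := ha
      refine ⟨t ^ (-k) * m⁻¹ * (t ^ (-k))⁻¹, hMt _ _ (inv_mem hm), -k, ?_⟩
      group
  have hNM : N = M := by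
    refine le_antisymm (fun x hx => ?_) hMN
    obtain ⟨m, hm, k, rfl⟩ := hall x
    have h1 : t ^ k ∈ N := by
      have := mul_mem (inv_mem (hMN hm)) hx
      rwa [inv_mul_cancel_left] at this
    rw [htn k h1]
    simpa using hm
  rw [Group.fg_iff_subgroup_fg, hNM]
  exact hMfg

include htn in
lemma growth_mul {d : ℕ} (hG : PG d G) (F : Finset N) :
    ∃ C : ℕ, ∀ n, 1 ≤ n → n * (F ^ n).card ≤ C * n ^ d := by
  set F' : Finset G := F.image N.subtype ∪ {1, t} with hF'
  obtain ⟨C, hC⟩ := hG F'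
  refine ⟨C * 2 ^ d, fun n hn => ?_⟩
  have h1 : n * (F ^ n).card ≤ (F' ^ (2 * n)).card := by
    have := Finset.card_le_card_of_injOn (s := (F ^ n) ×ˢ Finset.range n) (t := F' ^ (2 * n))
      (fun p : N × ℕ => (p.1 : G) * t ^ p.2) ?_ ?_
    · simpa [Finset.card_product, mul_comm] using this
    · rintro ⟨x, i⟩ hx
      simp only [Finset.coe_product, Set.mem_prod, Finset.mem_coe, Finset.mem_range] at hx
      rw [Finset.mem_coe, two_mul, pow_add]
      refine Finset.mul_mem_mul ?_ ?_
      · refine Finset.pow_subset_pow_left (s := F.image N.subtype) Finset.subset_union_left ?_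
        rw [← Finset.image_pow]
        exact Finset.mem_image_of_mem _ hx.1
      · exact Finset.pow_subset_pow_right (by simp [hF']) hx.2.le
          (Finset.pow_mem_pow (by simp [hF']))
    · rintro ⟨x, i⟩ _ ⟨y, j⟩ _ hxy
      have hxy : (x : G) * t ^ i = y * t ^ j := hxy
      have h2 : t ^ ((i : ℤ) - j) ∈ N := by
        have h3 : t ^ ((i : ℤ) - j) = (x : G)⁻¹ * y := by
          rw [zpow_sub, zpow_natCast, zpow_natCast, mul_inv_eq_iff_eq_mul, mul_assoc, ← hxy,
            inv_mul_cancel_left]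
        rw [h3]
        exact mul_mem (inv_mem x.2) y.2
      have h4 := htn _ h2
      have h5 : i = j := by omega
      subst h5
      rw [Prod.mk.injEq]
      exact ⟨Subtype.ext (mul_right_cancel hxy), rfl⟩
  calc _ ≤ _ := h1
    _ ≤ C * (2 * n) ^ d := hC (2 * n) (by omega)
    _ = _ := by rw [mul_pow, mul_assoc]

end
end Gromov

namespace Gromov
open scoped Classical commutatorElement

lemma hom_split {G : Type*} [Group G] (φ : G →* Multiplicative ℤ) (hφ : φ ≠ 1) :
    ∃ t : G, (∀ g, ∃ n : ℤ, ∃ y ∈ φ.ker, g = y * t ^ n) ∧ (∀ n : ℤ, t ^ n ∈ φ.ker → n = 0) := by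
  obtain ⟨⟨u, hu⟩, hgen⟩ := (inferInstance : IsCyclic φ.range).exists_generator
  obtain ⟨t, rfl⟩ := hu
  have hgen' : ∀ g, ∃ n : ℤ, φ g = φ t ^ n := by
    intro g
    obtain ⟨n, hn⟩ := hgen ⟨φ g, g, rfl⟩
    refine ⟨n, ?_⟩
    have := congrArg Subtype.val hn
    simpa using this.symm
  refine ⟨t, fun g => ?_, fun n hn => ?_⟩
  · obtain ⟨n, hn⟩ := hgen' g
    refine ⟨n, g * (t ^ n)⁻¹, ?_, by group⟩
    rw [MonoidHom.mem_ker, map_mul, map_inv, map_zpow, hn, mul_inv_cancel]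
  · rw [MonoidHom.mem_ker, map_zpow] at hn
    by_contra h0
    apply hφ
    have h1 : φ t = 1 := by
      have h2 : n * Multiplicative.toAdd (φ t) = 0 := by
        have := congrArg Multiplicative.toAdd hn
        simpa using this
      rcases mul_eq_zero.1 h2 with h | h
      · exact absurd h h0
      · exact h
    ext g
    obtain ⟨n, hn⟩ := hgen' g
    rw [hn, h1]; simp

lemma char_sub {N : Type*} [Group N] (hfg : Group.FG N) (H0 : Subgroup N) (hH : H0.index ≠ 0)
    (hnil : Group.IsNilpotent H0) :
    ∃ K : Subgroup N, K.Characteristic ∧ K.index ≠ 0 ∧ Group.IsNilpotent K := by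
  set m := H0.index with hm
  let K : Subgroup N := ⨅ ψ : N →* Equiv.Perm (Fin m), ψ.ker
  have hfin : Finite (N →* Equiv.Perm (Fin m)) := by
    obtain ⟨S, hS⟩ := hfg.out
    refine Finite.of_injective
      (fun ψ : N →* Equiv.Perm (Fin m) => (fun s : S => ψ s : S → Equiv.Perm (Fin m))) ?_
    intro ψ χ h
    refine MonoidHom.eq_of_eqOn_dense hS fun s hs => ?_
    exact congrFun h ⟨s, hs⟩
  refine ⟨K, ?_, ?_, ?_⟩
  · rw [Subgroup.characteristic_iff_le_comap]
    intro e x hx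
    simp only [K, Subgroup.mem_iInf, Subgroup.mem_comap] at hx ⊢
    intro ψ
    exact hx (ψ.comp e.toMonoidHom)
  · have : ∀ ψ : N →* Equiv.Perm (Fin m), ψ.ker.index ≠ 0 := fun ψ => by
      have := Subgroup.finiteIndex_ker ψ
      exact this.index_ne_zero
    exact Subgroup.index_iInf_ne_zero this
  · have hle : K ≤ H0 := by
      have hf : Finite (N ⧸ H0) := by
        have : H0.FiniteIndex := ⟨hH⟩
        infer_instance
      let e : (N ⧸ H0) ≃ Fin m := Finite.equivFin (N ⧸ H0)
      intro x hx
      have := (Subgroup.mem_iInf.1 hx)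
        ((e.permCongrHom.toMonoidHom).comp (MulAction.toPermHom N (N ⧸ H0)))
      rw [MonoidHom.mem_ker] at this
      have h1 : MulAction.toPermHom N (N ⧸ H0) x = 1 := by
        apply e.permCongrHom.injective
        rw [map_one]
        exact this
      have h2 := congrArg (fun p : Equiv.Perm (N ⧸ H0) => p ((1 : N) : N ⧸ H0)) h1
      have h3 : ((x * 1 : N) : N ⧸ H0) = ((1 : N) : N ⧸ H0) := h2
      rw [mul_one, eq_comm, QuotientGroup.eq] at h3
      simpa using h3
    exact Group.nilpotent_of_mulEquiv (Subgroup.subgroupOfEquivOfLe hle)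

lemma index_of_finite_cover {G : Type*} [Group G] (L : Subgroup G) (A : Set G) (hA : A.Finite)
    (h : ∀ g, ∃ a ∈ A, ∃ l ∈ L, g = a * l) : L.index ≠ 0 := by
  have : Finite (G ⧸ L) := by
    have := hA.to_subtype
    refine Finite.of_surjective (fun a : A => ((a : G) : G ⧸ L)) ?_
    intro q
    induction q using QuotientGroup.induction_on with
    | H g =>
      obtain ⟨a, ha, l, hl, rfl⟩ := h g
      exact ⟨⟨a, ha⟩, by simp [QuotientGroup.eq, hl]⟩
  exact Subgroup.index_ne_zero_of_finite

lemma step {G : Type*} [Group G] {d : ℕ} (hG : PG d G) (N : Subgroup G) [N.Normal] (t : G)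
    (hcov : ∀ g, ∃ n : ℤ, ∃ y ∈ N, g = y * t ^ n) (hfg : Group.FG N)
    (hN : ∃ H : Subgroup N, H.index ≠ 0 ∧ Group.IsNilpotent H) :
    ∃ H : Subgroup G, H.index ≠ 0 ∧ Group.IsNilpotent H := by
  obtain ⟨H0, h0, hnil0⟩ := hN
  obtain ⟨K, hchar, hK, hnil⟩ := char_sub hfg H0 h0 hnil0
  have hKn : (K.map N.subtype).Normal := ConjAct.normal_of_characteristic_of_normal
  have e : K ≃* K.map N.subtype := K.equivMapOfInjective _ N.subtype_injective
  have : K.FiniteIndex := ⟨hK⟩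
  have hKfg : Group.FG K := Subgroup.fg_of_index_ne_zero K
  have hKfg' : Group.FG (K.map N.subtype) := by
    exact Group.fg_of_surjective (f := e.toMonoidHom) e.surjective
  have hKnil' : Group.IsNilpotent (K.map N.subtype) := Group.nilpotent_of_mulEquiv e
  obtain ⟨k, hk, hL⟩ := ext_nilp hG (K.map N.subtype) hKfg' hKnil' t
  refine ⟨_, ?_, hL⟩
  have hfinq : Finite (N ⧸ K) := inferInstance
  refine index_of_finite_cover _
    (Set.range (fun p : (N ⧸ K) × Fin k => ((p.1.out : N) : G) * t ^ (p.2 : ℕ))) 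
    (Set.finite_range _) fun g => ?_
  obtain ⟨n, y, hy, rfl⟩ := hcov g
  set r := (n % (k : ℤ)).toNat with hr
  have hk' : (0 : ℤ) < k := by omega
  have hr1 : (r : ℤ) = n % k := Int.toNat_of_nonneg (Int.emod_nonneg _ hk'.ne')
  have hr2 : r < k := by have := Int.emod_lt_of_pos n hk'; omega
  set q : N ⧸ K := ((⟨y, hy⟩ : N) : N ⧸ K) with hq
  have h1 : (q.out : N)⁻¹ * ⟨y, hy⟩ ∈ K := by
    rw [← QuotientGroup.eq]; simp [hq]
  set z : G := ((q.out : N) : G)⁻¹ * y with hz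
  have hzK : z ∈ K.map N.subtype := ⟨_, h1, rfl⟩
  refine ⟨_, ⟨(q, ⟨r, hr2⟩), rfl⟩, ((t ^ r)⁻¹ * z * t ^ r) * (t ^ k) ^ (n / k), ?_, ?_⟩
  · refine mul_mem (Subgroup.mem_sup_left ?_)
      (Subgroup.mem_sup_right (zpow_mem (Subgroup.mem_zpowers _) _))
    have := hKn.conj_mem z hzK (t ^ r)⁻¹
    simpa using this
  · have h2 : t ^ n = t ^ r * (t ^ k) ^ (n / (k : ℤ)) := by
      rw [← zpow_natCast t r, ← zpow_natCast t k, ← zpow_mul, ← zpow_add, hr1, Int.emod_add_mul_ediv]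
    rw [h2, hz]; simp only; group

theorem main.{u} (d : ℕ) : ∀ (G : Type u) [Group G], Group.FG G → PG d G →
    ∃ H : Subgroup G, H.index ≠ 0 ∧ Group.IsNilpotent H := by
  induction d with
  | zero =>
    intro G _ hfg hG
    by_cases hfin : Finite G
    · exact ⟨⊥, Subgroup.index_ne_zero_of_finite, inferInstance⟩
    have : Infinite G := not_finite_iff_infinite.1 hfin
    obtain ⟨H, hH, φ, hφ⟩ := hom_exists hG
    obtain ⟨t, hcov, htn⟩ := hom_split φ hφ
    obtain ⟨C, hC⟩ := growth_mul φ.ker t htn (hG.subgroup H) {1}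
    have := hC (C + 1) (by omega)
    simp at this
  | succ d ih =>
    intro G _ hfg hG
    by_cases hfin : Finite G
    · exact ⟨⊥, Subgroup.index_ne_zero_of_finite, inferInstance⟩
    have : Infinite G := not_finite_iff_infinite.1 hfin
    obtain ⟨H, hH, φ, hφ⟩ := hom_exists hG
    obtain ⟨t, hcov, htn⟩ := hom_split φ hφ
    have : H.FiniteIndex := ⟨hH⟩
    have hHfg : Group.FG H := Subgroup.fg_of_index_ne_zero H
    have hNfg := ker_fg φ.ker t hcov htn (hG.subgroup H) hHfg
    have hNpg : PG d φ.ker := by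
      intro F
      obtain ⟨C, hC⟩ := growth_mul φ.ker t htn (hG.subgroup H) F
      refine ⟨C, fun n hn => ?_⟩
      have := hC n hn
      rw [pow_succ, ← mul_assoc, mul_comm] at this
      have h := Nat.le_of_mul_le_mul_right this (Nat.lt_of_lt_of_le Nat.zero_lt_one hn)
      convert h <;> rfl
    obtain ⟨L, hL, hLn⟩ := step (hG.subgroup H) φ.ker t hcov hNfg (ih _ hNfg hNpg)
    refine ⟨L.map H.subtype, ?_, ?_⟩
    · rw [Subgroup.index_map_subtype]
      exact mul_ne_zero hL hH
    · exact Group.nilpotent_of_mulEquiv (L.equivMapOfInjective _ H.subtype_injective)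

end Gromov

/-- Gromov (1981): a finitely generated group has polynomial growth if and only if it
contains a nilpotent subgroup of finite index. -/
theorem gromov_polynomial_growth {Γ : Type*} [Group Γ]
    (S : Finset Γ) (hgen : Subgroup.closure (S : Set Γ) = ⊤) :
    (∃ C : ℝ, 0 < C ∧ ∃ d : ℕ, ∀ k : ℕ, 1 ≤ k →
        (((((S : Set Γ) ∪ (S : Set Γ)⁻¹ ∪ {1}) ^ k).ncard : ℝ)) ≤ C * (k : ℝ) ^ d) ↔
      ∃ H : Subgroup Γ, H.index ≠ 0 ∧ Group.IsNilpotent H := by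
  classical
  have hT : ∃ T : Finset Γ, (T : Set Γ) = (S : Set Γ) ∪ (S : Set Γ)⁻¹ ∪ {1} :=
    ⟨S ∪ S⁻¹ ∪ {1}, by push_cast; rfl⟩
  obtain ⟨T, hT⟩ := hT
  have hfg : Group.FG Γ := ⟨⟨S, hgen⟩⟩
  rw [← hT]
  have hcard : ∀ k : ℕ, ((T : Set Γ) ^ k).ncard = (T ^ k).card := by
    intro k
    rw [← Finset.coe_pow, Set.ncard_coe_finset]
  simp only [hcard]
  constructor
  · rintro ⟨C, hC0, d, hC⟩
    refine Gromov.main d Γ hfg ?_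
    have hC' : ∀ n : ℕ, 1 ≤ n → (T ^ n).card ≤ ⌈C⌉₊ * n ^ d := by
      intro n hn
      have h2 : (0 : ℝ) ≤ (n : ℝ) ^ d := by positivity
      have h3 : ((T ^ n).card : ℝ) ≤ ((⌈C⌉₊ * n ^ d : ℕ) : ℝ) := by
        push_cast
        exact (hC n hn).trans (mul_le_mul_of_nonneg_right (Nat.le_ceil C) h2)
      exact_mod_cast h3
    have hm : ∀ x, x ∈ T ↔ x ∈ (S : Set Γ) ∪ (S : Set Γ)⁻¹ ∪ {1} := by
      intro x; rw [← hT, Finset.mem_coe]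
    refine Gromov.PG.of_gen (C := ⌈C⌉₊) T ((hm 1).2 (Or.inr rfl)) ?_ ?_ ?_
    · intro x hx
      rw [hm] at hx ⊢
      rcases hx with (hx | hx) | hx
      · exact Or.inl (Or.inr (by simpa using hx))
      · exact Or.inl (Or.inl hx)
      · rw [Set.mem_singleton_iff] at hx
        exact Or.inr (by simp [hx])
    · rw [eq_top_iff, ← hgen]
      refine Subgroup.closure_mono fun x hx => ?_
      rw [hT]
      exact Or.inl (Or.inl hx)
    · intro n hn
      convert hC' n hn
  · rintro ⟨H, hH, hnil⟩
    obtain ⟨d, hd⟩ := Gromov.pg_of_virtually_nilpotent hfg H hH hnil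
    obtain ⟨C, hC⟩ := hd T
    refine ⟨C + 1, by positivity, d, fun k hk => ?_⟩
    have h1 : (T ^ k).card ≤ C * k ^ d := by
      convert hC k hk
    have h2 : ((T ^ k).card : ℝ) ≤ C * (k : ℝ) ^ d := by exact_mod_cast h1
    have : (0 : ℝ) ≤ (k : ℝ) ^ d := by positivity
    linarith
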